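/- Second symmetry relation of the Griffiths polynomials of q-Racah type (exchange of degrees): for all nonnegative integers i, j, x, y with i+j ≤ N and x+y ≤ N, one has G_{i,j}(x,y;c₁,c₂,c₃,c₄;N) = (c₀/c₁)^{i/2}(c₃/c₁)^{j/2}(c₁/c₀)^{x/2}(c₁/c₄)^{y/2}·[ξ_i(c₂,c₃)ξ_j(c₀,c₄)/(ξ_x(c₂,c₄)ξ_y(c₀,c₃))]·[ω_y(c₁c₃c₀/c₂)/ω_x(c₂c₄c₁/c₀)]·ω_N(qc₁c₂c₄)·Ĝ_{j,i}(x,y), where Ĝ_{j,i}(x,y) denotes the Griffiths polynomial G_{j,i}(x,y;c₁⁻¹,c₄⁻¹,c₀⁻¹,c₂⁻¹;N) built with base q⁻¹ (chosen square root s⁻¹) and parameters c₁⁻¹,c₄⁻¹,c₀⁻¹,c₂⁻¹ (chosen square roots t₁⁻¹,t₄⁻¹,t₀⁻¹,t₂⁻¹); the induced fifth parameter for Ĝ is then c₃⁻¹. -/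

import Mathlib

noncomputable section
namespace qR

/-- q-Pochhammer symbol `(a;q)_k = ∏_{l<k} (1 - a qˡ)`. -/
def poch (q a : ℂ) (k : ℕ) : ℂ := ∏ l ∈ Finset.range k, (1 - a * q ^ l)

/-- q-binomial coefficient, zero outside `0 ≤ n ≤ N`. -/
def binom (q : ℂ) (N n : ℤ) : ℂ :=
  if 0 ≤ n ∧ n ≤ N then poch q q N.toNat / (poch q q n.toNat * poch q q (N - n).toNat) else 0

/-- Normalisation `Ω(n;c1,c2,c3;N)`; `s` and `t2` are the chosen square roots of `q` and `c2`,
so that `(q c2)^(n - N/2) = (s t2)^(2n - N)`. -/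
def Om (q s c1 c2 c3 t2 : ℂ) (N n : ℤ) : ℂ :=
  binom q N n * (1 - c2 * c3 * q ^ (2 * n + 1)) * poch q (q * c2) n.toNat
      * poch q (c1 * c2 * c3 * q ^ (N + 2)) n.toNat * poch q (q * c1) (N - n).toNat
    / ((s * t2) ^ (2 * n - N) * poch q (c2 * c3 * q ^ (n + 1)) (N + 1).toNat
        * poch q (q * c3) n.toNat)

/-- Normalised q-Racah polynomial `p_n(x;c1,c2,c3;N)`, with the convention that it
vanishes unless `0 ≤ n ≤ N` and `0 ≤ x ≤ N`. -/
def p (q s c1 c2 c3 t2 : ℂ) (N n x : ℤ) : ℂ :=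
  if 0 ≤ n ∧ n ≤ N ∧ 0 ≤ x ∧ x ≤ N then
    Om q s c1 c2 c3 t2 N n *
      ∑ k ∈ Finset.range (n.toNat + 1),
        poch q (q ^ (-n)) k * poch q (c2 * c3 * q ^ (n + 1)) k * poch q (q ^ (-x)) k
            * poch q (c1 * c2 * q ^ (x + 1)) k * q ^ k
          / (poch q (q * c2) k * poch q (c1 * c2 * c3 * q ^ (N + 2)) k
              * poch q (q ^ (-N)) k * poch q q k)
  else 0

/-- `ω_n(c) = (-1)^n c^{n/2} q^{n(n+1)/2}`, where `r` is the chosen square root of `c`. -/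
def om (q r : ℂ) (n : ℤ) : ℂ := (-1 : ℂ) ^ n * r ^ n * q ^ (n * (n + 1) / 2)

/-- `ξ_n(c1,c2) = ((qc1;q)_n/(qc2;q)_n) (c2/c1)^{n/2}`, where `t1, t2` are the chosen
square roots of `c1, c2`. -/
def xi (q c1 c2 t1 t2 : ℂ) (n : ℤ) : ℂ :=
  poch q (q * c1) n.toNat / poch q (q * c2) n.toNat * (t2 / t1) ^ n

/-- `λ(x;c) = -(1-q^{-x})(1-c q^{x+1})`. -/
def lam (q c : ℂ) (x : ℤ) : ℂ := -(1 - q ^ (-x)) * (1 - c * q ^ (x + 1))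

def PhiP (q c1 c2 c3 : ℂ) (N n : ℤ) : ℂ :=
  -c2 * q ^ (n - N) * (1 - q ^ n) * (1 - c1 * q ^ (N - n + 1)) * (1 - c2 * c3 * q ^ (n + N + 1))
      * (1 - c3 * q ^ n)
    / ((1 - c2 * c3 * q ^ (2 * n)) * (1 - c2 * c3 * q ^ (2 * n + 1)))

def PhiM (q c1 c2 c3 : ℂ) (N n : ℤ) : ℂ :=
  (1 - q ^ (n - N)) * (1 - c1 * c2 * c3 * q ^ (n + N + 2)) * (1 - c2 * q ^ (n + 1))
      * (1 - c2 * c3 * q ^ (n + 1))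
    / ((1 - c2 * c3 * q ^ (2 * n + 1)) * (1 - c2 * c3 * q ^ (2 * n + 2)))

/-- `Φ^ε(n;c1,c2,c3;N)`, where `ε = 1, -1, 0` selects `Φ⁺, Φ⁻, Φ⁰`. -/
def Phi (q c1 c2 c3 : ℂ) (N ε n : ℤ) : ℂ :=
  if ε = 1 then PhiP q c1 c2 c3 N n
  else if ε = -1 then PhiM q c1 c2 c3 N n
  else -PhiP q c1 c2 c3 N n - PhiM q c1 c2 c3 N n

/-- `λ₊(x;c1,c2,c3;N)`. -/
def lamP (q c1 c2 c3 : ℂ) (N x : ℤ) : ℂ :=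
  -(q ^ (-N - 1) / c3 - q ^ (-x)) * (1 - c1 * c2 * c3 * q ^ (N + x + 2))

/-- `λ₋(x;c1,c2,c3;N)`. -/
def lamM (q c1 c2 c3 : ℂ) (N x : ℤ) : ℂ :=
  -(q ^ (-N) - q ^ (-x)) * (1 - c1 * c2 * q ^ (N + x + 1))

def PhiPp (q sq c1 c2 c3 : ℂ) (N n : ℤ) : ℂ :=
  -sq * c2 * q ^ (2 * n - N - 1) * (1 - q ^ n) * (1 - c1 * q ^ (N - n + 1))
      * (1 - c1 * q ^ (N + 2 - n)) * (1 - c3 * q ^ n)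
    / ((1 - c2 * c3 * q ^ (2 * n)) * (1 - c2 * c3 * q ^ (2 * n + 1)))

def PhiPm (q sq c1 c2 c3 : ℂ) (N n : ℤ) : ℂ :=
  -((1 - c1 * c2 * c3 * q ^ (n + N + 2)) * (1 - c1 * c2 * c3 * q ^ (n + N + 3))
      * (1 - c2 * q ^ (n + 1)) * (1 - c2 * c3 * q ^ (n + 1)))
    / (c3 * q ^ (N + 1) * sq * (1 - c2 * c3 * q ^ (2 * n + 1)) * (1 - c2 * c3 * q ^ (2 * n + 2)))

def PhiP0 (q sq c1 c2 c3 : ℂ) (N n : ℤ) : ℂ :=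
  -PhiPp q sq c1 c2 c3 N n - PhiPm q sq c1 c2 c3 N n
    - (1 - c1 * c2 * q ^ (N + 2)) * (1 - c1 * c2 * c3 * q ^ (N + 2)) / (c3 * q ^ (N + 1) * sq)

def PhiMp (q sq c1 c2 c3 : ℂ) (N n : ℤ) : ℂ :=
  -sq * (1 - q ^ n) * (1 - c3 * q ^ n) * (1 - c2 * c3 * q ^ (n + N))
      * (1 - c2 * c3 * q ^ (n + N + 1))
    / (q ^ N * (1 - c2 * c3 * q ^ (2 * n)) * (1 - c2 * c3 * q ^ (2 * n + 1)))

def PhiMm (q sq c1 c2 c3 : ℂ) (N n : ℤ) : ℂ :=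
  -c3 * sq * q ^ N * (1 - q ^ (n - N)) * (1 - q ^ (n - N + 1)) * (1 - c2 * q ^ (n + 1))
      * (1 - c2 * c3 * q ^ (n + 1))
    / ((1 - c2 * c3 * q ^ (2 * n + 1)) * (1 - c2 * c3 * q ^ (2 * n + 2)))

def PhiM0 (q sq c1 c2 c3 : ℂ) (N n : ℤ) : ℂ :=
  -PhiMp q sq c1 c2 c3 N n - PhiMm q sq c1 c2 c3 N n - sq * (1 - c3 * q ^ N) * (q ^ (-N) - 1)

/-- Contiguity coefficient `Φ_σ^ε(n;c1,c2,c3;N)`, where `σ = 1` is the `+` and `σ = -1`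
the `-` family, `ε ∈ {1,0,-1}` selects the superscript, and `sq` is the chosen square
root of `q c2`. -/
def PhiC (q sq c1 c2 c3 : ℂ) (σ ε N n : ℤ) : ℂ :=
  if σ = 1 then
    if ε = 1 then PhiPp q sq c1 c2 c3 N n
    else if ε = -1 then PhiPm q sq c1 c2 c3 N n
    else PhiP0 q sq c1 c2 c3 N n
  else
    if ε = 1 then PhiMp q sq c1 c2 c3 N n
    else if ε = -1 then PhiMm q sq c1 c2 c3 N n
    else PhiM0 q sq c1 c2 c3 N n

def Fp (q c1 c2 : ℂ) (x : ℤ) : ℂ :=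
  c1 * c2 ^ 2 * q ^ (x + 1) * (1 - c1 * q ^ x) * (1 - q ^ x)
    / ((1 - c1 * c2 * q ^ (2 * x)) * (1 - c1 * c2 * q ^ (2 * x + 1)))

def Fm (q c1 c2 : ℂ) (x : ℤ) : ℂ :=
  c1 * c2 * q ^ (x + 1) * (1 - c2 * q ^ (x + 1)) * (1 - c1 * c2 * q ^ (x + 1))
    / ((1 - c1 * c2 * q ^ (2 * x + 1)) * (1 - c1 * c2 * q ^ (2 * x + 2)))

/-- The coefficients `A^{ε,ε'}_{i,j}(c1,c2,c3,c4;N)` for `(ε,ε') ≠ (0,0)`;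
`t2` is the chosen square root of `c2` and the fifth parameter
`c0 = (q^{2N+3} c1 c2 c3 c4)⁻¹` is computed internally. -/
def Aaux (q s c1 c2 c3 c4 t2 : ℂ) (N ε ε' i j : ℤ) : ℂ :=
  if ε' = 1 ∨ ε' = -1 then
    -c3 * q ^ (N + 1) *
        (if ε' = 1 then Fp q c4 ((q ^ (2 * N + 3) * c1 * c2 * c3 * c4)⁻¹) j
         else Fm q c4 ((q ^ (2 * N + 3) * c1 * c2 * c3 * c4)⁻¹) j) *
        PhiC q (s * t2) c1 c2 c3 ε' ε (N - j) i
  else if ε = 1 ∨ ε = -1 then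
    c3 * q ^ (N + 1) *
        (Fp q c4 ((q ^ (2 * N + 3) * c1 * c2 * c3 * c4)⁻¹) j
          + Fm q c4 ((q ^ (2 * N + 3) * c1 * c2 * c3 * c4)⁻¹) j) *
        Phi q c1 c2 c3 (N - j) ε i
  else 0

/-- The coefficients `A^{ε,ε'}_{i,j}(c1,c2,c3,c4;N)`. -/
def A (q s c1 c2 c3 c4 t2 : ℂ) (N ε ε' i j : ℤ) : ℂ :=
  if ε = 0 ∧ ε' = 0 then
    -((1 - c3 * q ^ (N + 1 - j)) * (s * t2) / (1 - c1 * c2 * q ^ (N + 2 - j)))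
          * ∑ e ∈ ({-1, 0, 1} : Finset ℤ), Aaux q s c1 c2 c3 c4 t2 N e 1 i j
      - (1 - c1 * c2 * q ^ (N + 1 - j)) / ((1 - c3 * q ^ (N - j)) * (s * t2))
          * ∑ e ∈ ({-1, 0, 1} : Finset ℤ), Aaux q s c1 c2 c3 c4 t2 N e (-1) i j
      - ∑ e ∈ ({-1, 1} : Finset ℤ), Aaux q s c1 c2 c3 c4 t2 N e 0 i j
  else Aaux q s c1 c2 c3 c4 t2 N ε ε' i j

/-- `Λ(x;c1,c2,c3,c4;N)`; `s, t1, t2, t3, t4` are the chosen square roots of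
`q, c1, c2, c3, c4`. -/
def Lam (q s c1 c2 c3 c4 t1 t2 t3 t4 : ℂ) (N x : ℤ) : ℂ :=
  (-1 : ℂ) ^ x * binom q N x * (1 - c1 * c2 * q ^ (2 * x + 1)) * poch q (q * c2) x.toNat
      * (s * t2) ^ N * (t1 * t3 / (t2 * t4)) ^ x * q ^ (x * (x - 1) / 2)
    / (poch q (q * c1) x.toNat * poch q (q ^ (x + 1) * c1 * c2) (N + 1).toNat)

/-- Tratnik polynomial of q-Racah type `T_{i,j}(x,y;c1,c2,c3,c4;N)`; the fifth parameter
`c0 = (q^{2N+3} c1 c2 c3 c4)⁻¹` and its square root `t0 = (s^{2N+3} t1 t2 t3 t4)⁻¹`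
are computed internally. -/
def T (q s c1 c2 c3 c4 t1 t2 t3 t4 : ℂ) (N i j x y : ℤ) : ℂ :=
  if 0 ≤ i ∧ 0 ≤ j ∧ i + j ≤ N then
    p q s c1 c2 c3 t2 (N - j) i x *
      p q s c3 ((q ^ (2 * N + 3) * c1 * c2 * c3 * c4)⁻¹) c4
        ((s ^ (2 * N + 3) * t1 * t2 * t3 * t4)⁻¹) (N - x) j y
  else 0

/-- Griffiths polynomial of q-Racah type `G_{i,j}(x,y;c1,c2,c3,c4;N)`; the fifth parameter
`c0 = (q^{2N+3} c1 c2 c3 c4)⁻¹` and its square root `t0 = (s^{2N+3} t1 t2 t3 t4)⁻¹`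
are computed internally. -/
def G (q s c1 c2 c3 c4 t1 t2 t3 t4 : ℂ) (N i j x y : ℤ) : ℂ :=
  if 0 ≤ i ∧ 0 ≤ j ∧ i + j ≤ N then
    ∑ a ∈ Finset.range ((min (N - j) (N - y)).toNat + 1),
      om q (t1 * t2 * t3 / t4) (a : ℤ) * p q s c1 c2 c3 t2 (N - j) i (a : ℤ) *
        p q s c3 ((q ^ (2 * N + 3) * c1 * c2 * c3 * c4)⁻¹) c4
          ((s ^ (2 * N + 3) * t1 * t2 * t3 * t4)⁻¹) (N - (a : ℤ)) j y *
        p q s c4 c2 c1 t2 (N - y) (a : ℤ) x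
  else 0

end qR

namespace gs
open qR Finset
local notation "ø" => (by omega)
local notation "Ψ" => qR.poch

lemma poch_zero (q a : ℂ) : Ψ q a 0 = 1 := by simp [poch]
lemma poch_succ (q a : ℂ) (k : ℕ) : Ψ q a (k+1) = Ψ q a k * (1 - a*q^k) := by
  simp [poch, prod_range_succ]
lemma poch_succ' (q a : ℂ) (k : ℕ) : Ψ q a (k+1) = (1 - a) * Ψ q (a*q) k := by
  simp only [poch, prod_range_succ', pow_zero, mul_one]
  rw [mul_comm]; congr 1
  apply prod_congr rfl; intros; ring
lemma poch_shift (q a : ℂ) (k : ℕ) : (1 - a) * Ψ q (a*q) k = Ψ q a k * (1 - a*q^k) := by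
  rw [← poch_succ', poch_succ]
lemma poch_ne (q a : ℂ) (k : ℕ) (h : ∀ l < k, 1 - a*q^l ≠ 0) : Ψ q a k ≠ 0 := by
  rw [poch, prod_ne_zero_iff]; intro l hl; exact h l (mem_range.1 hl)
lemma poch_eq_zero (q a : ℂ) (k l : ℕ) (hl : l < k) (h : a*q^l = 1) : Ψ q a k = 0 := by
  rw [poch, prod_eq_zero_iff]; exact ⟨l, mem_range.2 hl, by rw [h]; ring⟩
/-- one summand -/
def tm (q A B C D e f g : ℂ) (k : ℕ) : ℂ :=
  Ψ q A k * Ψ q B k * Ψ q C k * Ψ q D k * q^k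
    / (Ψ q e k * Ψ q f k * Ψ q g k * Ψ q q k)
def ph (q A B C D e f g : ℂ) (K : ℕ) : ℂ := ∑ k ∈ range K, tm q A B C D e f g k
lemma ph_succ (q A B C D e f g : ℂ) (K : ℕ) :
    ph q A B C D e f g (K+1) = ph q A B C D e f g K + tm q A B C D e f g K := by
  simp [ph, sum_range_succ]
lemma ph_swapAC (q A B C D e f g : ℂ) (K : ℕ) :
    ph q A B C D e f g K = ph q C D A B e f g K := by
  unfold ph; apply sum_congr rfl; intros; unfold tm; ring
lemma ph_swapfg (q A B C D e f g : ℂ) (K : ℕ) :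
    ph q A B C D e f g K = ph q A B C D e g f K := by
  unfold ph; apply sum_congr rfl; intros; unfold tm; congr 1; ring
lemma ph_trunc (q A B C D e f g : ℂ) (n K : ℕ) (hA : A * q^n = 1) (hK : n < K) :
    ph q A B C D e f g K = ph q A B C D e f g (n+1) := by
  unfold ph
  symm
  apply sum_subset (range_subset_range.2 hK)
  intro k _ hk
  simp only [mem_range, not_lt] at hk
  unfold tm
  rw [poch_eq_zero q A k n ø hA]; ring
lemma R2 (q A B C D e f g : ℂ) (K : ℕ) (hf : ∀ k < K, 1 - f*q^k ≠ 0) :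
    (1-f)*(B-A)*ph q A B C D e f g K
      = (1-B)*(f-A)*ph q A (B*q) C D e (f*q) g K + (1-A)*(B-f)*ph q (A*q) B C D e (f*q) g K := by
  unfold ph
  rw [mul_sum, mul_sum, mul_sum, ← sum_add_distrib]
  apply sum_congr rfl
  intro k hk
  have hk := mem_range.1 hk
  have h1 := hf k hk
  have h0 := hf 0 ø
  rw [pow_zero, mul_one] at h0
  have hp : Ψ q f k ≠ 0 := poch_ne _ _ _ (fun l hl => hf l ø)
  have e1 := poch_shift q A k
  have e2 := poch_shift q B k
  have e3 : Ψ q (f*q) k = Ψ q f k * (1-f*q^k)/(1-f) := by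
    rw [eq_div_iff h0, mul_comm, poch_shift]
  unfold tm
  rw [e3]
  have E1 : (1-B)*(f-A)*(Ψ q A k * Ψ q (B*q) k * Ψ q C k * Ψ q D k * q^k
    / (Ψ q e k * (Ψ q f k * (1-f*q^k)/(1-f)) * Ψ q g k * Ψ q q k))
    = (f-A)*(Ψ q A k * (Ψ q B k*(1-B*q^k)) * Ψ q C k * Ψ q D k * q^k
    / (Ψ q e k * (Ψ q f k * (1-f*q^k)/(1-f)) * Ψ q g k * Ψ q q k)) := by rw [← e2]; ring
  have E2 : (1-A)*(B-f)*(Ψ q (A*q) k * Ψ q B k * Ψ q C k * Ψ q D k * q^k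
    / (Ψ q e k * (Ψ q f k * (1-f*q^k)/(1-f)) * Ψ q g k * Ψ q q k))
    = (B-f)*((Ψ q A k*(1-A*q^k)) * Ψ q B k * Ψ q C k * Ψ q D k * q^k
    / (Ψ q e k * (Ψ q f k * (1-f*q^k)/(1-f)) * Ψ q g k * Ψ q q k)) := by rw [← e1]; ring
  rw [E1, E2]
  generalize Ψ q A k = pA
  generalize Ψ q B k = pB
  generalize Ψ q C k = pC
  generalize Ψ q D k = pD
  generalize Ψ q e k = pe
  generalize Ψ q g k = pg
  generalize Ψ q q k = pq
  generalize Ψ q f k = pf at *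
  generalize q^k = Z at *
  have : ∀ X, X/(pe * (pf * (1-f*Z)/(1-f)) * pg * pq) = X/(pe*pg*pq) * ((1-f)/(pf*(1-f*Z))) := by
    intro X; field_simp
  rw [this, this]
  have : ∀ X, X/(pe*pf*pg*pq) = X/(pe*pg*pq)/pf := by intro X; field_simp
  rw [this]
  field_simp
  ring
lemma mc {a b : ℂ} (h : 1 - a*b ≠ 0) : 1 - b*a ≠ 0 := by rwa [mul_comm]
lemma R1_alg (A B C D e f g Z : ℂ) (hA : A ≠ 0) (hB : B ≠ 0) (hAB : B - A ≠ 0)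
    (he : 1 - e*Z ≠ 0) (hf : 1 - f*Z ≠ 0) (hg : 1 - g*Z ≠ 0) (hZ : 1 - Z ≠ 0) :
    (1-C)*(1-D)*Z/(1-Z)
      = (e-A)*(f-A)*(g-A)*(1-B*Z)*(1-C*Z)*(1-D*Z)*Z/((B-A)*A*(1-e*Z)*(1-f*Z)*(1-g*Z)*(1-Z))
      - (e-B)*(f-B)*(g-B)*(1-A*Z)*(1-C*Z)*(1-D*Z)*Z/((B-A)*B*(1-e*Z)*(1-f*Z)*(1-g*Z)*(1-Z))
      + (1-A*Z)*(1-B*Z)*(1-C*Z)*(1-D*Z)*(1-e*f*g/(A*B)*Z)/((1-e*Z)*(1-f*Z)*(1-g*Z)*(1-Z))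
      - (1-C*D*Z) := by
  have he' := mc he
  have hf' := mc hf
  have hg' := mc hg
  field_simp
  ring
lemma ph_truncC (q A B C D e f g : ℂ) (n K : ℕ) (hC : C * q^n = 1) (hK : n < K) :
    ph q A B C D e f g K = ph q A B C D e f g (n+1) := by
  rw [ph_swapAC, ph_trunc _ _ _ _ _ _ _ _ n K hC hK, ph_swapAC]
def al (A B e f g : ℂ) : ℂ := (1-B)*(e-A)*(f-A)*(g-A)/((1-e)*(1-f)*(1-g)*(B-A)*A)
lemma T1_alg (b x pA pB' pC pD cz dz Z pe pf pg pq ue uf ug uz e1 f1 g1 w A : ℂ) (he : e1 ≠ 0) (hf : f1 ≠ 0)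
    (hg : g1 ≠ 0) :
    b*x/(e1*f1*g1*w*A) * (pA * pB' * (pC*cz) * (pD*dz) * Z / (pe*ue/e1*(pf*uf/f1)*(pg*ug/g1)*(pq*uz)))
     = pA*(b*pB')*pC*pD/(pe*pf*pg*pq) * (x*cz*dz*Z/(w*A*ue*uf*ug*uz)) := by
  have : pe*ue/e1*(pf*uf/f1)*(pg*ug/g1)*(pq*uz) = (pe*pf*pg*pq)*(ue*uf*ug*uz)/(e1*f1*g1) := by
    field_simp
  rw [this]
  have h2 : e1*f1*g1 ≠ 0 := by positivity
  generalize (pe*pf*pg*pq) = p1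
  rw [show w*A*ue*uf*ug*uz = w*A*(ue*uf*ug*uz) by ring]
  generalize ue*uf*ug*uz = u1
  rw [show e1*f1*g1*w*A = e1*f1*g1*(w*A) by ring]
  generalize e1*f1*g1 = v at *
  generalize w*A = z1
  rw [div_div_eq_mul_div, div_mul_div_comm, div_mul_div_comm]
  by_cases hp : p1 = 0
  · simp [hp]
  by_cases hu : u1 = 0
  · simp [hu]
  by_cases hz : z1 = 0
  · simp [hz]
  field_simp
lemma R1_part (q A B C D e f g : ℂ) (hA : A ≠ 0) (hB : B ≠ 0) (hAB : B - A ≠ 0)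
    (hbal : e*f*g = q*A*B*C*D) (m : ℕ)
    (he : ∀ k ≤ m, 1 - e*q^k ≠ 0) (hf : ∀ k ≤ m, 1 - f*q^k ≠ 0) (hg : ∀ k ≤ m, 1 - g*q^k ≠ 0)
    (hq : ∀ k < m, 1 - q*q^k ≠ 0) :
    ph q A B C D e f g (m+1) = al A B e f g * ph q A (B*q) (C*q) (D*q) (e*q) (f*q) (g*q) (m+1)
      + al B A e f g * ph q (A*q) B (C*q) (D*q) (e*q) (f*q) (g*q) (m+1)
      + Ψ q A (m+1) * Ψ q B (m+1) * Ψ q (C*q) m * Ψ q (D*q) m * (1 - C*D*q^(m+1))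
        / (Ψ q e (m+1) * Ψ q f (m+1) * Ψ q g (m+1) * Ψ q q m) := by
  have hBA : A - B ≠ 0 := fun h => hAB (by linear_combination -h)
  have he0 : 1 - e ≠ 0 := by simpa using he 0 ø
  have hf0 : 1 - f ≠ 0 := by simpa using hf 0 ø
  have hg0 : 1 - g ≠ 0 := by simpa using hg 0 ø
  have hr : C*D*q = e*f*g/(A*B) := by rw [hbal]; field_simp
  induction m with
  | zero =>
    simp only [ph, zero_add, range_one, sum_singleton, tm, poch_zero, poch_succ, pow_zero, mul_one, pow_one, one_mul, div_one]
    have : C*D*q = e*f*g/(A*B) := hr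
    rw [this]
    unfold al
    have hX : (A-B) = -(B-A) := by ring
    rw [hX]
    field_simp
    ring
  | succ m ih =>
    rw [ph_succ, ph_succ _ A (B*q), ph_succ _ (A*q), ih (fun k hk => he k ø) (fun k hk => hf k ø)
      (fun k hk => hg k ø) (fun k hk => hq k ø)]
    have ne : Ψ q e (m+1) ≠ 0 := poch_ne _ _ _ (fun l hl => he l ø)
    have nf : Ψ q f (m+1) ≠ 0 := poch_ne _ _ _ (fun l hl => hf l ø)
    have ng : Ψ q g (m+1) ≠ 0 := poch_ne _ _ _ (fun l hl => hg l ø)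
    have nq : Ψ q q m ≠ 0 := poch_ne _ _ _ (fun l hl => hq l ø)
    have h1 := he (m+1) le_rfl
    have h2 := hf (m+1) le_rfl
    have h3 := hg (m+1) le_rfl
    have h4 := hq m ø
    have h4' : 1 - q^(m+1) ≠ 0 := by rwa [pow_succ']
    have key := R1_alg A B C D e f g (q^(m+1)) hA hB hAB h1 h2 h3 h4'
    unfold tm
    rw [poch_succ q q m, poch_succ q A (m+1), poch_succ q B (m+1), poch_succ q e (m+1), poch_succ q f (m+1), poch_succ q g (m+1)]
    rw [poch_succ' q C m, poch_succ' q D m, poch_succ q (C*q) m, poch_succ q (D*q) m]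
    have e3 : Ψ q (e*q) (m+1) = Ψ q e (m+1) * (1-e*q^(m+1))/(1-e) := by
      rw [eq_div_iff he0, mul_comm, poch_shift]
    have f3 : Ψ q (f*q) (m+1) = Ψ q f (m+1) * (1-f*q^(m+1))/(1-f) := by
      rw [eq_div_iff hf0, mul_comm, poch_shift]
    have g3 : Ψ q (g*q) (m+1) = Ψ q g (m+1) * (1-g*q^(m+1))/(1-g) := by
      rw [eq_div_iff hg0, mul_comm, poch_shift]
    have a1 := poch_shift q A (m+1)
    have b1 := poch_shift q B (m+1)
    rw [e3, f3, g3]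
    have hCD : C*D*q^(m+1+1) = e*f*g/(A*B) * q^(m+1) := by rw [← hr]; ring
    have i1 : q * q^m = q^(m+1) := by ring
    have i2 : C*q*q^m = C*q^(m+1) := by ring
    have i3 : D*q*q^m = D*q^(m+1) := by ring
    rw [hCD, i1, i2, i3]
    generalize q^(m+1) = Z at *
    generalize Ψ q e (m+1) = pe at *
    generalize Ψ q f (m+1) = pf at *
    generalize Ψ q g (m+1) = pg at *
    generalize Ψ q q m = pq at *
    generalize Ψ q (C*q) m = pC at *
    generalize Ψ q (D*q) m = pD at *
    generalize Ψ q A (m+1) = pA at *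
    generalize Ψ q B (m+1) = pB at *
    generalize Ψ q (A*q) (m+1) = pA' at *
    generalize Ψ q (B*q) (m+1) = pB' at *
    generalize ph q A (B * q) (C * q) (D * q) (e * q) (f * q) (g * q) (m + 1) = S1
    generalize ph q (A * q) B (C * q) (D * q) (e * q) (f * q) (g * q) (m + 1) = S2
    have T1 : al A B e f g * (pA * pB' * (pC * (1 - C * Z)) * (pD * (1 - D * Z)) * Z /
      (pe * (1 - e * Z) / (1 - e) * (pf * (1 - f * Z) / (1 - f)) * (pg * (1 - g * Z) / (1 - g)) * (pq * (1 - Z))))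
      = pA*pB*pC*pD/(pe*pf*pg*pq) * ((e-A)*(f-A)*(g-A)*(1-B*Z)*(1-C*Z)*(1-D*Z)*Z/((B-A)*A*(1-e*Z)*(1-f*Z)*(1-g*Z)*(1-Z))) := by
      unfold al
      have : pA*pB*pC*pD/(pe*pf*pg*pq) * ((e-A)*(f-A)*(g-A)*(1-B*Z)*(1-C*Z)*(1-D*Z)*Z/((B-A)*A*(1-e*Z)*(1-f*Z)*(1-g*Z)*(1-Z))) = pA*(pB*(1-B*Z))*pC*pD/(pe*pf*pg*pq) * ((e-A)*(f-A)*(g-A)*(1-C*Z)*(1-D*Z)*Z/((B-A)*A*(1-e*Z)*(1-f*Z)*(1-g*Z)*(1-Z))) := by ring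
      rw [this, ← b1]
      have := T1_alg (1-B) ((e-A)*(f-A)*(g-A)) pA pB' pC pD (1-C*Z) (1-D*Z) Z pe pf pg pq (1-e*Z) (1-f*Z) (1-g*Z) (1-Z) (1-e) (1-f) (1-g) (B-A) A he0 hf0 hg0
      rw [show (1-B)*(e-A)*(f-A)*(g-A) = (1-B)*((e-A)*(f-A)*(g-A)) by ring, this]
    have T2 : al B A e f g * (pA' * pB * (pC * (1 - C * Z)) * (pD * (1 - D * Z)) * Z /
      (pe * (1 - e * Z) / (1 - e) * (pf * (1 - f * Z) / (1 - f)) * (pg * (1 - g * Z) / (1 - g)) * (pq * (1 - Z))))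
      = -(pA*pB*pC*pD/(pe*pf*pg*pq) * ((e-B)*(f-B)*(g-B)*(1-A*Z)*(1-C*Z)*(1-D*Z)*Z/((B-A)*B*(1-e*Z)*(1-f*Z)*(1-g*Z)*(1-Z)))) := by
      unfold al
      have : pA*pB*pC*pD/(pe*pf*pg*pq) * ((e-B)*(f-B)*(g-B)*(1-A*Z)*(1-C*Z)*(1-D*Z)*Z/((B-A)*B*(1-e*Z)*(1-f*Z)*(1-g*Z)*(1-Z))) = (pA*(1-A*Z))*pB*pC*pD/(pe*pf*pg*pq) * ((e-B)*(f-B)*(g-B)*(1-C*Z)*(1-D*Z)*Z/((B-A)*B*(1-e*Z)*(1-f*Z)*(1-g*Z)*(1-Z))) := by ring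
      rw [this, ← a1]
      have := T1_alg (1-A) ((e-B)*(f-B)*(g-B)) pB pA' pC pD (1-C*Z) (1-D*Z) Z pe pf pg pq (1-e*Z) (1-f*Z) (1-g*Z) (1-Z) (1-e) (1-f) (1-g) (A-B) B he0 hf0 hg0
      rw [show (1-A)*(e-B)*(f-B)*(g-B) = (1-A)*((e-B)*(f-B)*(g-B)) by ring, show pA' * pB = pB*pA' by ring, this]
      have hX : (A-B) = -(B-A) := by ring
      rw [hX, show (-(B - A) * B * (1 - e * Z) * (1 - f * Z) * (1 - g * Z) * (1 - Z)) = -((B - A) * B * (1 - e * Z) * (1 - f * Z) * (1 - g * Z) * (1 - Z)) by ring, div_neg]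
      ring
    have T3 : pA * pB * ((1 - C) * pC) * ((1 - D) * pD) * Z / (pe * pf * pg * (pq * (1 - Z))) = pA*pB*pC*pD/(pe*pf*pg*pq) * ((1-C)*(1-D)*Z/(1-Z)) := by
      field_simp
    rw [mul_add, mul_add, T1, T2, T3, key]
    have T4 : ∀ w : ℂ, pA * (1 - A * Z) * (pB * (1 - B * Z)) * (pC * (1 - C * Z)) * (pD * (1 - D * Z)) * w /
      (pe * (1 - e * Z) * (pf * (1 - f * Z)) * (pg * (1 - g * Z)) * (pq * (1 - Z))) = pA*pB*pC*pD/(pe*pf*pg*pq) * ((1-A*Z)*(1-B*Z)*(1-C*Z)*(1-D*Z)*w/((1-e*Z)*(1-f*Z)*(1-g*Z)*(1-Z))) := by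
      intro w; rw [div_mul_div_comm]; congr 1 <;> ring
    rw [T4]
    ring
/-- terminating version -/
lemma R1 (q A B C D e f g : ℂ) (hA : A ≠ 0) (hB : B ≠ 0) (hAB : B - A ≠ 0)
    (hbal : e*f*g = q*A*B*C*D) (n K : ℕ) (hn : 1 ≤ n) (hC : C * q^n = 1) (hK : n < K)
    (he : ∀ k < n, 1 - e*q^k ≠ 0) (hf : ∀ k < n, 1 - f*q^k ≠ 0) (hg : ∀ k < n, 1 - g*q^k ≠ 0)
    (hq : ∀ k < n, 1 - q*q^k ≠ 0) :
    ph q A B C D e f g K = al A B e f g * ph q A (B*q) (C*q) (D*q) (e*q) (f*q) (g*q) K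
      + al B A e f g * ph q (A*q) B (C*q) (D*q) (e*q) (f*q) (g*q) K := by
  obtain ⟨m, rfl⟩ : ∃ m, n = m+1 := ⟨n-1, by omega⟩
  have hC' : C*q*q^m = 1 := by rw [← hC]; ring
  rw [ph_truncC _ _ _ _ _ _ _ _ (m+1) K hC hK, ph_truncC _ _ _ _ _ _ _ _ m K hC' ø,
    ph_truncC _ _ _ _ _ _ _ _ m K hC' ø]
  rw [ph_succ, R1_part q A B C D e f g hA hB hAB hbal m (fun k hk => he k ø) (fun k hk => hf k ø)
      (fun k hk => hg k ø) (fun k hk => hq k ø)]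
  have pq : Ψ q q m ≠ 0 := poch_ne _ _ _ (fun l hl => hq l ø)
  have h4 := hq m ø
  have : Ψ q A (m+1) * Ψ q B (m+1) * Ψ q (C*q) m * Ψ q (D*q) m * (1 - C*D*q^(m+1))
        / (Ψ q e (m+1) * Ψ q f (m+1) * Ψ q g (m+1) * Ψ q q m)
        + tm q A B C D e f g (m+1) = 0 := by
    unfold tm
    rw [poch_succ' q C m, poch_succ' q D m, poch_succ q q m]
    have i1 : C*D*q^(m+1) = D := by linear_combination D*hC
    have i2 : (1-C)*q^(m+1) = -(1-q*q^m) := by linear_combination -hC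
    rw [i1]
    have : Ψ q A (m + 1) * Ψ q B (m + 1) * ((1 - C) * Ψ q (C * q) m) * ((1 - D) * Ψ q (D * q) m) * q ^ (m + 1)
      = Ψ q A (m + 1) * Ψ q B (m + 1) * Ψ q (C * q) m * ((1 - D) * Ψ q (D * q) m) * ((1-C)*q ^ (m + 1)) := by ring
    rw [this, i2]
    generalize Ψ q e (m+1) * Ψ q f (m+1) * Ψ q g (m+1) = pd
    rw [show pd * (Ψ q q m * (1 - q*q^m)) = pd * Ψ q q m * (1-q*q^m) by ring]
    by_cases hd : pd = 0
    · simp [hd]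
    field_simp
    ring
  linear_combination this
lemma R6_alg (a B C D e φ g Z : ℂ) (haB : a - B ≠ 0) (hφ : φ ≠ 0) (hC : C ≠ 0) (hD : D ≠ 0)
    (hCD : D - C ≠ 0) (he : 1 - e*Z ≠ 0) (hg : 1 - g*Z ≠ 0) :
    a*(φ-B)/(φ*(a-B))*((1-a*Z)*(1-B)*Z) + B*(a-φ)/(φ*(a-B))*((1-a)*(1-B*Z)*Z)
     = (1-a*Z)*(1-B*Z)*(1-D*Z)*(g-C)*(C-e)*Z/(C*(D-C)*(1-e*Z)*(1-g*Z))
      + (1-a*Z)*(1-B*Z)*(1-C*Z)*(D-g)*(D-e)*Z/(D*(D-C)*(1-e*Z)*(1-g*Z))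
      + e*g/(C*D)*Z*((1-a*Z)*(1-B*Z)*(1-C*Z)*(1-D*Z))/((1-e*Z)*(1-g*Z))
      - a*B/φ*Z*((1-φ*Z)*(1-Z)) := by
  have he' := mc he
  have hg' := mc hg
  have h1 : a*(φ-B)/(φ*(a-B))*((1-a*Z)*(1-B)*Z) + B*(a-φ)/(φ*(a-B))*((1-a)*(1-B*Z)*Z)
    = Z*(1 - a*B/φ + Z*(-a - B +a*B+a*B/φ)) := by
    field_simp
    ring
  have h2 : (1-a*Z)*(1-B*Z)*(1-D*Z)*(g-C)*(C-e)*Z/(C*(D-C)*(1-e*Z)*(1-g*Z))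
      + (1-a*Z)*(1-B*Z)*(1-C*Z)*(D-g)*(D-e)*Z/(D*(D-C)*(1-e*Z)*(1-g*Z))
      + e*g/(C*D)*Z*((1-a*Z)*(1-B*Z)*(1-C*Z)*(1-D*Z))/((1-e*Z)*(1-g*Z))
      = (1-a*Z)*(1-B*Z)*Z := by
    field_simp
    ring
  rw [h1, h2]
  field_simp
  ring
def s6 (C D e g : ℂ) : ℂ := (1-D)*(g-C)*(C-e)/((1-g)*(D-C)*(1-e)*C)
lemma T6_alg (b x pA pB pC pD' Z pe pf pg pq ue uf ug uz e1 g1 w : ℂ) (he : e1 ≠ 0)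
    (hg : g1 ≠ 0) :
    b*x/(g1*w*e1) * (pA * pB * pC * pD' * Z / (pe*ue/e1*(pf*uf)*(pg*ug/g1)*(pq*uz)))
     = pA*pB*pC*(b*pD')/(pe*pf*pg*pq) * (x*Z/(w*ue*ug))/(uf*uz) := by
  have : pe*ue/e1*(pf*uf)*(pg*ug/g1)*(pq*uz) = (pe*pf*pg*pq)*(ue*ug)*(uf*uz)/(e1*g1) := by
    field_simp
  rw [this]
  have h2 : e1*g1 ≠ 0 := by positivity
  generalize (pe*pf*pg*pq) = p1
  rw [show w*ue*ug = w*(ue*ug) by ring]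
  generalize ue*ug = u1
  generalize uf*uz = u2
  rw [show g1*w*e1 = e1*g1*w by ring]
  generalize e1*g1 = v at *
  by_cases hp : p1 = 0
  · simp [hp]
  by_cases hu : u1 = 0
  · simp [hu]
  by_cases hu2 : u2 = 0
  · simp [hu2]
  by_cases hz : w = 0
  · simp [hz]
  field_simp
lemma R6_part (q a B C D e φ g : ℂ) (haB : a - B ≠ 0) (hφ : φ ≠ 0) (hC : C ≠ 0) (hD : D ≠ 0)
    (hCD : D - C ≠ 0) (hbal : e*φ*g = a*q*B*C*D) (m : ℕ)
    (he : ∀ k ≤ m, 1 - e*q^k ≠ 0) (hg : ∀ k ≤ m, 1 - g*q^k ≠ 0)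
    (hf : ∀ k < m, 1 - φ*q*q^k ≠ 0) (hq : ∀ k < m, 1 - q*q^k ≠ 0) :
    a*(φ-B)/(φ*(a-B)) * ph q (a*q) B C D e (φ*q) g (m+1)
      + B*(a-φ)/(φ*(a-B)) * ph q a (B*q) C D e (φ*q) g (m+1)
    = s6 C D e g * ph q (a*q) (B*q) C (D*q) (e*q) (φ*q) (g*q) (m+1)
      + s6 D C e g * ph q (a*q) (B*q) (C*q) D (e*q) (φ*q) (g*q) (m+1)
      + e*g/(C*D)*q^m * (Ψ q (a*q) m * Ψ q (B*q) m * Ψ q C (m+1) * Ψ q D (m+1))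
        / (Ψ q e (m+1) * Ψ q (φ*q) m * Ψ q g (m+1) * Ψ q q m) := by
  have hDC : C - D ≠ 0 := fun h => hCD (by linear_combination -h)
  have he0 : 1 - e ≠ 0 := by simpa using he 0 ø
  have hg0 : 1 - g ≠ 0 := by simpa using hg 0 ø
  have hr : a*B/φ*q = e*g/(C*D) := by field_simp; linear_combination -hbal
  induction m with
  | zero =>
    simp only [ph, zero_add, range_one, sum_singleton, tm, poch_zero, poch_succ, pow_zero, mul_one, pow_one, one_mul, div_one]
    unfold s6
    have hX : (C-D) = -(D-C) := by ring
    rw [hX]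
    field_simp
    ring
  | succ m ih =>
    have ih := ih (fun k hk => he k ø) (fun k hk => hg k ø)
      (fun k hk => hf k ø) (fun k hk => hq k ø)
    rw [ph_succ, ph_succ _ a (B*q), ph_succ _ (a*q) (B*q) C, ph_succ _ (a*q) (B*q) (C*q)]
    have ne : Ψ q e (m+1) ≠ 0 := poch_ne _ _ _ (fun l hl => he l ø)
    have ng : Ψ q g (m+1) ≠ 0 := poch_ne _ _ _ (fun l hl => hg l ø)
    have nf : Ψ q (φ*q) m ≠ 0 := poch_ne _ _ _ (fun l hl => hf l ø)
    have nq : Ψ q q m ≠ 0 := poch_ne _ _ _ (fun l hl => hq l ø)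
    have h1 := he (m+1) le_rfl
    have h3 := hg (m+1) le_rfl
    have h4 := hq m ø
    have h2 := hf m ø
    have h4' : 1 - q^(m+1) ≠ 0 := by rwa [pow_succ']
    have h2' : 1 - φ*q^(m+1) ≠ 0 := by rwa [pow_succ', ← mul_assoc]
    have key := R6_alg a B C D e φ g (q^(m+1)) haB hφ hC hD hCD h1 h3
    unfold tm
    rw [poch_succ' q a m, poch_succ' q B m]
    rw [poch_succ q q m, poch_succ q (a*q) m, poch_succ q (B*q) m, poch_succ q (φ*q) m,
     poch_succ q e (m+1), poch_succ q g (m+1), poch_succ q C (m+1), poch_succ q D (m+1)]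
    have e3 : Ψ q (e*q) (m+1) = Ψ q e (m+1) * (1-e*q^(m+1))/(1-e) := by
      rw [eq_div_iff he0, mul_comm, poch_shift]
    have g3 : Ψ q (g*q) (m+1) = Ψ q g (m+1) * (1-g*q^(m+1))/(1-g) := by
      rw [eq_div_iff hg0, mul_comm, poch_shift]
    have a1 := poch_shift q C (m+1)
    have b1 := poch_shift q D (m+1)
    rw [e3, g3]
    have i1 : q * q^m = q^(m+1) := by ring
    have i2 : a*q*q^m = a*q^(m+1) := by ring
    have i3 : B*q*q^m = B*q^(m+1) := by ring
    have i4 : φ*q*q^m = φ*q^(m+1) := by ring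
    have i5 : e*g/(C*D)*q^m = a*B/φ*q^(m+1) := by rw [← hr]; ring
    rw [i5] at ih
    rw [i1, i2, i3, i4]
    generalize q^(m+1) = Z at *
    generalize Ψ q e (m+1) = pe at *
    generalize Ψ q g (m+1) = pg at *
    generalize Ψ q (φ*q) m = pf at *
    generalize Ψ q q m = pq at *
    generalize Ψ q C (m+1) = pC at *
    generalize Ψ q D (m+1) = pD at *
    generalize Ψ q (a*q) m = pA at *
    generalize Ψ q (B*q) m = pB at *
    generalize Ψ q (C*q) (m+1) = pC' at *
    generalize Ψ q (D*q) (m+1) = pD' at *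
    generalize ph q (a*q) (B * q) (C * q) D (e * q) (φ * q) (g * q) (m + 1) = S1 at *
    generalize ph q (a*q) (B * q) C (D*q) (e * q) (φ * q) (g * q) (m + 1) = S2 at *
    generalize ph q (a * q) B C D e (φ * q) g (m + 1) = S3 at *
    generalize ph q a (B*q) C D e (φ * q) g (m + 1) = S4 at *
    have T1 : s6 C D e g * (pA * (1 - a*Z) * (pB * (1-B*Z)) * pC * pD' * Z /
      (pe * (1 - e * Z) / (1 - e) * (pf * (1 - φ * Z)) * (pg * (1 - g * Z) / (1 - g)) * (pq * (1 - Z))))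
      = pA*pB*pC*pD/(pe*pf*pg*pq) * ((1-a*Z)*(1-B*Z)*(1-D*Z)*(g-C)*(C-e)*Z/(C*(D-C)*(1-e*Z)*(1-g*Z)))/((1 - φ * Z) * (1-Z)) := by
      have := T6_alg (1-D) ((g-C)*(C-e)) (pA * (1 - a*Z)) (pB * (1-B*Z)) pC pD' Z pe pf pg pq (1-e*Z) (1-φ*Z) (1-g*Z) (1-Z) (1-e) (1-g) (C*(D-C)) he0 hg0
      unfold s6
      rw [show (1-D)*(g-C)*(C-e) = (1-D)*((g-C)*(C-e)) by ring, show (1 - g) * (D - C) * (1 - e) * C = (1 - g) * (C*(D - C)) * (1 - e) by ring, this, b1]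
      ring
    have T2 : s6 D C e g * (pA * (1 - a*Z) * (pB * (1-B*Z)) * pC' * pD * Z /
      (pe * (1 - e * Z) / (1 - e) * (pf * (1 - φ * Z)) * (pg * (1 - g * Z) / (1 - g)) * (pq * (1 - Z))))
      = pA*pB*pC*pD/(pe*pf*pg*pq) * ((1-a*Z)*(1-B*Z)*(1-C*Z)*(D-g)*(D-e)*Z/(D*(D-C)*(1-e*Z)*(1-g*Z)))/((1 - φ * Z) * (1-Z)) := by
      have := T6_alg (1-C) ((D-g)*(D-e)) (pA * (1 - a*Z)) (pB * (1-B*Z)) pD pC' Z pe pf pg pq (1-e*Z) (1-φ*Z) (1-g*Z) (1-Z) (1-e) (1-g) (D*(D-C)) he0 hg0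
      unfold s6
      rw [show (1-C)*(g-D)*(D-e) = -((1-C)*((D-g)*(D-e))) by ring, show (1 - g) * (C - D) * (1 - e) * D = -((1 - g) * (D*(D - C)) * (1 - e)) by ring,
        neg_div_neg_eq, show pA * (1 - a*Z) * (pB * (1-B*Z)) * pC' * pD * Z = pA * (1 - a*Z) * (pB * (1-B*Z)) * pD * pC' * Z by ring, this, a1]
      ring
    have T3 : ∀ w1 w2 : ℂ, pA * w1 * (w2 * pB) * pC * pD * Z / (pe * (pf * (1 - φ * Z)) * pg * (pq * (1 - Z)))
      = pA*pB*pC*pD/(pe*pf*pg*pq) * (w1*w2*Z)/((1 - φ * Z) * (1-Z)) := by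
      intro w1 w2; field_simp
    have T3' : ∀ w1 w2 : ℂ, w1 * pA * (pB * w2) * pC * pD * Z / (pe * (pf * (1 - φ * Z)) * pg * (pq * (1 - Z)))
      = pA*pB*pC*pD/(pe*pf*pg*pq) * (w1*w2*Z)/((1 - φ * Z) * (1-Z)) := by
      intro w1 w2; field_simp
    rw [mul_add, mul_add, mul_add, mul_add, T1, T2, T3, T3']
    have T5 : e * g / (C * D) * Z * (pA * (1 - a * Z) * (pB * (1 - B * Z)) * (pC * (1 - C * Z)) * (pD * (1 - D * Z))) /
      (pe * (1 - e * Z) * (pf * (1 - φ * Z)) * (pg * (1 - g * Z)) * (pq * (1 - Z))) =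
       pA*pB*pC*pD/(pe*pf*pg*pq)*(e*g/(C*D)*Z*((1-a*Z)*(1-B*Z)*(1-C*Z)*(1-D*Z))/((1-e*Z)*(1-g*Z)))/((1 - φ * Z) * (1-Z)) := by
      generalize e*g/(C*D) = w
      rw [← mul_div_assoc, div_mul_eq_mul_div, div_div, div_div]
      congr 1 <;> ring
    have T6 : a * B / φ * Z * (pA * pB * pC * pD) / (pe * pf * pg * pq) = pA*pB*pC*pD/(pe*pf*pg*pq)*(a * B / φ * Z*((1 - φ * Z) * (1-Z)))/((1 - φ * Z) * (1-Z)) := by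
      generalize a*B/φ = w
      generalize 1 - φ*Z = u at *
      generalize 1 - Z = u2 at *
      generalize pA*pB*pC*pD = n at *
      field_simp
    rw [T5]
    rw [T6] at ih
    linear_combination ih + pA*pB*pC*pD/(pe*pf*pg*pq) /((1 - φ * Z) * (1-Z)) * key
lemma R6 (q a B C D e φ g : ℂ) (haB : a - B ≠ 0) (hφ : φ ≠ 0) (hC : C ≠ 0) (hD : D ≠ 0)
    (hCD : D - C ≠ 0) (hbal : e*φ*g = a*q*B*C*D) (m K : ℕ) (ha : a*q^(m+1) = 1) (hK : m+1 < K)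
    (he : ∀ k ≤ m, 1 - e*q^k ≠ 0) (hg : ∀ k ≤ m, 1 - g*q^k ≠ 0)
    (hf : ∀ k ≤ m, 1 - φ*q*q^k ≠ 0) (hq : ∀ k ≤ m, 1 - q*q^k ≠ 0) :
    a*(φ-B)/(φ*(a-B)) * ph q (a*q) B C D e (φ*q) g K
      + B*(a-φ)/(φ*(a-B)) * ph q a (B*q) C D e (φ*q) g K
    = s6 C D e g * ph q (a*q) (B*q) C (D*q) (e*q) (φ*q) (g*q) K
      + s6 D C e g * ph q (a*q) (B*q) (C*q) D (e*q) (φ*q) (g*q) K := by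
  have ha' : a*q*q^m = 1 := by rw [← ha]; ring
  rw [ph_trunc _ (a*q) B _ _ _ _ _ m K ha' ø, ph_trunc _ a _ _ _ _ _ _ (m+1) K ha ø,
   ph_trunc _ (a*q) (B*q) C _ _ _ _ m K ha' ø, ph_trunc _ (a*q) (B*q) (C*q) _ _ _ _ m K ha' ø]
  rw [ph_succ q a, mul_add, ← add_assoc, R6_part q a B C D e φ g haB hφ hC hD hCD hbal m he hg (fun k hk => hf k ø) (fun k hk => hq k ø)]
  have ne : Ψ q e (m+1) ≠ 0 := poch_ne _ _ _ (fun l hl => he l ø)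
  have ng : Ψ q g (m+1) ≠ 0 := poch_ne _ _ _ (fun l hl => hg l ø)
  have nf : Ψ q (φ*q) m ≠ 0 := poch_ne _ _ _ (fun l hl => hf l ø)
  have nq : Ψ q q m ≠ 0 := poch_ne _ _ _ (fun l hl => hq l ø)
  have hr : a*B/φ*q = e*g/(C*D) := by field_simp; linear_combination -hbal
  have h4 := hq m ø
  have h2 := hf m ø
  have i5 : e*g/(C*D)*q^m = a*B/φ*q^(m+1) := by rw [← hr]; ring
  have i1 : q * q^m = q^(m+1) := by ring
  have i3 : B*q*q^m = B*q^(m+1) := by ring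
  have i4 : φ*q*q^m = φ*q^(m+1) := by ring
  have hZ : q^(m+1) ≠ 0 := by intro h; rw [h] at ha; simp at ha
  have ha2 : a = 1/q^(m+1) := by rw [eq_div_iff hZ, ha]
  unfold tm
  rw [i5, poch_succ' q a m, poch_succ q (B*q) m, poch_succ q (φ*q) m, poch_succ q q m, i1, i3, i4]
  rw [i1] at h4
  rw [i4] at h2
  generalize Ψ q C (m+1) = pC at *
  generalize Ψ q D (m+1) = pD at *
  generalize Ψ q (a*q) m = pA at *
  generalize Ψ q (B*q) m = pB at *
  generalize Ψ q e (m+1) = pe at *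
  generalize Ψ q g (m+1) = pg at *
  generalize Ψ q (φ*q) m = pf at *
  generalize Ψ q q m = pq at *
  clear i1 i3 i4 i5 ha ha' he hg hf hq hbal hr
  generalize q^(m+1) = Z at *
  have hB : 1 - B*Z ≠ 0 := by
    intro h; apply haB; rw [ha2]; field_simp; linear_combination h
  have hB' := mc hB
  have : a * B / φ * Z * (pA * pB * pC * pD) / (pe * pf * pg * pq) +
      B * (a - φ) / (φ * (a - B)) *
        ((1 - a) * pA * (pB * (1 - B * Z)) * pC * pD * Z / (pe * (pf * (1 - φ * Z)) * pg * (pq * (1 - Z)))) = 0 := by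
    have e1 : B * (a - φ) / (φ * (a - B)) = B*(1-φ*Z)/(φ*(1-B*Z)) := by
      subst ha2
      have h5 : 1/Z - B = (1-B*Z)/Z := by field_simp
      have h6 : 1/Z - φ = (1-φ*Z)/Z := by field_simp
      rw [h5, h6]; field_simp
    have e2 : (1-a) = -a*(1-Z) := by subst ha2; field_simp; ring
    rw [e1, e2]
    generalize 1 - B*Z = u1 at *
    generalize 1 - φ*Z = u2 at *
    generalize 1 - Z = u3 at *
    field_simp
    ring
  linear_combination this
structure Gen (q ε α β γ δ : ℂ) (N : ℕ) : Prop where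
  hq : q ≠ 0
  h0 : ε ≠ 0
  h1 : α ≠ 0
  h2 : β ≠ 0
  h3 : γ ≠ 0
  h4 : δ ≠ 0
  bal : ε*α*β*γ*δ*q^(2*N+3) = 1
  gen : ∀ e0 e1 e2 e3 e4 : ℕ, e0 ≤ 1 → e1 ≤ 1 → e2 ≤ 1 → e3 ≤ 1 → e4 ≤ 1 →
      1 ≤ e0 + e1 + e2 + e3 + e4 → e0 + e1 + e2 + e3 + e4 ≤ 4 →
      ∀ k : ℕ, 1 ≤ k → k ≤ 2*N+5 → 1 - ε ^ e0 * α ^ e1 * β ^ e2 * γ ^ e3 * δ ^ e4 * q^k ≠ 0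
  q1 : ∀ k : ℕ, 1 ≤ k → k ≤ N → 1 - q^k ≠ 0
section
variable {q ε α β γ δ : ℂ} {N : ℕ}
lemma Gen.g0 (G : Gen q ε α β γ δ N) (k : ℕ) (h : 1 ≤ k) (h' : k ≤ 2*N+5) : 1 - ε*q^k ≠ 0 := by
  simpa using G.gen 1 0 0 0 0 ø ø ø ø ø ø ø k h h'
lemma Gen.g1 (G : Gen q ε α β γ δ N) (k : ℕ) (h : 1 ≤ k) (h' : k ≤ 2*N+5) : 1 - α*q^k ≠ 0 := by
  simpa using G.gen 0 1 0 0 0 ø ø ø ø ø ø ø k h h'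
lemma Gen.g2 (G : Gen q ε α β γ δ N) (k : ℕ) (h : 1 ≤ k) (h' : k ≤ 2*N+5) : 1 - β*q^k ≠ 0 := by
  simpa using G.gen 0 0 1 0 0 ø ø ø ø ø ø ø k h h'
lemma Gen.g3 (G : Gen q ε α β γ δ N) (k : ℕ) (h : 1 ≤ k) (h' : k ≤ 2*N+5) : 1 - γ*q^k ≠ 0 := by
  simpa using G.gen 0 0 0 1 0 ø ø ø ø ø ø ø k h h'
lemma Gen.g4 (G : Gen q ε α β γ δ N) (k : ℕ) (h : 1 ≤ k) (h' : k ≤ 2*N+5) : 1 - δ*q^k ≠ 0 := by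
  simpa using G.gen 0 0 0 0 1 ø ø ø ø ø ø ø k h h'
lemma Gen.g12 (G : Gen q ε α β γ δ N) (k : ℕ) (h : 1 ≤ k) (h' : k ≤ 2*N+5) : 1 - α*β*q^k ≠ 0 := by
  simpa using G.gen 0 1 1 0 0 ø ø ø ø ø ø ø k h h'
lemma Gen.g04 (G : Gen q ε α β γ δ N) (k : ℕ) (h : 1 ≤ k) (h' : k ≤ 2*N+5) : 1 - ε*δ*q^k ≠ 0 := by
  simpa using G.gen 1 0 0 0 1 ø ø ø ø ø ø ø k h h'
lemma Gen.g23 (G : Gen q ε α β γ δ N) (k : ℕ) (h : 1 ≤ k) (h' : k ≤ 2*N+5) : 1 - β*γ*q^k ≠ 0 := by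
  simpa using G.gen 0 0 1 1 0 ø ø ø ø ø ø ø k h h'
lemma Gen.g24 (G : Gen q ε α β γ δ N) (k : ℕ) (h : 1 ≤ k) (h' : k ≤ 2*N+5) : 1 - β*δ*q^k ≠ 0 := by
  simpa using G.gen 0 0 1 0 1 ø ø ø ø ø ø ø k h h'
lemma Gen.g034 (G : Gen q ε α β γ δ N) (k : ℕ) (h : 1 ≤ k) (h' : k ≤ 2*N+5) : 1 - ε*γ*δ*q^k ≠ 0 := by
  simpa using G.gen 1 0 0 1 1 ø ø ø ø ø ø ø k h h'
lemma Gen.g123 (G : Gen q ε α β γ δ N) (k : ℕ) (h : 1 ≤ k) (h' : k ≤ 2*N+5) : 1 - α*β*γ*q^k ≠ 0 := by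
  simpa using G.gen 0 1 1 1 0 ø ø ø ø ø ø ø k h h'
lemma Gen.g124 (G : Gen q ε α β γ δ N) (k : ℕ) (h : 1 ≤ k) (h' : k ≤ 2*N+5) : 1 - α*β*δ*q^k ≠ 0 := by
  simpa using G.gen 0 1 1 0 1 ø ø ø ø ø ø ø k h h'
lemma Gen.shift (G : Gen q ε α β γ δ (N+1)) (a0 a1 a2 a3 a4 : ℕ)
    (hs : a0 + a1 + a2 + a3 + a4 = 2) :
    Gen q (ε*q^a0) (α*q^a1) (β*q^a2) (γ*q^a3) (δ*q^a4) N where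
  hq := G.hq
  h0 := mul_ne_zero G.h0 (pow_ne_zero _ G.hq)
  h1 := mul_ne_zero G.h1 (pow_ne_zero _ G.hq)
  h2 := mul_ne_zero G.h2 (pow_ne_zero _ G.hq)
  h3 := mul_ne_zero G.h3 (pow_ne_zero _ G.hq)
  h4 := mul_ne_zero G.h4 (pow_ne_zero _ G.hq)
  bal := by
    rw [← G.bal, show 2*(N+1)+3 = 2*N+3+2 by ring, ← hs]; ring
  gen := by
    intro e0 e1 e2 e3 e4 h0 h1 h2 h3 h4 hl hu k hk hk'
    have b0 := Nat.mul_le_mul_left a0 h0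
    have b1 := Nat.mul_le_mul_left a1 h1
    have b2 := Nat.mul_le_mul_left a2 h2
    have b3 := Nat.mul_le_mul_left a3 h3
    have b4 := Nat.mul_le_mul_left a4 h4
    have := G.gen e0 e1 e2 e3 e4 h0 h1 h2 h3 h4 hl hu (k + (a0*e0+a1*e1+a2*e2+a3*e3+a4*e4)) ø ø
    convert this using 2
    rw [mul_pow, mul_pow, mul_pow, mul_pow, mul_pow]
    ring
  q1 := fun k h h' => G.q1 k h ø
lemma Gen.hat (G : Gen q ε α β γ δ N) : Gen q⁻¹ γ⁻¹ α⁻¹ δ⁻¹ ε⁻¹ β⁻¹ N where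
  hq := inv_ne_zero G.hq
  h0 := inv_ne_zero G.h3
  h1 := inv_ne_zero G.h1
  h2 := inv_ne_zero G.h4
  h3 := inv_ne_zero G.h0
  h4 := inv_ne_zero G.h2
  bal := by
    have := congrArg (fun z => z⁻¹) G.bal
    simp only [mul_inv, inv_one] at this
    rw [inv_pow, ← this]; ring
  gen := by
    intro e0 e1 e2 e3 e4 h0 h1 h2 h3 h4 hl hu k hk hk'
    have := G.gen e3 e1 e4 e0 e2 h3 h1 h4 h0 h2 ø ø k hk hk'
    intro h
    apply this
    have h5 : (γ⁻¹ ^ e0 * α⁻¹ ^ e1 * δ⁻¹ ^ e2 * ε⁻¹ ^ e3 * β⁻¹ ^ e4 * q⁻¹ ^ k)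
      = (ε ^ e3 * α ^ e1 * β ^ e4 * γ ^ e0 * δ ^ e2 * q ^ k)⁻¹ := by
      simp only [inv_pow, mul_inv]; ring
    rw [h5, sub_eq_zero, eq_comm, inv_eq_one] at h
    rw [h]; ring
  q1 := by
    intro k h h'
    have := G.q1 k h h'
    intro h2
    apply this
    rw [inv_pow, sub_eq_zero, eq_comm, inv_eq_one] at h2
    rw [h2]; ring
lemma inv_ne (hq : q ≠ 0) (c : ℂ) (hc : c ≠ 0) (L l : ℕ) (hl : l ≤ L) (h : 1 - c*q^(L-l) ≠ 0) :
    1 - (c*q^L)⁻¹*q^l ≠ 0 := by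
  intro h2
  apply h
  have e : q^L = q^(L-l)*q^l := by rw [← pow_add]; congr 1; omega
  rw [e] at h2
  field_simp at h2
  linear_combination -h2
end
def SS (q α β γ Q : ℂ) (n x : ℕ) : ℂ :=
  ph q (q^n)⁻¹ (β*γ*q^(n+1)) (q^x)⁻¹ (α*β*q^(x+1)) (q*β) (α*β*γ*Q*q^2) Q⁻¹ (n+x+1)
lemma SS_cutn (q α β γ Q : ℂ) (n x K : ℕ) (hq : q ≠ 0) (h : n < K) : SS q α β γ Q n x =
  ph q (q^n)⁻¹ (β*γ*q^(n+1)) (q^x)⁻¹ (α*β*q^(x+1)) (q*β) (α*β*γ*Q*q^2) Q⁻¹ K := by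
  have hn : (q^n)⁻¹*q^n = 1 := inv_mul_cancel₀ (pow_ne_zero _ hq)
  unfold SS
  rw [ph_trunc _ _ _ _ _ _ _ _ n _ hn ø, ph_trunc _ _ _ _ _ _ _ _ n _ hn h]
lemma SS_cutx (q α β γ Q : ℂ) (n x K : ℕ) (hq : q ≠ 0) (h : x < K) : SS q α β γ Q n x =
  ph q (q^n)⁻¹ (β*γ*q^(n+1)) (q^x)⁻¹ (α*β*q^(x+1)) (q*β) (α*β*γ*Q*q^2) Q⁻¹ K := by
  have hn : (q^x)⁻¹*q^x = 1 := inv_mul_cancel₀ (pow_ne_zero _ hq)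
  unfold SS
  rw [ph_truncC _ _ _ _ _ _ _ _ x _ hn ø, ph_truncC _ _ _ _ _ _ _ _ x _ hn h]
def hnum (q ε α β γ δ : ℂ) (L N j a : ℕ) : ℂ :=
  (-(ε*α*q^(N+2+j)))^a * q^(a*(a-1)/2) * Ψ q (q^L)⁻¹ a * (1-α*β*q^(2*a+1)) * Ψ q (α*β*q) a
    * Ψ q (q*β) a * Ψ q (α*β*δ*q^(L+2)) a * Ψ q (ε*δ*q^(N+j+1))⁻¹ a
    * Ψ q (q^a/q^N) j * Ψ q (ε*γ*δ*q^(N+2)/q^a) j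
def hden (q _c0 α β γ δ : ℂ) (L N j a : ℕ) : ℂ :=
  Ψ q q a * Ψ q (q*α) a * Ψ q (α*β*q^(L+2)) a * Ψ q (δ*q^L)⁻¹ a * Ψ q (γ*q^N)⁻¹ (a+j)
def hh (q ε α β γ δ : ℂ) (L N j a : ℕ) : ℂ := hnum q ε α β γ δ L N j a / hden q ε α β γ δ L N j a
def HH (q ε α β γ δ : ℂ) (L y i j x : ℕ) : ℂ :=
  ∑ a ∈ range (L+1), hh q ε α β γ δ L (L+y) j a * SS q α β γ (q^(L+y)/q^j) i a
    * SS q γ ε δ (q^(L+y)/q^a) j y * SS q δ β α (q^L) a x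
def pre (q ε α β γ δ : ℂ) (L y i j x : ℕ) : ℂ :=
  Ψ q (q^j/q^(L+y)) i * Ψ q (q*β) i * Ψ q (q*ε) j * Ψ q (q*β) x * Ψ q (q*ε) y
   * Ψ q (q*γ) (L+y) * Ψ q (q*δ) L / Ψ q (α*β*q) (L+1)
def FF (q ε α β γ δ : ℂ) (L y i j x : ℕ) : ℂ :=
  pre q ε α β γ δ L y i j x * HH q ε α β γ δ L y i j x
lemma FF_vanish (q ε α β γ δ : ℂ) (L y i j x : ℕ) (hq : q ≠ 0) (h : L + y < i + j) :
    FF q ε α β γ δ L y i j x = 0 := by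
  by_cases hj : j ≤ L + y
  · unfold FF pre
    rw [poch_eq_zero q (q^j/q^(L+y)) i (L+y-j) ø]
    · simp
    · rw [div_mul_eq_mul_div, ← pow_add, show j + (L+y-j) = L+y by omega]
      exact div_self (pow_ne_zero _ hq)
  · unfold FF HH
    rw [sum_eq_zero, mul_zero]
    intro a ha
    have ha := mem_range.1 ha
    unfold hh hnum
    rw [poch_eq_zero q (q^a/q^(L+y)) j (L+y-a) ø]
    · simp
    · rw [div_mul_eq_mul_div, ← pow_add, show a + (L+y-a) = L+y by omega]
      exact div_self (pow_ne_zero _ hq)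
lemma SS_ph (q α β γ Q A B C D e f g : ℂ) (n x : ℕ) (hq : q ≠ 0) (hA : A = (q^n)⁻¹)
   (hB : B = β*γ*q^(n+1)) (hC : C = (q^x)⁻¹) (hD : D = α*β*q^(x+1)) (he : e = q*β)
   (hf : f = α*β*γ*Q*q^2) (hg : g = Q⁻¹) (K : ℕ) (hK : n < K ∨ x < K) :
   ph q A B C D e f g K = SS q α β γ Q n x := by
  subst hA hB hC hD he hf hg
  rcases hK with h | h
  · rw [SS_cutn _ _ _ _ _ _ _ _ hq h]
  · rw [SS_cutx _ _ _ _ _ _ _ _ hq h]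
lemma st2g (q α β γ Q : ℂ) (hq : q ≠ 0) (hQ : Q ≠ 0) (i a : ℕ)
    (hne : ∀ k < a+1, 1 - Q⁻¹*q^k ≠ 0) (hB : 1 - β*γ*q^(2*i+1) ≠ 0) :
    Ψ q Q⁻¹ i * Ψ q (q*β) i * SS q α β γ Q i a
     = (1-β*γ*q^(i+1))/(1 - β*γ*q^(2*i+1)) * (Ψ q (Q⁻¹*q) i * Ψ q (q*β) i * SS q α β (γ*q) (Q/q) i a)
     + (1-q^i)*(1-β*q^i)*(β*γ*q^(i+1)-Q⁻¹)/(1 - β*γ*q^(2*i+1)) *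
       (Ψ q (Q⁻¹*q) (i-1) * Ψ q (q*β) (i-1) * SS q α β (γ*q) (Q/q) (i-1) a) := by
  have hI : q^i ≠ 0 := pow_ne_zero _ hq
  have r := R2 q (q^i)⁻¹ (β*γ*q^(i+1)) (q^a)⁻¹ (α*β*q^(a+1)) (q*β) Q⁻¹ (α*β*γ*Q*q^2) (a+1) hne
  rw [ph_swapfg, SS_ph q α β γ Q _ _ _ _ _ _ _ i a hq rfl rfl rfl rfl rfl rfl rfl _ ø,
   ph_swapfg, SS_ph q α β (γ*q) (Q/q) _ _ _ _ _ _ _ i a hq rfl (by ring) rfl rfl rfl (by field_simp) (by field_simp) _ ø] at r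
  have g0 : 1 - Q⁻¹ ≠ 0 := by simpa using hne 0 ø
  have e1 := poch_shift q Q⁻¹ i
  have hBe : β*γ*q^(i+1) - (q^i)⁻¹ = -(1 - β*γ*q^(2*i+1)) * (q^i)⁻¹ := by
    have : q^(2*i+1) = q^i*q^i*q := by ring
    rw [this]; field_simp; ring
  rw [hBe] at r
  rcases i with _ | n
  · simp only [pow_zero, poch_zero, inv_one, sub_self, zero_mul, zero_div, add_zero, mul_one, one_mul] at r ⊢
    have : SS q α β γ Q 0 a = (1-β*γ*q^(0+1))/(1 - β*γ*q^(2*0+1)) * SS q α β (γ*q) (Q/q) 0 a := by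
      rw [div_mul_eq_mul_div, eq_div_iff hB]
      apply mul_left_cancel₀ g0
      linear_combination -r
    exact this
  · rw [Nat.add_sub_cancel]
    rw [ph_swapfg q _ _ _ _ _ (Q⁻¹*q), SS_ph q α β (γ*q) (Q/q) _ _ _ _ _ _ _ n a hq (by field_simp; try ring) (by ring) rfl rfl rfl (by field_simp) (by field_simp) _ ø] at r
    have e2 := poch_succ' q Q⁻¹ n
    have e3 := poch_succ q (q*β) n
    have e4 : 1 - q*β*q^n = 1 - β*q^(n+1) := by ring
    rw [e4] at e3
    set S0 := SS q α β γ Q (n+1) a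
    set S1 := SS q α β (γ*q) (Q/q) (n+1) a
    set S2 := SS q α β (γ*q) (Q/q) n a
    set B1 := β*γ*q^(n+1+1)
    set W := 1 - β*γ*q^(2*(n+1)+1)
    set I := q^(n+1)
    rw [e3]
    have r2 : (1 - Q⁻¹)*W*S0 = (1-B1)*(1-Q⁻¹*I)*S1 + (1-I)*(B1-Q⁻¹)*S2 := by
      field_simp at r ⊢; linear_combination -r
    rw [div_mul_eq_mul_div, div_mul_eq_mul_div, ← add_div, eq_div_iff hB]
    apply mul_left_cancel₀ g0
    linear_combination Ψ q Q⁻¹ (n+1)*Ψ q (q*β) n*(1-β*I)*r2 - (1-B1)*Ψ q (q*β) n*(1-β*I)*S1*e1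
      + (1-I)*(B1-Q⁻¹)*S2*Ψ q (q*β) n*(1-β*I)*e2
lemma st2f (q α β γ Q : ℂ) (hq : q ≠ 0) (hQ : Q ≠ 0) (i a : ℕ)
    (hne : ∀ k < a+1, 1 - α*β*γ*Q*q^2*q^k ≠ 0) (hB : 1 - β*γ*q^(2*i+1) ≠ 0) :
    Ψ q Q⁻¹ i * Ψ q (q*β) i * SS q α β γ Q i a
     = (1-β*γ*q^(i+1))*(1-α*β*γ*Q*q^2*q^i)/((1-α*β*γ*Q*q^2)*(1 - β*γ*q^(2*i+1))) * (Ψ q Q⁻¹ i * Ψ q (q*β) i * SS q α β (γ*q) Q i a)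
     + (1-Q⁻¹*q^i/q)*(1-q^i)*(1-β*q^i)*(β*γ*q^(i+1)-α*β*γ*Q*q^2)/((1-α*β*γ*Q*q^2)*(1 - β*γ*q^(2*i+1))) *
       (Ψ q Q⁻¹ (i-1) * Ψ q (q*β) (i-1) * SS q α β (γ*q) Q (i-1) a) := by
  have hI : q^i ≠ 0 := pow_ne_zero _ hq
  have r := R2 q (q^i)⁻¹ (β*γ*q^(i+1)) (q^a)⁻¹ (α*β*q^(a+1)) (q*β) (α*β*γ*Q*q^2) Q⁻¹ (a+1) hne
  rw [SS_ph q α β γ Q _ _ _ _ _ _ _ i a hq rfl rfl rfl rfl rfl rfl rfl _ ø,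
   SS_ph q α β (γ*q) Q _ _ _ _ _ _ _ i a hq rfl (by ring) rfl rfl rfl (by ring) rfl _ ø] at r
  have g0 : 1 - α*β*γ*Q*q^2 ≠ 0 := by simpa using hne 0 ø
  have hBe : β*γ*q^(i+1) - (q^i)⁻¹ = -(1 - β*γ*q^(2*i+1)) * (q^i)⁻¹ := by
    have : q^(2*i+1) = q^i*q^i*q := by ring
    rw [this]; field_simp; ring
  rw [hBe] at r
  rcases i with _ | n
  · simp only [pow_zero, poch_zero, inv_one, sub_self, zero_mul, mul_zero, zero_div, add_zero, mul_one, one_mul] at r hB ⊢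
    rw [div_mul_eq_mul_div, eq_div_iff (mul_ne_zero g0 hB)]
    linear_combination -r
  · rw [Nat.add_sub_cancel]
    rw [SS_ph q α β (γ*q) Q _ _ _ _ _ _ _ n a hq (by field_simp; try ring) (by ring) rfl rfl rfl (by ring) rfl _ ø] at r
    have e2 := poch_succ q Q⁻¹ n
    have e3 := poch_succ q (q*β) n
    have e4 : 1 - q*β*q^n = 1 - β*q^(n+1) := by ring
    have e5 : 1 - Q⁻¹*q^n = 1 - Q⁻¹*q^(n+1)/q := by field_simp; ring
    rw [e4] at e3
    rw [e5] at e2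
    set f := α*β*γ*Q*q^2
    set S0 := SS q α β γ Q (n+1) a
    set S1 := SS q α β (γ*q) Q (n+1) a
    set S2 := SS q α β (γ*q) Q n a
    set B1 := β*γ*q^(n+1+1)
    set W := 1 - β*γ*q^(2*(n+1)+1)
    set I := q^(n+1)
    rw [e3, e2]
    have r2 : (1 - f)*W*S0 = (1-B1)*(1-f*I)*S1 + (1-I)*(B1-f)*S2 := by
      field_simp at r ⊢; linear_combination -r
    rw [div_mul_eq_mul_div, div_mul_eq_mul_div, ← add_div, eq_div_iff (mul_ne_zero g0 hB)]
    linear_combination Ψ q Q⁻¹ n*(1-Q⁻¹*I/q)*Ψ q (q*β) n*(1-β*I)*r2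
lemma hh_zero (q ε α β γ δ : ℂ) (L N j a : ℕ) (hq : q ≠ 0) (ha : a ≤ N) (h : N < a + j) :
   hh q ε α β γ δ L N j a = 0 := by
  unfold hh hnum
  rw [poch_eq_zero q (q^a/q^N) j (N-a) ø]
  · simp
  · rw [div_mul_eq_mul_div, ← pow_add, show a + (N-a) = N by omega]
    exact div_self (pow_ne_zero _ hq)
lemma qinv_ne {q : ℂ} {N : ℕ} (hq : q ≠ 0) (q1 : ∀ k : ℕ, 1 ≤ k → k ≤ N → 1 - q^k ≠ 0) (a k : ℕ) (h : a + k < N) :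
    1 - q^a/q^N*q^k ≠ 0 := by
  intro h2
  apply q1 (N-(a+k)) ø ø
  have e : q^N = q^(N-(a+k))*q^a*q^k := by rw [← pow_add, ← pow_add]; congr 1; omega
  rw [e] at h2
  field_simp at h2
  linear_combination -h2
def yP1 (q ε γ δ : ℂ) (j : ℕ) : ℂ := (1-q*ε)*(1-q*γ)*(1-ε*δ*q^(j+1))/(q^j*(1-ε*δ*q^(2*j+1)))
def yP2 (q ε γ δ : ℂ) (N j : ℕ) : ℂ :=
  (1-q*ε)*(1-q*γ)*(1-ε*δ*q^(N+1+j))*(1-(q^j)⁻¹)*q^2*ε*γ*(1-δ*q^j)/(1-ε*δ*q^(2*j+1))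
lemma st1a_aux (E F G E' F' G' Py z Pz r V u v w u' v' w' W Y : ℂ) (hu : u' ≠ 0) (hv : v' ≠ 0) (hw : w' ≠ 0)
   (hW : W ≠ 0) (hY : Y ≠ 0) (t : E*F*G*(u*v*w) = u'*v'*w'*(E'*F'*G')) :
   E*(u'*Py)*(z*Pz)*(r*(G*F))*(V*(-u*Y⁻¹)*(-v*Y⁻¹)*(-w*Y⁻¹)/(u'*v'*w'*(-W*Y⁻¹)*Y⁻¹))
   = u'*z*V/(Y*W)*(E'*Py*Pz*(r*(G'*F'))) := by
  have : E*(u'*Py)*(z*Pz)*(r*(G*F))*(V*(-u*Y⁻¹)*(-v*Y⁻¹)*(-w*Y⁻¹)/(u'*v'*w'*(-W*Y⁻¹)*Y⁻¹))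
   = (E*F*G*(u*v*w))*(Py*z*Pz*r*V/(v'*w'*W*Y)) := by
    trans (E*F*G*(u*v*w))*(Py*z*Pz*r*V/(v'*w'*W*Y))*(u'*u'⁻¹)*(Y*Y⁻¹)^2
    · simp only [div_eq_mul_inv, mul_inv, inv_inv, inv_neg]; ring
    · rw [mul_inv_cancel₀ hu, mul_inv_cancel₀ hY]; ring
  rw [this, t]
  trans u'*z*V/(Y*W)*(E'*Py*Pz*(r*(G'*F')))*(v'*v'⁻¹)*(w'*w'⁻¹)
  · ring
  · rw [mul_inv_cancel₀ hv, mul_inv_cancel₀ hw]; ring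
lemma st1a (q ε α β γ δ : ℂ) (L y j a : ℕ) (hq : q ≠ 0)
   (he : 1 - q*ε ≠ 0) (hf : 1 - ε*γ*δ*q^(L+y+1+2)/q^a ≠ 0) (hg : 1 - q^a/q^(L+y+1) ≠ 0)
   (hB : 1 - ε*δ*q^(2*j+1) ≠ 0) :
   Ψ q (q*ε) j * Ψ q (q*ε) (y+1) * Ψ q (q*γ) (L+y+1) * hh q ε α β γ δ L (L+y+1) j a *
    al (q^j)⁻¹ (ε*δ*q^(j+1)) (q*ε) (ε*γ*δ*q^(L+y+1+2)/q^a) (q^a/q^(L+y+1))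
   = yP1 q ε γ δ j * (Ψ q (q*(ε*q)) j * Ψ q (q*(ε*q)) y * Ψ q (q*(γ*q)) (L+y) *
    hh q (ε*q) α β (γ*q) δ L (L+y) j a) := by
  have hY : q^j ≠ 0 := pow_ne_zero _ hq
  have hX : q^a ≠ 0 := pow_ne_zero _ hq
  have hM : q^(L+y) ≠ 0 := pow_ne_zero _ hq
  have hBe : ε*δ*q^(j+1) - (q^j)⁻¹ = -(1 - ε*δ*q^(2*j+1)) * (q^j)⁻¹ := by
    have : q^(2*j+1) = q^j*q^j*q := by ring
    rw [this]; field_simp; ring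
  have e1 := poch_shift q (q*ε) j
  have e2 := poch_shift q (ε*γ*δ*q^(L+y+1+2)/q^a) j
  have e3 := poch_shift q (q^a/q^(L+y+1)) j
  rw [poch_succ' q (q*ε) y, poch_succ' q (q*γ) (L+y)]
  unfold hh hnum hden al yP1
  have w1 : ε*q*α*q^(L+y+2+j) = ε*α*q^(L+y+1+2+j) := by ring
  have w2 : ε*q*δ*q^(L+y+j+1) = ε*δ*q^(L+y+1+j+1) := by ring
  have w3 : γ*q*q^(L+y) = γ*q^(L+y+1) := by ring
  have w4 : ε*q*(γ*q)*δ*q^(L+y+2)/q^a = ε*γ*δ*q^(L+y+1+2)/q^a*q := by ring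
  have w5 : q^a/q^(L+y) = q^a/q^(L+y+1)*q := by field_simp; try ring
  rw [w1, w2, w3, w4, w5, hBe, show q*(ε*q) = q*ε*q by ring, show q*(γ*q) = q*γ*q by ring]
  have n1 : q*ε - (q^j)⁻¹ = -(1-q*ε*q^j)*(q^j)⁻¹ := by field_simp; ring
  have n2 : ε*γ*δ*q^(L+y+1+2)/q^a - (q^j)⁻¹ = -(1-ε*γ*δ*q^(L+y+1+2)/q^a*q^j)*(q^j)⁻¹ := by
    generalize ε*γ*δ*q^(L+y+1+2)/q^a = f; field_simp; ring
  have n3 : q^a/q^(L+y+1) - (q^j)⁻¹ = -(1-q^a/q^(L+y+1)*q^j)*(q^j)⁻¹ := by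
    generalize q^a/q^(L+y+1) = f; field_simp; ring
  rw [n1, n2, n3]
  generalize Ψ q (q*ε*q) j = E' at *
  generalize Ψ q (q*ε) j = E at *
  generalize ε*γ*δ*q^(L+y+1+2)/q^a = f at *
  generalize q^a/q^(L+y+1) = g at *
  generalize Ψ q (f*q) j = F' at *
  generalize Ψ q f j = F at *
  generalize Ψ q (g*q) j = G' at *
  generalize Ψ q g j = G at *
  generalize 1 - ε*δ*q^(2*j+1) = W at *
  generalize 1 - ε*δ*q^(j+1) = V at *
  generalize q^j = Y at *
  generalize (Ψ q q a * Ψ q (q*α) a * Ψ q (α*β*q^(L+2)) a * Ψ q (δ*q^L)⁻¹ a * Ψ q (γ*q^(L+y+1))⁻¹ (a+j)) = den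
  generalize (-(ε*α*q^(L+y+1+2+j)))^a * q^(a*(a-1)/2) * Ψ q (q^L)⁻¹ a * (1-α*β*q^(2*a+1)) * Ψ q (α*β*q) a
    * Ψ q (q*β) a * Ψ q (α*β*δ*q^(L+2)) a * Ψ q (ε*δ*q^(L+y+1+j+1))⁻¹ a = num
  generalize Ψ q (q*ε*q) y = Py
  generalize Ψ q (q*γ*q) (L+y) = Pz
  have t : E*F*G*((1-q*ε*Y)*(1-f*Y)*(1-g*Y)) = (1-q*ε)*(1-f)*(1-g)*(E'*F'*G') := by
    linear_combination -F*(1-f*Y)*G*(1-g*Y)*e1 - (1-q*ε)*E'*G*(1-g*Y)*e2 - (1-q*ε)*E'*(1-f)*F'*e3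
  generalize hu : 1-q*ε*Y = u at *
  generalize hv : 1-f*Y = v at *
  generalize hw : 1-g*Y = w at *
  generalize hu' : 1-q*ε = u' at *
  generalize hv' : 1-f = v' at *
  generalize hw' : 1-g = w' at *
  generalize 1-q*γ = z at *
  rw [show num*G*F/den = num/den*(G*F) by ring, show num*G'*F'/den = num/den*(G'*F') by ring]
  generalize num/den = r
  exact st1a_aux _ _ _ _ _ _ _ _ _ _ _ _ _ _ _ _ _ _ _ he hf hg hB hY t
lemma st1b_aux (E E' Py zc Pz r w X Z Z' G G' F F' D D' A ε δ q Y f ρ B z u' v' w' W k : ℂ)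
   (hE : E = u'*E') (hF : F = v'*F') (hG : G = w'*G') (hD : D = D'*(1-ρ)) (hZ : (1-z)*Z' = Z*(1-z*X))
   (hρ : 1-ρ ≠ 0) (hu : u' ≠ 0) (hv : v' ≠ 0) (hw : w' ≠ 0) (hW : W ≠ 0) (hY : Y ≠ 0) (hB : B ≠ 0)
   (hk : -(f*X*Y)*(1-z)*ε = k) :
   E*(u'*Py)*(zc*Pz)*(r*(w*X)*Z*G*F/D)*((1-A)*(q*ε*(1-δ*Y))*(f*(1-ρ))*(-B*(1-z*X))/(u'*v'*w'*(W*Y⁻¹)*B))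
   = u'*zc*q*(1-A)*(1-δ*Y)*k/W*(E'*Py*Pz*(r*w*Z'*G'*F'/D')) := by
  have h1 : E*(u'*Py)*(zc*Pz)*(r*(w*X)*Z*G*F/D)*((1-A)*(q*ε*(1-δ*Y))*(f*(1-ρ))*(-B*(1-z*X))/(u'*v'*w'*(W*Y⁻¹)*B))
   = -((Z*(1-z*X))*((1-A)*(q*ε*(1-δ*Y))*f*X*Y/W*(u'*E'*Py*(zc*Pz)*r*w*G'*F'/D'))) := by
    rw [hE, hF, hG, hD]
    generalize 1-ρ = σ at *
    generalize 1-z*X = τ at *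
    generalize 1-δ*Y = τ' at *
    generalize 1-A = τ'' at *
    trans -((Z*τ)*(τ''*(q*ε*τ')*f*X*Y/W*(u'*E'*Py*(zc*Pz)*r*w*G'*F'/D'))) * (u'*u'⁻¹)*(v'*v'⁻¹)*(w'*w'⁻¹)*(σ*σ⁻¹)*(B*B⁻¹)
    · simp only [div_eq_mul_inv, mul_inv, inv_inv]; ring
    · rw [mul_inv_cancel₀ hu, mul_inv_cancel₀ hv, mul_inv_cancel₀ hw, mul_inv_cancel₀ hB, mul_inv_cancel₀ hρ]; ring
  rw [h1, ← hZ, ← hk]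
  ring
lemma st1b (q ε α β γ δ : ℂ) (L y n a : ℕ) (hq : q ≠ 0) (h0 : ε ≠ 0) (h3 : γ ≠ 0) (h4 : δ ≠ 0)
   (he : 1 - q*ε ≠ 0) (hf : 1 - ε*γ*δ*q^(L+y+1+2)/q^a ≠ 0) (hg : 1 - q^a/q^(L+y+1) ≠ 0)
   (hB : 1 - ε*δ*q^(2*(n+1)+1) ≠ 0) (hρ : 1 - (γ*q^(L+y+1))⁻¹*q^(a+n) ≠ 0) :
   Ψ q (q*ε) (n+1) * Ψ q (q*ε) (y+1) * Ψ q (q*γ) (L+y+1) * hh q ε α β γ δ L (L+y+1) (n+1) a *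
    al (ε*δ*q^(n+1+1)) (q^(n+1))⁻¹ (q*ε) (ε*γ*δ*q^(L+y+1+2)/q^a) (q^a/q^(L+y+1))
   = yP2 q ε γ δ (L+y+1) (n+1) * (Ψ q (q*(ε*q)) n * Ψ q (q*(ε*q)) y * Ψ q (q*(γ*q)) (L+y) *
    hh q (ε*q) α β (γ*q) δ L (L+y) n a) := by
  have hY : q^(n+1) ≠ 0 := pow_ne_zero _ hq
  have hX : q^a ≠ 0 := pow_ne_zero _ hq
  have hM : q^(L+y) ≠ 0 := pow_ne_zero _ hq
  have hB0 : ε*δ*q^(n+1+1) ≠ 0 := mul_ne_zero (mul_ne_zero h0 h4) (pow_ne_zero _ hq)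
  have hBe : (q^(n+1))⁻¹ - ε*δ*q^(n+1+1) = (1 - ε*δ*q^(2*(n+1)+1)) * (q^(n+1))⁻¹ := by
    have : q^(2*(n+1)+1) = q^(n+1)*q^(n+1)*q := by ring
    rw [this]; field_simp; ring
  have e1 := poch_succ' q (q*ε) n
  have e2 := poch_succ' q (ε*γ*δ*q^(L+y+1+2)/q^a) n
  have e3 := poch_succ' q (q^a/q^(L+y+1)) n
  have e4 := poch_succ q (γ*q^(L+y+1))⁻¹ (a+n)
  have e5 := poch_shift q (ε*δ*q^(L+y+1+(n+1)+1))⁻¹ a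
  rw [poch_succ' q (q*ε) y, poch_succ' q (q*γ) (L+y)]
  unfold hh hnum hden al yP2
  have w1 : (-(ε*α*q^(L+y+1+2+(n+1))))^a = (-(ε*q*α*q^(L+y+2+n)))^a*q^a := by
    rw [← mul_pow]; congr 1; ring
  have w2 : (ε*q*δ*q^(L+y+n+1))⁻¹ = (ε*δ*q^(L+y+1+(n+1)+1))⁻¹*q := by field_simp; ring
  have w3 : γ*q*q^(L+y) = γ*q^(L+y+1) := by ring
  have w4 : ε*q*(γ*q)*δ*q^(L+y+2)/q^a = ε*γ*δ*q^(L+y+1+2)/q^a*q := by ring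
  have w5 : q^a/q^(L+y) = q^a/q^(L+y+1)*q := by field_simp; try ring
  rw [w1, w2, w3, w4, w5, hBe, show q*(ε*q) = q*ε*q by ring, show q*(γ*q) = q*γ*q by ring]
  have n1 : q*ε - ε*δ*q^(n+1+1) = q*ε*(1-δ*q^(n+1)) := by ring
  have n2 : ε*γ*δ*q^(L+y+1+2)/q^a - ε*δ*q^(n+1+1) = ε*γ*δ*q^(L+y+1+2)/q^a*(1-(γ*q^(L+y+1))⁻¹*q^(a+n)) := by
    field_simp; ring
  have n3 : q^a/q^(L+y+1) - ε*δ*q^(n+1+1) = -(ε*δ*q^(n+1+1))*(1-(ε*δ*q^(L+y+1+(n+1)+1))⁻¹*q^a) := by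
    field_simp; ring
  rw [n1, n2, n3]
  have k1 : -(ε*γ*δ*q^(L+y+1+2)/q^a*q^a*q^(n+1))*(1-(ε*δ*q^(L+y+1+(n+1)+1))⁻¹)*ε
    = q*ε*γ*(1-ε*δ*q^(L+y+1+1+(n+1))) := by
    field_simp; ring
  have := st1b_aux _ _ (Ψ q (q*ε*q) y) (1-q*γ) (Ψ q (q*γ*q) (L+y)) (q^(a*(a-1)/2) * Ψ q (q^L)⁻¹ a * (1-α*β*q^(2*a+1)) * Ψ q (α*β*q) a
    * Ψ q (q*β) a * Ψ q (α*β*δ*q^(L+2)) a/(Ψ q q a * Ψ q (q*α) a * Ψ q (α*β*q^(L+2)) a * Ψ q (δ*q^L)⁻¹ a))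
    ((-(ε*q*α*q^(L+y+2+n)))^a) (q^a) _ _ _ _ _ _ _ _ (q^(n+1))⁻¹ ε δ q (q^(n+1)) _ _ (ε*δ*q^(n+1+1)) _ _ _ _ _ _ e1 e2 e3 e4 e5 hρ he hf hg hB hY hB0 k1
  rw [show a+(n+1) = a+n+1 by ring]
  refine Eq.trans ?_ (this.trans ?_)
  · congr 1; congr 1; ring
  · ring
lemma st1 (q ε α β γ δ : ℂ) (L y j a : ℕ) (G : Gen q ε α β γ δ (L+y+1)) (ha : a ≤ L) (hj : j ≤ L+y+1) :
   Ψ q (q*ε) j * Ψ q (q*ε) (y+1) * Ψ q (q*γ) (L+y+1) * hh q ε α β γ δ L (L+y+1) j a *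
     SS q γ ε δ (q^(L+y+1)/q^a) j (y+1)
   = yP1 q ε γ δ j * (Ψ q (q*(ε*q)) j * Ψ q (q*(ε*q)) y * Ψ q (q*(γ*q)) (L+y) *
       hh q (ε*q) α β (γ*q) δ L (L+y) j a * SS q (γ*q) (ε*q) δ (q^(L+y)/q^a) j y)
    + yP2 q ε γ δ (L+y+1) j * (Ψ q (q*(ε*q)) (j-1) * Ψ q (q*(ε*q)) y * Ψ q (q*(γ*q)) (L+y) *
       hh q (ε*q) α β (γ*q) δ L (L+y) (j-1) a * SS q (γ*q) (ε*q) δ (q^(L+y)/q^a) (j-1) y) := by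
  have hq := G.hq
  by_cases hja : L+y+1 < a + j
  · rw [hh_zero q _ _ _ _ _ _ (L+y+1) j a hq ø hja, hh_zero q _ _ _ _ _ _ (L+y) j a hq ø ø,
      hh_zero q _ _ _ _ _ _ (L+y) (j-1) a hq ø ø]
    ring
  push Not at hja
  have hY : q^j ≠ 0 := pow_ne_zero _ hq
  have hX : q^a ≠ 0 := pow_ne_zero _ hq
  have he : 1 - q*ε ≠ 0 := by have := G.g0 1 ø ø; rwa [pow_one, mul_comm] at this
  have hff : ∀ k < y+1, 1 - ε*γ*δ*q^(L+y+1+2)/q^a*q^k ≠ 0 := by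
    intro k hk
    have := G.g034 (L+y+1+2-a+k) ø ø
    convert this using 2
    have e : q^(L+y+1+2) = q^(L+y+1+2-a)*q^a := by rw [← pow_add]; congr 1; omega
    rw [e, pow_add]; field_simp
  have hgg : ∀ k < y+1, 1 - q^a/q^(L+y+1)*q^k ≠ 0 := fun k hk => qinv_ne hq G.q1 a k ø
  have hf := hff 0 ø
  have hg := hgg 0 ø
  rw [pow_zero, mul_one] at hf hg
  have hB := G.g04 (2*j+1) ø ø
  have hBe : ε*δ*q^(j+1) - (q^j)⁻¹ = -(1 - ε*δ*q^(2*j+1)) * (q^j)⁻¹ := by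
    have : q^(2*j+1) = q^j*q^j*q := by ring
    rw [this]; field_simp; ring
  have r := R1 q (q^j)⁻¹ (ε*δ*q^(j+1)) (q^(y+1))⁻¹ (γ*ε*q^(y+1+1)) (q*ε) (ε*γ*δ*q^(L+y+1+2)/q^a) (q^a/q^(L+y+1))
    (inv_ne_zero hY) (mul_ne_zero (mul_ne_zero G.h0 G.h4) (pow_ne_zero _ hq))
    (by rw [hBe]; exact mul_ne_zero (neg_ne_zero.2 hB) (inv_ne_zero hY)) (by field_simp; try ring) (y+1) (y+2) ø
    (inv_mul_cancel₀ (pow_ne_zero _ hq)) ø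
    (by
      intro k hk
      have := G.g0 (k+1) ø ø
      convert this using 2; ring) hff hgg
    (by
      intro k hk
      have := G.q1 (k+1) ø ø
      convert this using 2; ring)
  rw [SS_ph q γ ε δ (q^(L+y+1)/q^a) _ _ _ _ _ _ _ j (y+1) hq rfl rfl rfl rfl rfl (by field_simp; try ring) (by field_simp) _ ø,
    SS_ph q (γ*q) (ε*q) δ (q^(L+y)/q^a) _ _ _ _ _ _ _ j y hq rfl (by ring) (by field_simp; try ring) (by ring) (by ring) (by field_simp; try ring) (by field_simp; try ring) _ ø] at r
  have ra := st1a q ε α β γ δ L y j a hq he hf hg hB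
  rcases j with _ | n
  · have z1 : yP2 q ε γ δ (L+y+1) 0 = 0 := by simp [yP2]
    have z2 : al (ε*δ*q^(0+1)) (q^0)⁻¹ (q*ε) (ε*γ*δ*q^(L+y+1+2)/q^a) (q^a/q^(L+y+1)) = 0 := by simp [al]
    rw [z2] at r
    rw [r, z1, zero_mul, zero_mul, add_zero, add_zero]
    linear_combination SS q (γ*q) (ε*q) δ (q^(L+y)/q^a) 0 y * ra
  · have rb := st1b q ε α β γ δ L y n a hq G.h0 G.h3 G.h4 he hf hg hB
      (inv_ne hq γ G.h3 _ _ ø (G.g3 _ ø ø))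
    rw [SS_ph q (γ*q) (ε*q) δ (q^(L+y)/q^a) _ _ _ _ _ _ _ n y hq (by field_simp; try ring) (by ring) (by field_simp; try ring) (by ring) (by ring) (by field_simp; try ring) (by field_simp; try ring) _ ø] at r
    rw [r, Nat.add_sub_cancel]
    linear_combination SS q (γ*q) (ε*q) δ (q^(L+y)/q^a) (n+1) y * ra + SS q (γ*q) (ε*q) δ (q^(L+y)/q^a) n y * rb
def u00 (q β γ : ℂ) (i : ℕ) : ℂ := (1-β*γ*q^(i+1))/(1 - β*γ*q^(2*i+1))
def u10 (q β γ : ℂ) (N i j : ℕ) : ℂ := (1-q^i)*(1-β*q^i)*(β*γ*q^(i+1)-q^j/q^N)/(1 - β*γ*q^(2*i+1))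
def u01 (q α β γ : ℂ) (N i j : ℕ) : ℂ := (1-β*γ*q^(i+1))*(1-α*β*γ*(q^N/q^j)*q^2*q^i)/((1-α*β*γ*(q^N/q^j)*q^2)*(1 - β*γ*q^(2*i+1)))
def u11 (q α β γ : ℂ) (N i j : ℕ) : ℂ :=
  (1-q^j/q^N*q^i/q)*(1-q^i)*(1-β*q^i)*(β*γ*q^(i+1)-α*β*γ*(q^N/q^j)*q^2)/((1-α*β*γ*(q^N/q^j)*q^2)*(1 - β*γ*q^(2*i+1)))
lemma ystep (q ε α β γ δ : ℂ) (L y i j x : ℕ) (G : Gen q ε α β γ δ (L+y+1)) (hij : i + j ≤ L+y+1) :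
   FF q ε α β γ δ L (y+1) i j x =
    yP1 q ε γ δ j * u00 q β γ i * FF q (ε*q) α β (γ*q) δ L y i j x
    + yP1 q ε γ δ j * u10 q β γ (L+y+1) i j * FF q (ε*q) α β (γ*q) δ L y (i-1) j x
    + yP2 q ε γ δ (L+y+1) j * u01 q α β γ (L+y+1) i j * FF q (ε*q) α β (γ*q) δ L y i (j-1) x
    + yP2 q ε γ δ (L+y+1) j * u11 q α β γ (L+y+1) i j * FF q (ε*q) α β (γ*q) δ L y (i-1) (j-1) x := by
  have hq := G.hq
  have hB := G.g23 (2*i+1) ø ø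
  unfold FF HH
  simp only [mul_sum, ← sum_add_distrib]
  apply sum_congr rfl
  intro a ha
  have ha : a ≤ L := by have := mem_range.1 ha; omega
  have s1 := st1 q ε α β γ δ L y j a G ha ø
  rw [show L + (y+1) = L+y+1 by ring]
  -- stage 2g
  have s2 : hh q (ε*q) α β (γ*q) δ L (L+y) j a * (Ψ q (q^j/q^(L+y+1)) i * Ψ q (q*β) i * SS q α β γ (q^(L+y+1)/q^j) i a)
    = hh q (ε*q) α β (γ*q) δ L (L+y) j a *
    (u00 q β γ i * (Ψ q (q^j/q^(L+y)) i * Ψ q (q*β) i * SS q α β (γ*q) (q^(L+y)/q^j) i a)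
    + u10 q β γ (L+y+1) i j * (Ψ q (q^j/q^(L+y)) (i-1) * Ψ q (q*β) (i-1) * SS q α β (γ*q) (q^(L+y)/q^j) (i-1) a)) := by
    by_cases h : L + y < a + j
    · rw [hh_zero q _ _ _ _ _ _ (L+y) j a hq ø h]; ring
    · congr 1
      have := st2g q α β γ (q^(L+y+1)/q^j) hq (div_ne_zero (pow_ne_zero _ hq) (pow_ne_zero _ hq)) i a
        (by intro k hk; rw [inv_div]; exact qinv_ne hq G.q1 j k ø) hB
      rw [inv_div, show q^j/q^(L+y+1)*q = q^j/q^(L+y) by field_simp; try ring,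
       show q^(L+y+1)/q^j/q = q^(L+y)/q^j by field_simp; try ring] at this
      exact this
  have s3 : yP2 q ε γ δ (L+y+1) j * (Ψ q (q^j/q^(L+y+1)) i * Ψ q (q*β) i * SS q α β γ (q^(L+y+1)/q^j) i a)
    = yP2 q ε γ δ (L+y+1) j *
    (u01 q α β γ (L+y+1) i j * (Ψ q (q^(j-1)/q^(L+y)) i * Ψ q (q*β) i * SS q α β (γ*q) (q^(L+y)/q^(j-1)) i a)
    + u11 q α β γ (L+y+1) i j * (Ψ q (q^(j-1)/q^(L+y)) (i-1) * Ψ q (q*β) (i-1) * SS q α β (γ*q) (q^(L+y)/q^(j-1)) (i-1) a)) := by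
    rcases j with _ | n
    · simp [yP2]
    · congr 1
      have := st2f q α β γ (q^(L+y+1)/q^(n+1)) hq (div_ne_zero (pow_ne_zero _ hq) (pow_ne_zero _ hq)) i a
        (by
          intro k hk
          have := G.g123 (L+y+1-(n+1)+2+k) ø ø
          convert this using 2
          have e : q^(L+y+1) = q^(L+y+1-(n+1))*q^(n+1) := by rw [← pow_add]; congr 1; omega
          rw [e, pow_add, pow_add]; field_simp; try ring) hB
      rw [inv_div] at this
      rw [Nat.add_sub_cancel]
      have e1 : q^n/q^(L+y) = q^(n+1)/q^(L+y+1) := by field_simp; try ring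
      have e2 : q^(L+y)/q^n = q^(L+y+1)/q^(n+1) := by field_simp; try ring
      rw [e1, e2]
      exact this
  unfold pre
  rw [show L + (y+1) = L+y+1 by ring]
  set T := SS q δ β α (q^L) a x * (Ψ q (q*β) x * Ψ q (q*δ) L / Ψ q (α*β*q) (L+1))
  linear_combination (T * (Ψ q (q^j/q^(L+y+1)) i * Ψ q (q*β) i * SS q α β γ (q^(L+y+1)/q^j) i a)) * s1
    + T * (yP1 q ε γ δ j * (Ψ q (q*(ε*q)) j * Ψ q (q*(ε*q)) y * Ψ q (q*(γ*q)) (L+y) *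
        SS q (γ*q) (ε*q) δ (q^(L+y)/q^a) j y)) * s2
    + T * (Ψ q (q*(ε*q)) (j-1) * Ψ q (q*(ε*q)) y * Ψ q (q*(γ*q)) (L+y) *
       hh q (ε*q) α β (γ*q) δ L (L+y) (j-1) a * SS q (γ*q) (ε*q) δ (q^(L+y)/q^a) (j-1) y) * s3
lemma SS_x0 (q α β γ Q : ℂ) (n : ℕ) (hq : q ≠ 0) : SS q α β γ Q n 0 = 1 := by
  rw [SS_cutx _ _ _ _ _ _ _ 1 hq ø]
  simp [ph, tm, poch_zero]
lemma SS_n0 (q α β γ Q : ℂ) (n : ℕ) (hq : q ≠ 0) : SS q α β γ Q 0 n = 1 := by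
  rw [SS_cutn _ _ _ _ _ _ _ 1 hq ø]
  simp [ph, tm, poch_zero]
lemma J_aux (p1 p2 p3 E E' T T' R V U U' w X b Z Z' W W' F F' r s v v' z ζ B B' A A' fx κ : ℂ)
   (hE : E = p1*E') (hT : T = T'*p2) (hR : R = p3*V) (hU : U = U'*v)
   (hA : b*A' = A*ζ) (hW : W = ζ*W') (hF : F = fx*F') (hB : v*B' = B*v') (hZ : Z = z*Z')
   (hv : v ≠ 0) (hv' : v' ≠ 0) (hz : z ≠ 0) (hζ : ζ ≠ 0) (hB0 : B ≠ 0) (hk : p1*p3*p2*X*fx*b = κ*v'*z) :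
   r*E*T*R/U*(w*X*A*s*W*F/(B'*Z)) = κ*(r*E'*T'*V/U'*(w*A'*s*W'*F'/(B*Z'))) := by
  have hB2 : B' = B*v'/v := by field_simp; linear_combination hB
  have hA2 : A = b*A'/ζ := by field_simp; linear_combination -hA
  have hX : κ = p1*p3*p2*X*fx*b/(v'*z) := by field_simp; linear_combination -hk
  rw [hE, hT, hR, hU, hW, hF, hZ, hB2, hA2, hX]
  trans p1*p3*p2*X*fx*b/(v'*z)*(r*E'*T'*V/U'*(w*A'*s*W'*F'/(B*Z')))*(ζ*ζ⁻¹)*(v*v⁻¹)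
  · simp only [div_eq_mul_inv, mul_inv, inv_inv]; ring
  · rw [mul_inv_cancel₀ hv, mul_inv_cancel₀ hζ]; ring
def JK (q ε α β γ δ : ℂ) (N : ℕ) : ℂ := (1-q*ε)*(1-q*δ)*γ*(1-(q^N)⁻¹)/(α*β*q)
lemma J_pre (q ε α β γ δ : ℂ) (M i n x a : ℕ) (G : Gen q ε α β γ δ (M+1)) (ha : a ≤ M) (hn : a + n ≤ M) :
   pre q ε α β γ δ (M+1) 0 i (n+1) x * hh q ε α β γ δ (M+1) (M+1) (n+1) a
   = JK q ε α β γ δ (M+1) * (pre q (ε*q) α β γ (δ*q) M 0 i n x * hh q (ε*q) α β γ (δ*q) M M n a) := by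
  have hq := G.hq
  have h0 := G.h0
  have h1 := G.h1
  have h2 := G.h2
  have h3 := G.h3
  have h4 := G.h4
  have hX : q^a ≠ 0 := pow_ne_zero _ hq
  have hM : q^M ≠ 0 := pow_ne_zero _ hq
  have e1 := poch_succ' q (q*ε) n
  have e2 := poch_succ q (q*γ) M
  have e3 := poch_succ' q (q*δ) M
  have e4 := poch_succ q (α*β*q) (M+1)
  have e5 := poch_shift q (q^(M+1))⁻¹ a
  have e6 := poch_succ' q (q^a/q^(M+1)) n
  have e7 := poch_succ' q (ε*γ*δ*q^(M+1+2)/q^a) n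
  have e8 := poch_shift q (α*β*q^(M+2)) a
  have e9 := poch_succ' q (γ*q^(M+1))⁻¹ (a+n)
  have w1 : (-(ε*α*q^(M+1+2+(n+1))))^a = (-(ε*q*α*q^(M+2+n)))^a*q^a := by
    rw [← mul_pow]; congr 1; ring
  have v1 : 1 - α*β*q*q^(M+1) ≠ 0 := by
    have := G.g12 (M+2) ø ø; convert this using 2; ring
  have v2 : 1 - α*β*q^(M+2)*q^a ≠ 0 := by
    have := G.g12 (M+2+a) ø ø; convert this using 2; ring
  have z1 : 1 - (γ*q^(M+1))⁻¹ ≠ 0 := by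
    have := inv_ne hq γ h3 (M+1) 0 ø (G.g3 _ ø ø); simpa using this
  have y1 : 1 - (q^(M+1))⁻¹*q^a ≠ 0 := by
    have := qinv_ne hq G.q1 a 0 ø
    convert this using 2; ring
  have b1 : Ψ q (α*β*q^(M+2)) a ≠ 0 := by
    apply poch_ne; intro l hl
    have := G.g12 (M+2+l) ø ø; convert this using 2; ring
  have hbal := G.bal
  have k1 : (1-q*ε)*(1-q*δ)*(1-q*γ*q^M)*q^a*(1-ε*γ*δ*q^(M+1+2)/q^a)*(1-(q^(M+1))⁻¹)
    = JK q ε α β γ δ (M+1) * (1 - α*β*q^(M+2)*q^a)*(1 - (γ*q^(M+1))⁻¹) := by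
    have : ε*γ*δ*q^(M+1+2)/q^a = (α*β*q^(M+2)*q^a)⁻¹ := by
      field_simp; rw [← hbal]; ring
    rw [this]
    unfold JK
    generalize 1-q*ε = s1
    generalize 1-q*δ = s2
    generalize 1 - (q^(M+1))⁻¹ = s3
    field_simp
    ring
  have := J_aux _ _ _ _ _ _ _ _ _ _ _ ((-(ε*q*α*q^(M+2+n)))^a) (q^a) _ _ _ _ _ _ _
    (Ψ q (q^(n+1)/q^(M+1)) i * Ψ q (q*β) i * Ψ q (q*β) x)
    (q^(a*(a-1)/2) * (1-α*β*q^(2*a+1)) * Ψ q (α*β*q) a * Ψ q (q*β) a * Ψ q (α*β*δ*q^(M+1+2)) a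
      * Ψ q (ε*δ*q^(M+1+(n+1)+1))⁻¹ a / (Ψ q q a * Ψ q (q*α) a * Ψ q (δ*q^(M+1))⁻¹ a)) _ _ _ _ _ _ _ _ _ _
    e1 e2 e3 e4 e5 (e6.trans (by rw [show q^a/q^(M+1) = (q^(M+1))⁻¹*q^a by ring])) e7
    (by rw [← e8, show α*β*q*q^(M+1) = α*β*q^(M+2) by ring]) e9 v1 v2 z1 y1 b1 k1
  unfold pre hh hnum hden
  rw [w1]
  have w2 : ε*q*(δ*q)*q^(M+n+1) = ε*δ*q^(M+1+(n+1)+1) := by ring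
  have w4 : ε*q*γ*(δ*q)*q^(M+2)/q^a = ε*γ*δ*q^(M+1+2)/q^a*q := by ring
  have w5 : q^a/q^M = (q^(M+1))⁻¹*q^a*q := by field_simp; try ring
  have w6 : α*β*(δ*q)*q^(M+2) = α*β*δ*q^(M+1+2) := by ring
  have w7 : (γ*q^M)⁻¹ = (γ*q^(M+1))⁻¹*q := by field_simp; try ring
  have w8 : δ*q*q^M = δ*q^(M+1) := by ring
  have w9 : q^n/q^M = q^(n+1)/q^(M+1) := by field_simp; try ring
  have w10 : (q^M)⁻¹ = (q^(M+1))⁻¹*q := by field_simp; try ring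
  have w11 : α*β*q^(M+1+2) = α*β*q^(M+2)*q := by ring
  rw [add_zero, add_zero, w2, w4, w5, w6, w7, w8, w9, w10, w11, show q*(ε*q) = q*ε*q by ring, show q*(δ*q) = q*δ*q by ring,
    show a+(n+1) = a+n+1 by ring, poch_zero, poch_zero]
  refine Eq.trans ?_ (this.trans ?_)
  · ring
  · ring
lemma Jstep (q ε α β γ δ : ℂ) (M i n x : ℕ) (G : Gen q ε α β γ δ (M+1)) (hx : x ≤ M+1) :
   FF q ε α β γ δ (M+1) 0 i (n+1) x =
    JK q ε α β γ δ (M+1) * ((1-β*δ*q^(x+1))*((q^(M+1))⁻¹ - (q^x)⁻¹)/((1-(q^(M+1))⁻¹)*(β*δ*q^(x+1)-(q^x)⁻¹))) *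
      FF q (ε*q) α β γ (δ*q) M 0 i n x
    + JK q ε α β γ δ (M+1) * ((1-β*q^x)*(1-(q^x)⁻¹)*(β*δ*q^(x+1)-(q^(M+1))⁻¹)/((1-(q^(M+1))⁻¹)*(β*δ*q^(x+1)-(q^x)⁻¹))) *
      FF q (ε*q) α β γ (δ*q) M 0 i n (x-1) := by
  have hq := G.hq
  have hX : q^x ≠ 0 := pow_ne_zero _ hq
  unfold FF HH
  rw [sum_range_succ, add_zero, hh_zero q _ _ _ _ _ _ (M+1) _ (M+1) hq le_rfl ø]
  simp only [zero_mul, add_zero, mul_sum, ← sum_add_distrib]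
  apply sum_congr rfl
  intro a ha
  have ha : a ≤ M := by have := mem_range.1 ha; omega
  by_cases hn : M < a + n
  · rw [hh_zero q _ _ _ _ _ _ (M+1) _ a hq ø ø, hh_zero q _ _ _ _ _ _ M _ a hq ø ø]
    ring
  have P1 := J_pre q ε α β γ δ M i n x a G ha ø
  have g0 : 1 - (q^(M+1))⁻¹ ≠ 0 := by
    have := qinv_ne hq G.q1 0 0 ø; simpa using this
  have d0 : β*δ*q^(x+1)-(q^x)⁻¹ ≠ 0 := by
    have := G.g24 (2*x+1) ø ø
    intro h; apply this
    have e : q^(2*x+1) = q^(x+1)*q^x := by ring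
    rw [e]; field_simp at h; linear_combination -h
  have r := R2 q (q^x)⁻¹ (β*δ*q^(x+1)) (q^a)⁻¹ (β*α*q^(a+1)) (q*β) (q^(M+1))⁻¹ (δ*β*α*q^(M+1)*q^2) (a+1) (by
    intro k hk
    have := qinv_ne hq G.q1 0 k ø; convert this using 2; ring)
  rw [ph_swapAC, ph_swapfg, SS_ph q δ β α (q^(M+1)) _ _ _ _ _ _ _ a x hq rfl rfl rfl (by ring) rfl rfl rfl _ ø,
   ph_swapAC, ph_swapfg, SS_ph q (δ*q) β α (q^M) _ _ _ _ _ _ _ a x hq rfl rfl rfl (by ring) rfl (by ring) (by field_simp; try ring) _ ø] at r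
  rw [SS_x0 _ _ _ _ _ _ hq, SS_x0 _ _ _ _ _ _ hq]
  rw [show q^M/q^n = q^(M+1)/q^(n+1) by field_simp; try ring]
  rcases x with _ | m
  · simp only [pow_zero, inv_one, sub_self, zero_mul, mul_zero, zero_div, add_zero] at r ⊢
    have r2 : SS q δ β α (q^(M+1)) a 0 = (1-β*δ*q^(0+1))*((q^(M+1))⁻¹ - 1)/((1-(q^(M+1))⁻¹)*(β*δ*q^(0+1)-1)) * SS q (δ*q) β α (q^M) a 0 := by
      rw [pow_zero, inv_one] at d0
      rw [div_mul_eq_mul_div, eq_div_iff (mul_ne_zero g0 d0)]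
      linear_combination r
    rw [r2]
    linear_combination ((1-β*δ*q^(0+1))*((q^(M+1))⁻¹ - 1)/((1-(q^(M+1))⁻¹)*(β*δ*q^(0+1)-1)) * SS q (δ*q) β α (q^M) a 0 * SS q α β γ (q^(M+1)/q^(n+1)) i a) * P1
  · rw [ph_swapAC q _ _ (q^a)⁻¹, ph_swapfg q _ _ _ _ _ ((q^(M+1))⁻¹*q), SS_ph q (δ*q) β α (q^M) _ _ _ _ _ _ _ a m hq rfl rfl (by field_simp; try ring) (by ring) rfl (by ring) (by field_simp; try ring) _ ø] at r
    rw [Nat.add_sub_cancel]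
    have P2 := J_pre q ε α β γ δ M i n m a G ha ø
    have P3 : pre q ε α β γ δ (M+1) 0 i (n+1) (m+1) = (1-β*q^(m+1))*pre q ε α β γ δ (M+1) 0 i (n+1) m := by
      unfold pre; rw [poch_succ q (q*β) m]; ring
    rw [P3] at P1 ⊢
    set V := (1-(q^(M+1))⁻¹)*(β*δ*q^(m+1+1)-(q^(m+1))⁻¹) with hV
    have V0 : V ≠ 0 := mul_ne_zero g0 d0
    have r2 : SS q δ β α (q^(M+1)) a (m+1) = (1-β*δ*q^(m+1+1))*((q^(M+1))⁻¹ - (q^(m+1))⁻¹)/V * SS q (δ*q) β α (q^M) a (m+1)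
     + (1-(q^(m+1))⁻¹)*(β*δ*q^(m+1+1)-(q^(M+1))⁻¹)/V * SS q (δ*q) β α (q^M) a m := by
      rw [div_mul_eq_mul_div, div_mul_eq_mul_div, ← add_div, eq_div_iff V0]
      linear_combination r
    rw [r2]
    linear_combination ((1-β*δ*q^(m+1+1))*((q^(M+1))⁻¹ - (q^(m+1))⁻¹)/V * SS q (δ*q) β α (q^M) a (m+1) * SS q α β γ (q^(M+1)/q^(n+1)) i a) * P1
     + ((1-β*q^(m+1))*(1-(q^(m+1))⁻¹)*(β*δ*q^(m+1+1)-(q^(M+1))⁻¹)/V * SS q (δ*q) β α (q^M) a m * SS q α β γ (q^(M+1)/q^(n+1)) i a) * P2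
lemma Ia_aux (r s w X κ b ζ u1 B2 e1 ε f1 φ g1 γ m1 μ r1 t1 w0 w1 xc
   A A' B B' C C' Z Z' J J' M M' Pg Pg' E E' T T' R R' U U' : ℂ)
   (hPg : Pg = g1*Pg') (hE : E = e1*E') (hT : T = t1*T') (hR : R = R'*r1) (hU : U = u1*U')
   (hA : b*A' = A*ζ) (hB : u1*B' = B*B2) (hC : e1*C' = C*ε) (hZ : f1*Z' = Z*φ) (hJ : ζ*J' = J*γ) (hM : m1*M' = M*μ)
   (hX : X ≠ 0) (hζ : ζ ≠ 0) (hu : u1 ≠ 0) (he : e1 ≠ 0) (hf : f1 ≠ 0) (hg : g1 ≠ 0) (hm : m1 ≠ 0) (hμ : μ ≠ 0) (hw0 : w0 ≠ 0) (hw1 : w1 ≠ 0)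
   (hk : r1*μ = xc*m1) (hκ : κ = e1*t1*b*xc/w1) :
   r*Pg*E*T*R/U*(s*(w*X)*A*w0*B*C*Z*J/M)*(B2*(-ε*X⁻¹)*(-φ*X⁻¹)*(-γ*X⁻¹)/(e1*f1*g1*(-w0*X⁻¹)*X⁻¹))
   = κ*(r*Pg'*E'*T'*R'/U'*(s*w*A'*w1*B'*C'*Z'*J'/M')) := by
  have hA2 : A = b*A'/ζ := by field_simp; linear_combination -hA
  have hM2 : M = m1*M'/μ := by field_simp; linear_combination -hM
  have hk2 : xc = r1*μ/m1 := by field_simp; linear_combination -hk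
  rw [hPg, hE, hT, hR, hU, hM2, hκ, hk2, hA2]
  trans (B*B2)*(C*ε)*(Z*φ)*(J*γ)*((r*Pg'*E'*(t1*T')*(R'*r1)/U'*(s*w*(b*A')/M')*μ/(u1*f1*m1*ζ))
     *(X*X⁻¹)^3*(g1*g1⁻¹)*(w0*w0⁻¹)*(e1*e1⁻¹))
  · simp only [div_eq_mul_inv, mul_inv, inv_inv, inv_neg]; ring
  rw [← hB, ← hC, ← hZ, ← hJ]
  trans (e1*t1*b*(r1*μ/m1)/w1*(r*Pg'*E'*T'*R'/U'*(s*w*A'*w1*B'*C'*Z'*J'/M')))*(u1*u1⁻¹)*(f1*f1⁻¹)*(ζ*ζ⁻¹)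
  · rw [mul_inv_cancel₀ hX, mul_inv_cancel₀ hg, mul_inv_cancel₀ hw0, mul_inv_cancel₀ he]
    trans (e1*t1*b*(r1*μ/m1)*(r*Pg'*E'*T'*R'/U'*(s*w*A'*B'*C'*Z'*J'/M')))*(u1*u1⁻¹)*(f1*f1⁻¹)*(ζ*ζ⁻¹)*(w1*w1⁻¹)
    · rw [mul_inv_cancel₀ hw1]; ring
    · ring
  · rw [mul_inv_cancel₀ hu, mul_inv_cancel₀ hf, mul_inv_cancel₀ hζ]; ring
def IK (q β γ : ℂ) (N : ℕ) : ℂ := (1-q*β)*(1-q*γ)*(1-(q^N)⁻¹)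
lemma Ia (q ε α β γ δ : ℂ) (M n j a : ℕ) (G : Gen q ε α β γ δ (M+1)) (ha : a ≤ M) (hj : j ≤ M) :
   pre q ε α β γ δ (M+1) 0 (n+1) j 0 * hh q ε α β γ δ (M+1) (M+1) j a *
    al (q^a)⁻¹ (α*β*q^(a+1)) (q*β) (α*β*γ*(q^(M+1)/q^j)*q^2) (q^j/q^(M+1))
   = IK q β γ (M+1) * (q^a - δ*q^(M+1))/(1-α*β*q^(2*a+2)) * (pre q ε α (β*q) (γ*q) δ M 0 n j 0 *
    hh q ε α (β*q) (γ*q) δ M M j a) := by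
  have hq := G.hq
  have h0 := G.h0
  have h1 := G.h1
  have h2 := G.h2
  have h3 := G.h3
  have h4 := G.h4
  have hX : q^a ≠ 0 := pow_ne_zero _ hq
  have hM : q^M ≠ 0 := pow_ne_zero _ hq
  have hY : q^j ≠ 0 := pow_ne_zero _ hq
  have hbal := G.bal
  have hz : (ε*δ*q^(M+1+j+1))⁻¹ = α*β*γ*(q^(M+1)/q^j)*q^2 := by
    field_simp; linear_combination (-q^j)*hbal
  have e1 := poch_succ' q (q^j/q^(M+1)) n
  have e2 := poch_succ' q (q*β) n
  have e3 := poch_succ' q (q*γ) M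
  have e4 := poch_succ q (q*δ) M
  have e5 := poch_succ' q (α*β*q) (M+1)
  have e6 := poch_shift q (q^(M+1))⁻¹ a
  have e7 := poch_shift q (α*β*q) a
  have e8 := poch_shift q (q*β) a
  have e9 := poch_shift q (α*β*γ*(q^(M+1)/q^j)*q^2) a
  have e10 := poch_shift q ((q^(M+1))⁻¹*q^a) j
  have e11 := poch_shift q (δ*q^(M+1))⁻¹ a
  have n1 : 1 - (q^(M+1))⁻¹*q^a ≠ 0 := by
    have := qinv_ne hq G.q1 a 0 ø
    convert this using 2; ring
  have n2 : 1 - α*β*q ≠ 0 := by have := G.g12 1 ø ø; rwa [pow_one] at this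
  have n3 : 1 - q*β ≠ 0 := by have := G.g2 1 ø ø; rwa [pow_one, mul_comm] at this
  have n4 : 1 - α*β*γ*(q^(M+1)/q^j)*q^2 ≠ 0 := by
    have := G.g123 (M+1-j+2) ø ø; convert this using 2
    have e : q^(M+1) = q^(M+1-j)*q^j := by rw [← pow_add]; congr 1; omega
    rw [e, pow_add]; field_simp
  have n5 : 1 - q^j/q^(M+1) ≠ 0 := by have := qinv_ne hq G.q1 j 0 ø; rwa [pow_zero, mul_one] at this
  have n6 : 1 - (δ*q^(M+1))⁻¹ ≠ 0 := by
    have := inv_ne hq δ h4 (M+1) 0 ø (G.g4 _ ø ø); simpa using this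
  have n7 := inv_ne hq δ h4 (M+1) a ø (G.g4 _ ø ø)
  have n8 := G.g12 (2*a+1) ø ø
  have n9 := G.g12 (2*a+2) ø ø
  have w1 : (-(ε*α*q^(M+1+2+j)))^a = (-(ε*α*q^(M+2+j)))^a*q^a := by
    rw [← mul_pow]; congr 1; ring
  have hk : (1 - q*δ*q^M)*(1 - (δ*q^(M+1))⁻¹*q^a) = (q^a - δ*q^(M+1))*(1 - (δ*q^(M+1))⁻¹) := by
    field_simp; ring
  have := Ia_aux (r := Ψ q (q*ε) j) (s := q^(a*(a-1)/2) * Ψ q (α*β*δ*q^(M+1+2)) a * Ψ q (ε*γ*δ*q^(M+1+2)/q^a) j /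
     (Ψ q q a * Ψ q (q*α) a * Ψ q (α*β*q^(M+1+2)) a * Ψ q (γ*q^(M+1))⁻¹ (a+j)))
    (w := (-(ε*α*q^(M+2+j)))^a) (X := q^a) (γ := 1 - q^j/q^(M+1)*q^a) (κ := _) (b := _) (ζ := _) (u1 := _) (B2 := _) (e1 := _) (ε := _) (f1 := _) (φ := _) (g1 := _) (m1 := _) (μ := _) (r1 := _) (t1 := _) (w0 := _) (w1 := _) (xc := _) (A := _) (A' := _) (B := _) (B' := _) (C := _) (C' := _) (Z := _) (Z' := _) (J := _) (J' := _) (M := _) (M' := _) (Pg := _) (Pg' := _) (E := _) (E' := _) (T := _) (T' := _) (R := _) (R' := _) (U := _) (U' := _)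
    e1 e2 e3 e4 e5 e6 e7 e8 e9 (e10.trans (by rw [show (q^(M+1))⁻¹*q^a*q^j = q^j/q^(M+1)*q^a by ring])) e11 hX n1 n2 n3 n4 n5 n6 n7 n8 n9 hk rfl
  unfold pre hh hnum hden IK al
  have hBe : α*β*q^(a+1) - (q^a)⁻¹ = -(1 - α*β*q^(2*a+1)) * (q^a)⁻¹ := by
    have : q^(2*a+1) = q^a*q^a*q := by ring
    rw [this]; field_simp; ring
  have l1 : q*β - (q^a)⁻¹ = -(1-q*β*q^a)*(q^a)⁻¹ := by field_simp; ring
  have l2 : α*β*γ*(q^(M+1)/q^j)*q^2 - (q^a)⁻¹ = -(1-α*β*γ*(q^(M+1)/q^j)*q^2*q^a)*(q^a)⁻¹ := by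
    generalize α*β*γ*(q^(M+1)/q^j)*q^2 = f; field_simp; ring
  have l3 : q^j/q^(M+1) - (q^a)⁻¹ = -(1-q^j/q^(M+1)*q^a)*(q^a)⁻¹ := by
    generalize q^j/q^(M+1) = f; field_simp; ring
  have l4 : 1 - α*β*q^(a+1) = 1 - α*β*q*q^a := by ring
  rw [w1, hBe, l1, l2, l3, l4, hz]
  have w2 : (ε*δ*q^(M+j+1))⁻¹ = α*β*γ*(q^(M+1)/q^j)*q^2*q := by
    rw [← hz]; field_simp; ring
  have w4 : ε*(γ*q)*δ*q^(M+2)/q^a = ε*γ*δ*q^(M+1+2)/q^a := by ring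
  have w5 : q^a/q^M = (q^(M+1))⁻¹*q^a*q := by field_simp; try ring
  have w5' : q^a/q^(M+1) = (q^(M+1))⁻¹*q^a := by field_simp
  have w6 : α*(β*q)*δ*q^(M+2) = α*β*δ*q^(M+1+2) := by ring
  have w7 : γ*q*q^M = γ*q^(M+1) := by ring
  have w8 : (δ*q^M)⁻¹ = (δ*q^(M+1))⁻¹*q := by field_simp; try ring
  have w9 : q^j/q^M = q^j/q^(M+1)*q := by field_simp; try ring
  have w10 : (q^M)⁻¹ = (q^(M+1))⁻¹*q := by field_simp; try ring
  have w11 : α*(β*q)*q^(M+2) = α*β*q^(M+1+2) := by ring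
  have w12 : 1-α*(β*q)*q^(2*a+1) = 1-α*β*q^(2*a+2) := by ring
  rw [add_zero, add_zero, w2, w4, w5, w5', w6, w7, w8, w9, w10, w11, w12, show q*(β*q) = q*β*q by ring, show q*(γ*q) = q*γ*q by ring,
    show α*(β*q)*q = α*β*q*q by ring, poch_zero, poch_zero, poch_zero]
  refine Eq.trans ?_ (this.trans ?_)
  · ring
  · ring
lemma Ib_aux (r w wa X qs n1 u1 e1 f1 g1 m1 r1 t1 w0 w1 δ kd hd vd wd q β f Bb φ v
   A' B' C' D Z' J F0 F' Kd H V M' W Pg' E' T' R' U' κ : ℂ)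
   (hF : F0*φ = -(vd/(v*X))*F')
   (hX : X ≠ 0) (hu : u1 ≠ 0) (he : e1 ≠ 0) (hf : f1 ≠ 0) (hg : g1 ≠ 0) (hm : m1 ≠ 0) (hw0 : w0 ≠ 0) (hw1 : w1 ≠ 0)
   (hkd : kd ≠ 0) (hhd : hd ≠ 0) (hvd : vd ≠ 0) (hwd : wd ≠ 0) (hv : v ≠ 0) (hq : q ≠ 0) (hB : Bb ≠ 0)
   (hk : r1*w*q*β*f = v*m1) (hκ : κ = - e1*t1*n1*X*δ/w1) :
   r*(g1*Pg')*(e1*E')*(t1*T')*(R'*r1)/(u1*U')*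
   (w*wa*X*(qs*X)*(n1*A')*w0*(u1*B')*(e1*C')*(D*δ)*(f1*Z')*J*F0/((Kd*kd)*(H*hd)*V*vd*(m1*M')*(W*wd)))*
   ((-kd*(q*X)⁻¹)*(q*β*hd)*(f*wd)*(-Bb*φ)/(e1*f1*g1*(w0*(q*X)⁻¹)*Bb))
   = κ*(r*Pg'*E'*T'*R'/U'*(wa*qs*A'*w1*B'*C'*D*Z'*J*F'/(Kd*H*V*M'*W))) := by
  subst hκ
  trans (F0*φ)*((r1*w*q*β*f)*(r*Pg'*E'*(t1*T')*R'/U'*(wa*qs*(n1*A')*B'*(e1*C')*(D*δ)*Z'*J/(Kd*H*V*M'*W)))/(vd*m1)*X*X)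
     *(g1*g1⁻¹)*(e1*e1⁻¹)*(f1*f1⁻¹)*(u1*u1⁻¹)*(w0*w0⁻¹)*(kd*kd⁻¹)*(hd*hd⁻¹)*(wd*wd⁻¹)*(Bb*Bb⁻¹)*(q*q⁻¹)*(X*X⁻¹)
  · simp only [div_eq_mul_inv, mul_inv, inv_inv, inv_neg]; ring
  rw [hF, hk, mul_inv_cancel₀ hg, mul_inv_cancel₀ he, mul_inv_cancel₀ hf, mul_inv_cancel₀ hu, mul_inv_cancel₀ hw0, mul_inv_cancel₀ hkd,
   mul_inv_cancel₀ hhd, mul_inv_cancel₀ hwd, mul_inv_cancel₀ hB, mul_inv_cancel₀ hq, mul_inv_cancel₀ hX]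
  trans (-(e1*t1*n1*X*δ)*(r*Pg'*E'*T'*R'/U'*(wa*qs*A'*B'*C'*D*Z'*J*F'/(Kd*H*V*M'*W))))*(vd*vd⁻¹)*(v*v⁻¹)*(m1*m1⁻¹)*(X*X⁻¹)
  · simp only [div_eq_mul_inv, mul_inv, inv_inv, inv_neg]; ring
  trans (-(e1*t1*n1*X*δ)*(r*Pg'*E'*T'*R'/U'*(wa*qs*A'*B'*C'*D*Z'*J*F'/(Kd*H*V*M'*W))))*(w1*w1⁻¹)
  · rw [mul_inv_cancel₀ hvd, mul_inv_cancel₀ hv, mul_inv_cancel₀ hm, mul_inv_cancel₀ hX, mul_inv_cancel₀ hw1]; ring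
  · simp only [div_eq_mul_inv, mul_inv, inv_inv, inv_neg]; ring
lemma tri_succ (a : ℕ) : (a+1)*(a+1-1)/2 = a*(a-1)/2 + a := by
  have := Nat.triangle_succ a
  omega
set_option maxHeartbeats 1000000 in
lemma Ib (q ε α β γ δ : ℂ) (M n j a : ℕ) (G : Gen q ε α β γ δ (M+1)) (ha : a ≤ M) (hj : j ≤ M) :
   pre q ε α β γ δ (M+1) 0 (n+1) j 0 * hh q ε α β γ δ (M+1) (M+1) j (a+1) *
    al (α*β*q^(a+1+1)) (q^(a+1))⁻¹ (q*β) (α*β*γ*(q^(M+1)/q^j)*q^2) (q^j/q^(M+1))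
   = - IK q β γ (M+1) * (q^a*(1 - α*β*δ*q^(M+1+2)*q^a))/(1-α*β*q^(2*a+2)) * (pre q ε α (β*q) (γ*q) δ M 0 n j 0 *
    hh q ε α (β*q) (γ*q) δ M M j a) := by
  have hq := G.hq
  by_cases haj : M < a + j
  · rw [hh_zero q _ _ _ _ _ _ (M+1) _ (a+1) hq ø ø, hh_zero q _ _ _ _ _ _ M _ a hq ø ø]
    ring
  have h0 := G.h0
  have h1 := G.h1
  have h2 := G.h2
  have h3 := G.h3
  have h4 := G.h4
  have hX : q^a ≠ 0 := pow_ne_zero _ hq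
  have hM : q^M ≠ 0 := pow_ne_zero _ hq
  have hY : q^j ≠ 0 := pow_ne_zero _ hq
  have hbal := G.bal
  have hz : (ε*δ*q^(M+1+j+1))⁻¹ = α*β*γ*(q^(M+1)/q^j)*q^2 := by
    field_simp; linear_combination (-q^j)*hbal
  have e6 := poch_shift q (ε*γ*δ*q^(M+1+1)/q^a) j
  have n2 : 1 - α*β*q ≠ 0 := by have := G.g12 1 ø ø; rwa [pow_one] at this
  have n3 : 1 - q*β ≠ 0 := by have := G.g2 1 ø ø; rwa [pow_one, mul_comm] at this
  have n4 : 1 - α*β*γ*(q^(M+1)/q^j)*q^2 ≠ 0 := by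
    have := G.g123 (M+1-j+2) ø ø; convert this using 2
    have e : q^(M+1) = q^(M+1-j)*q^j := by rw [← pow_add]; congr 1; omega
    rw [e, pow_add]; field_simp
  have n5 : 1 - q^j/q^(M+1) ≠ 0 := by have := qinv_ne hq G.q1 j 0 ø; rwa [pow_zero, mul_one] at this
  have n6 : 1 - (δ*q^(M+1))⁻¹ ≠ 0 := by
    have := inv_ne hq δ h4 (M+1) 0 ø (G.g4 _ ø ø); simpa using this
  have n8 := G.g12 (2*a+3) ø ø
  have n9 := G.g12 (2*a+2) ø ø
  have n10 : 1 - q*q^a ≠ 0 := by have := G.q1 (a+1) ø ø; rwa [pow_succ, mul_comm] at this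
  have n11 : 1 - q*α*q^a ≠ 0 := by have := G.g1 (a+1) ø ø; convert this using 2; ring
  have n12 : 1 - α*β*q^(M+1+2)*q^a ≠ 0 := by have := G.g12 (M+1+2+a) ø ø; convert this using 2; ring
  have n13 := inv_ne hq γ h3 (M+1) (a+j) ø (G.g3 _ ø ø)
  have hv : α*β*q^(M+1+2) ≠ 0 := by simp [h1,h2,hq]
  have hF : 1 - ε*γ*δ*q^(M+1+1)/q^a = -((1 - α*β*q^(M+1+2)*q^a)/(α*β*q^(M+1+2)*q^a)) := by
    field_simp; linear_combination (-1)*hbal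
  rw [hF] at e6
  have hk : (1 - q*δ*q^M)*(-(ε*α*q^(M+1+2+j)))*q*β*(ε*δ*q^(M+1+j+1))⁻¹ = α*β*q^(M+1+2)*(1 - (δ*q^(M+1))⁻¹) := by
    field_simp; ring
  have := Ib_aux (Ψ q (q*ε) j) (-(ε*α*q^(M+1+2+j))) ((-(ε*α*q^(M+2+j)))^a) (q^a) (q^(a*(a-1)/2)) (1-(q^(M+1))⁻¹) (1-α*β*q) (1-q*β)
    (1 - α*β*γ*(q^(M+1)/q^j)*q^2) (1 - q^j/q^(M+1)) (1 - (δ*q^(M+1))⁻¹) (1-q*δ*q^M) (1-q*γ) (1-α*β*q^(2*a+3)) (1-α*β*q^(2*a+2))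
    (1 - α*β*δ*q^(M+1+2)*q^a) (1-q*q^a) (1-q*α*q^a) (1 - α*β*q^(M+1+2)*q^a) (1-(γ*q^(M+1))⁻¹*q^(a+j)) q β (ε*δ*q^(M+1+j+1))⁻¹ (α*β*q^(a+1+1))
    (1 - ε*γ*δ*q^(M+1+1)/q^a*q^j) (α*β*q^(M+1+2))
    (Ψ q ((q^(M+1))⁻¹*q) a) (Ψ q (α*β*q*q) a) (Ψ q (q*β*q) a) (Ψ q (α*β*δ*q^(M+1+2)) a) (Ψ q (α*β*γ*(q^(M+1)/q^j)*q^2*q) a)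
    (Ψ q (q^(a+1)/q^(M+1)) j) _ _ (Ψ q q a) (Ψ q (q*α) a) (Ψ q (α*β*q^(M+1+2)) a) (Ψ q ((δ*q^(M+1))⁻¹*q) a)
    (Ψ q (γ*q^(M+1))⁻¹ (a+j)) (Ψ q (q^j/q^(M+1)*q) n) (Ψ q (q*β*q) n) (Ψ q (q*γ*q) M) (Ψ q (q*δ) M) (Ψ q (α*β*q*q) (M+1)) _
    e6.symm hX n2 n3 n4 n5 n6 n8 n9 n10 n11 n12 n13 hv hq (by simp [h1,h2,hq]) hk rfl
  unfold pre hh hnum hden IK al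
  have l0 : 1 - (q^(a+1))⁻¹ = -(1-q*q^a)*(q*q^a)⁻¹ := by field_simp; ring
  have l1 : (q^(a+1))⁻¹ - α*β*q^(a+1+1) = (1 - α*β*q^(2*a+3))*(q*q^a)⁻¹ := by
    have : q^(2*a+3) = q^a*q^a*q^3 := by ring
    rw [this]; field_simp; ring
  have l2 : q*β - α*β*q^(a+1+1) = q*β*(1-q*α*q^a) := by ring
  have l3 : α*β*γ*(q^(M+1)/q^j)*q^2 - α*β*q^(a+1+1) = (ε*δ*q^(M+1+j+1))⁻¹*(1-(γ*q^(M+1))⁻¹*q^(a+j)) := by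
    rw [hz]; field_simp; try ring
  have l4 : q^j/q^(M+1) - α*β*q^(a+1+1) = -(α*β*q^(a+1+1))*(1 - ε*γ*δ*q^(M+1+1)/q^a*q^j) := by
    field_simp; linear_combination (-q^j*q^a)*hbal
  rw [l0, l1, l2, l3, l4, tri_succ, pow_add q (a*(a-1)/2) a, show a+1+j = a+j+1 by ring]
  have w1 : (-(ε*α*q^(M+1+2+j)))^(a+1) = -(ε*α*q^(M+1+2+j)) * (-(ε*α*q^(M+2+j)))^a*q^a := by
    rw [pow_succ, mul_assoc (-(ε*α*q^(M+1+2+j))), ← mul_pow, mul_comm]; congr 2; ring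
  rw [w1]
  have w2 : (ε*δ*q^(M+j+1))⁻¹ = α*β*γ*(q^(M+1)/q^j)*q^2*q := by
    rw [← hz]; field_simp; ring
  have w4 : ε*(γ*q)*δ*q^(M+2)/q^a = ε*γ*δ*q^(M+1+1)/q^a*q := by ring
  have w4' : ε*γ*δ*q^(M+1+2)/q^(a+1) = ε*γ*δ*q^(M+1+1)/q^a := by field_simp; try ring
  have w5 : q^a/q^M = q^(a+1)/q^(M+1) := by field_simp; try ring
  have w6 : α*(β*q)*δ*q^(M+2) = α*β*δ*q^(M+1+2) := by ring
  have w7 : γ*q*q^M = γ*q^(M+1) := by ring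
  have w8 : (δ*q^M)⁻¹ = (δ*q^(M+1))⁻¹*q := by field_simp; try ring
  have w9 : q^j/q^M = q^j/q^(M+1)*q := by field_simp; try ring
  have w10 : (q^M)⁻¹ = (q^(M+1))⁻¹*q := by field_simp; try ring
  have w11 : α*(β*q)*q^(M+2) = α*β*q^(M+1+2) := by ring
  have w12 : 1-α*(β*q)*q^(2*a+1) = 1-α*β*q^(2*a+2) := by ring
  rw [add_zero, add_zero, w2, w4, w4', w5, w6, w7, w8, w9, w10, w11, w12, show q*(β*q) = q*β*q by ring, show q*(γ*q) = q*γ*q by ring,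
    show α*(β*q)*q = α*β*q*q by ring, poch_zero, poch_zero, poch_zero, show 2*(a+1)+1 = 2*a+3 by ring]
  rw [poch_succ' q (q^(M+1))⁻¹, poch_succ' q (α*β*q), poch_succ' q (α*β*q), poch_succ' q (q*β), poch_succ' q (q*β), poch_succ q (α*β*δ*q^(M+1+2)),
    poch_succ q q, poch_succ q (q*α), poch_succ q (α*β*q^(M+1+2)), poch_succ' q (δ*q^(M+1))⁻¹, poch_succ q (γ*q^(M+1))⁻¹, poch_succ' q (q^j/q^(M+1)),
    poch_succ' q (q*γ), poch_succ q (q*δ), hz, poch_succ' q (α*β*γ*(q^(M+1)/q^j)*q^2)]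
  rw [hz] at this
  clear hk hF hv n13 n12 n11 n10 n9 n8 n6 n5 n4 n3 n2 e6 hz hbal l0 l1 l2 l3 l4 w1 w2 w4 w4' w5 w6 w7 w8 w9 w10 w11 w12 hX hM hY
  generalize 1 - q*q^a = g0 at this ⊢
  generalize 1 - q*α*q^a = g1 at this ⊢
  generalize 1 - α*β*q^(M+1+2)*q^a = g2 at this ⊢
  generalize 1 - (γ*q^(M+1))⁻¹*q^(a+j) = g3 at this ⊢
  generalize 1 - ε*γ*δ*q^(M+1+1)/q^a*q^j = g4 at this ⊢
  generalize 1 - α*β*q^(2*a+3) = g5 at this ⊢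
  generalize 1 - α*β*q^(2*a+2) = g6 at this ⊢
  generalize 1 - α*β*δ*q^(M+1+2)*q^a = g7 at this ⊢
  generalize 1 - (δ*q^(M+1))⁻¹ = g8 at this ⊢
  generalize 1 - q^j/q^(M+1) = g9 at this ⊢
  generalize 1 - α*β*γ*(q^(M+1)/q^j)*q^2 = g10 at this ⊢
  generalize 1 - q*β = g11 at this ⊢
  generalize 1 - q*γ = g12 at this ⊢
  generalize 1 - α*β*q = g13 at this ⊢
  generalize 1 - (q^(M+1))⁻¹ = g14 at this ⊢
  generalize 1 - q*δ*q^M = g15 at this ⊢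
  generalize Ψ q ((q^(M+1))⁻¹*q) a = g16 at this ⊢
  generalize Ψ q (α*β*q*q) a = g17 at this ⊢
  generalize Ψ q (q*β*q) a = g18 at this ⊢
  generalize Ψ q (α*β*δ*q^(M+1+2)) a = g19 at this ⊢
  generalize Ψ q (α*β*γ*(q^(M+1)/q^j)*q^2*q) a = g20 at this ⊢
  generalize Ψ q (q^(a+1)/q^(M+1)) j = g21 at this ⊢
  generalize Ψ q (ε*γ*δ*q^(M+1+1)/q^a) j = g22 at this ⊢
  generalize Ψ q (ε*γ*δ*q^(M+1+1)/q^a*q) j = g23 at this ⊢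
  generalize Ψ q q a = g24 at this ⊢
  generalize Ψ q (q*α) a = g25 at this ⊢
  generalize Ψ q (α*β*q^(M+1+2)) a = g26 at this ⊢
  generalize Ψ q ((δ*q^(M+1))⁻¹*q) a = g27 at this ⊢
  generalize Ψ q (γ*q^(M+1))⁻¹ (a+j) = g28 at this ⊢
  generalize Ψ q (α*β*q*q) (M+1) = g29 at this ⊢
  generalize α*β*γ*(q^(M+1)/q^j)*q^2 = g30 at this ⊢
  generalize α*β*q^(a+1+1) = g31 at this ⊢
  generalize -(ε*α*q^(M+1+2+j)) = g32 at this ⊢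
  generalize (-(ε*α*q^(M+2+j)))^a = g33 at this ⊢
  generalize q^(a*(a-1)/2) = g34 at this ⊢
  generalize q^a = g35 at this ⊢
  refine Eq.trans ?_ (this.trans ?_)
  · ring
  · ring
/-- R1 applied to S_i(a). -/
lemma I_S (q ε α β γ δ : ℂ) (M n j a : ℕ) (G : Gen q ε α β γ δ (M+1)) (ha : a ≤ M+1) (hj : n + j ≤ M) :
  SS q α β γ (q^(M+1)/q^j) (n+1) a =
   al (q^a)⁻¹ (α*β*q^(a+1)) (q*β) (α*β*γ*(q^(M+1)/q^j)*q^2) (q^j/q^(M+1)) * SS q α (β*q) (γ*q) (q^M/q^j) n a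
   + al (α*β*q^(a+1)) (q^a)⁻¹ (q*β) (α*β*γ*(q^(M+1)/q^j)*q^2) (q^j/q^(M+1)) * SS q α (β*q) (γ*q) (q^M/q^j) n (a-1) := by
  have hq := G.hq
  have hX : q^a ≠ 0 := pow_ne_zero _ hq
  have hY : q^j ≠ 0 := pow_ne_zero _ hq
  have hM : q^(M+1) ≠ 0 := pow_ne_zero _ hq
  have r := R1 q (q^a)⁻¹ (α*β*q^(a+1)) (q^(n+1))⁻¹ (β*γ*q^(n+1+1)) (q*β) (α*β*γ*(q^(M+1)/q^j)*q^2) (q^j/q^(M+1))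
   (inv_ne_zero hX) (by simp [G.h1, G.h2, hq]) (by
    have := G.g12 (2*a+1) ø ø
    intro h; apply this
    have e : q^(2*a+1) = q^(a+1)*q^a := by ring
    rw [e]; field_simp at h; linear_combination -h) (by field_simp; try ring) (n+1) (n+2) ø (inv_mul_cancel₀ (pow_ne_zero _ hq)) ø
    (by intro k hk; have := G.g2 (k+1) ø ø; convert this using 2; ring)
    (by
      intro k hk
      have := G.g123 (M+1-j+2+k) ø ø; convert this using 2
      have e : q^(M+1) = q^(M+1-j)*q^j := by rw [← pow_add]; congr 1; omega
      rw [e, pow_add, pow_add]; field_simp)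
    (by intro k hk; exact qinv_ne hq G.q1 j k ø)
    (by intro k hk; have := G.q1 (k+1) ø ø; convert this using 2; ring)
  rw [ph_swapAC, SS_ph q α β γ (q^(M+1)/q^j) _ _ _ _ _ _ _ (n+1) a hq rfl rfl rfl rfl rfl rfl (by field_simp) _ ø,
   ph_swapAC, SS_ph q α (β*q) (γ*q) (q^M/q^j) _ _ _ _ _ _ _ n a hq (by field_simp; try ring) (by ring) rfl (by ring) (by ring) (by ring) (by field_simp; try ring) _ ø] at r
  rw [r]
  congr 1
  rcases a with _ | b
  · unfold al; simp
  rw [ph_swapAC, SS_ph q α (β*q) (γ*q) (q^M/q^j) _ _ _ _ _ _ _ n b hq (by field_simp; try ring) (by ring) (by field_simp; try ring) (by ring) (by ring) (by ring) (by field_simp; try ring) _ ø]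
  rfl
lemma I_R6 (q ε α β γ δ : ℂ) (M x a : ℕ) (G : Gen q ε α β γ δ (M+1)) (ha : a ≤ M) (hx : x ≤ M+1) :
  (q^a - δ*q^(M+1))/(1-α*β*q^(2*a+2)) * SS q δ β α (q^(M+1)) a x
   - (q^a*(1 - α*β*δ*q^(M+1+2)*q^a))/(1-α*β*q^(2*a+2)) * SS q δ β α (q^(M+1)) (a+1) x
  = -(δ*q^(M+1)) * (s6 (q^x)⁻¹ (β*δ*q^(x+1)) (q*β) (q^(M+1))⁻¹ * SS q δ (β*q) α (q^M) a x
   + s6 (β*δ*q^(x+1)) (q^x)⁻¹ (q*β) (q^(M+1))⁻¹ * SS q δ (β*q) α (q^M) a (x-1)) := by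
  have hq := G.hq
  have h1 := G.h1
  have h2 := G.h2
  have h4 := G.h4
  have hX : q^a ≠ 0 := pow_ne_zero _ hq
  have hM : q^(M+1) ≠ 0 := pow_ne_zero _ hq
  have d := G.g12 (2*a+2) ø ø
  have e2 : q^(2*a+2) = q^(a+1)*q^(a+1) := by ring
  have d1 : (q^(a+1))⁻¹ - α*β*q^(a+1) = (1 - α*β*q^(2*a+2))/q^(a+1) := by
    rw [e2]; field_simp
  have r := R6 q (q^(a+1))⁻¹ (α*β*q^(a+1)) (q^x)⁻¹ (β*δ*q^(x+1)) (q*β) (α*β*δ*q^(M+1+1)) (q^(M+1))⁻¹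
    (by rw [d1]; exact div_ne_zero d (pow_ne_zero _ hq)) (by simp [h1,h2,h4,hq]) (by simp [hq]) (by simp [h2,h4,hq])
    (by
    have := G.g24 (2*x+1) ø ø
    intro h; apply this
    have e : q^(2*x+1) = q^(x+1)*q^x := by ring
    rw [e]; field_simp at h; linear_combination -h) (by field_simp; try ring) a (a+2) (inv_mul_cancel₀ (pow_ne_zero _ hq)) ø
    (by intro k hk; have := G.g2 (k+1) ø ø; convert this using 2; ring)
    (by intro k hk; have := qinv_ne hq G.q1 0 k ø; convert this using 2; ring)
    (by intro k hk; have := G.g124 (M+3+k) ø ø; convert this using 2; ring)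
    (by intro k hk; have := G.q1 (k+1) ø ø; convert this using 2; ring)
  rw [SS_ph q δ β α (q^(M+1)) _ _ _ _ _ _ _ a x hq (by field_simp; try ring) (by ring) rfl (by ring) rfl (by ring) rfl _ ø,
    SS_ph q δ β α (q^(M+1)) _ _ _ _ _ _ _ (a+1) x hq rfl (by ring) rfl (by ring) rfl (by ring) rfl _ ø,
    SS_ph q δ (β*q) α (q^M) _ _ _ _ _ _ _ a x hq (by field_simp; try ring) (by ring) rfl (by ring) (by ring) (by ring) (by field_simp; try ring) _ ø] at r
  have r3 : s6 (β*δ*q^(x+1)) (q^x)⁻¹ (q*β) (q^(M+1))⁻¹ * ph q ((q^(a+1))⁻¹*q) (α*β*q^(a+1)*q) ((q^x)⁻¹*q) (β*δ*q^(x+1)) (q*β*q) (α*β*δ*q^(M+1+1)*q) ((q^(M+1))⁻¹*q) (a+2)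
    = s6 (β*δ*q^(x+1)) (q^x)⁻¹ (q*β) (q^(M+1))⁻¹ * SS q δ (β*q) α (q^M) a (x-1) := by
    rcases x with _ | m
    · unfold s6; simp
    rw [SS_ph q δ (β*q) α (q^M) _ _ _ _ _ _ _ a m hq (by field_simp; try ring) (by ring) (by field_simp; try ring) (by ring) (by ring) (by ring) (by field_simp; try ring) _ ø]
    rfl
  rw [r3] at r
  rw [← r, d1]
  generalize SS q δ β α (q^(M+1)) a x = t1
  generalize SS q δ β α (q^(M+1)) (a+1) x = t2
  field_simp
  ring
lemma Istep (q ε α β γ δ : ℂ) (M n j x : ℕ) (G : Gen q ε α β γ δ (M+1)) (hj : n + j ≤ M) (hx : x ≤ M+1) :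
  FF q ε α β γ δ (M+1) 0 (n+1) j x = IK q β γ (M+1) * (-(δ*q^(M+1))) *
   (s6 (q^x)⁻¹ (β*δ*q^(x+1)) (q*β) (q^(M+1))⁻¹ * (1-q*β)/(1-β*q^(x+1)) * FF q ε α (β*q) (γ*q) δ M 0 n j x
   + s6 (β*δ*q^(x+1)) (q^x)⁻¹ (q*β) (q^(M+1))⁻¹ * (1-q*β) * FF q ε α (β*q) (γ*q) δ M 0 n j (x-1)) := by
  have hq := G.hq
  have px : pre q ε α β γ δ (M+1) 0 (n+1) j x = Ψ q (q*β) x * pre q ε α β γ δ (M+1) 0 (n+1) j 0 := by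
    unfold pre; rw [poch_zero q (q*β)]; ring
  have nx : 1 - β*q^(x+1) ≠ 0 := G.g2 _ ø ø
  have px' : (1-q*β)/(1-β*q^(x+1)) * pre q ε α (β*q) (γ*q) δ M 0 n j x = Ψ q (q*β) x * pre q ε α (β*q) (γ*q) δ M 0 n j 0 := by
    have := poch_shift q (q*β) x
    rw [div_mul_eq_mul_div, div_eq_iff nx]
    unfold pre; rw [poch_zero q (q*(β*q)), show q*(β*q) = q*β*q by ring]
    set E := Ψ q (q^j/q^(M+0)) n * Ψ q (q*β*q) n * Ψ q (q*ε) j * Ψ q (q*ε) 0 * Ψ q (q*(γ*q)) (M+0) * Ψ q (q*δ) M / Ψ q (α*(β*q)*q) (M+1) with hE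
    rw [show q*β*q^x = β*q^(x+1) by ring] at this
    linear_combination E * this
  have px'' : s6 (β*δ*q^(x+1)) (q^x)⁻¹ (q*β) (q^(M+1))⁻¹ * (1-q*β) * pre q ε α (β*q) (γ*q) δ M 0 n j (x-1)
     = s6 (β*δ*q^(x+1)) (q^x)⁻¹ (q*β) (q^(M+1))⁻¹ * (Ψ q (q*β) x * pre q ε α (β*q) (γ*q) δ M 0 n j 0) := by
    rcases x with _ | m
    · unfold s6; simp
    rw [poch_succ', Nat.add_sub_cancel]
    unfold pre; rw [poch_zero q (q*(β*q)), show q*(β*q) = q*β*q by ring]; ring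
  have key : ∑ a ∈ range (M+2), pre q ε α β γ δ (M+1) 0 (n+1) j 0 * hh q ε α β γ δ (M+1) (M+1) j a * SS q α β γ (q^(M+1)/q^j) (n+1) a * SS q δ β α (q^(M+1)) a x
    = ∑ a ∈ range (M+1), IK q β γ (M+1) * (pre q ε α (β*q) (γ*q) δ M 0 n j 0 * hh q ε α (β*q) (γ*q) δ M M j a) * SS q α (β*q) (γ*q) (q^M/q^j) n a *
     (-(δ*q^(M+1)) * (s6 (q^x)⁻¹ (β*δ*q^(x+1)) (q*β) (q^(M+1))⁻¹ * SS q δ (β*q) α (q^M) a x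
   + s6 (β*δ*q^(x+1)) (q^x)⁻¹ (q*β) (q^(M+1))⁻¹ * SS q δ (β*q) α (q^M) a (x-1))) := by
    have e1 : ∀ a ∈ range (M+2), pre q ε α β γ δ (M+1) 0 (n+1) j 0 * hh q ε α β γ δ (M+1) (M+1) j a * SS q α β γ (q^(M+1)/q^j) (n+1) a * SS q δ β α (q^(M+1)) a x
      = (pre q ε α β γ δ (M+1) 0 (n+1) j 0 * hh q ε α β γ δ (M+1) (M+1) j a * al (q^a)⁻¹ (α*β*q^(a+1)) (q*β) (α*β*γ*(q^(M+1)/q^j)*q^2) (q^j/q^(M+1)))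
         * SS q α (β*q) (γ*q) (q^M/q^j) n a * SS q δ β α (q^(M+1)) a x
       + (pre q ε α β γ δ (M+1) 0 (n+1) j 0 * hh q ε α β γ δ (M+1) (M+1) j a * al (α*β*q^(a+1)) (q^a)⁻¹ (q*β) (α*β*γ*(q^(M+1)/q^j)*q^2) (q^j/q^(M+1)))
         * SS q α (β*q) (γ*q) (q^M/q^j) n (a-1) * SS q δ β α (q^(M+1)) a x := by
      intro a ha
      rw [I_S q ε α β γ δ M n j a G (by have := mem_range.1 ha; omega) hj]; ring
    rw [sum_congr rfl e1, sum_add_distrib, sum_range_succ _ (M+1), sum_range_succ' _ (M+1)]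
    have z1 : hh q ε α β γ δ (M+1) (M+1) j (M+1) * al (q^(M+1))⁻¹ (α*β*q^(M+1+1)) (q*β) (α*β*γ*(q^(M+1)/q^j)*q^2) (q^j/q^(M+1)) = 0 := by
      rcases j with _ | k
      · unfold al; simp
      · rw [hh_zero q _ _ _ _ _ _ _ _ _ hq le_rfl ø]; ring
    have z2 : al (α*β*q^(0+1)) (q^0)⁻¹ (q*β) (α*β*γ*(q^(M+1)/q^j)*q^2) (q^j/q^(M+1)) = 0 := by
      unfold al; simp
    rw [z2, mul_assoc (pre _ _ _ _ _ _ _ _ _ _ _) _ (al (q^(M+1))⁻¹ _ _ _ _), z1]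
    simp only [mul_zero, zero_mul, add_zero]
    rw [← sum_add_distrib]
    apply sum_congr rfl
    intro a ha
    have ha : a ≤ M := by have := mem_range.1 ha; omega
    rw [Ia q ε α β γ δ M n j a G ha ø, Ib q ε α β γ δ M n j a G ha ø, ← I_R6 q ε α β γ δ M x a G ha hx, Nat.add_sub_cancel]
    ring
  have F1 : FF q ε α β γ δ (M+1) 0 (n+1) j x = Ψ q (q*β) x * ∑ a ∈ range (M+2), pre q ε α β γ δ (M+1) 0 (n+1) j 0 * hh q ε α β γ δ (M+1) (M+1) j a * SS q α β γ (q^(M+1)/q^j) (n+1) a * SS q δ β α (q^(M+1)) a x := by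
    unfold FF HH
    rw [px, mul_sum, mul_sum]
    apply sum_congr rfl
    intro a ha
    rw [SS_x0 _ _ _ _ _ _ hq, add_zero]; ring
  have F2 : s6 (q^x)⁻¹ (β*δ*q^(x+1)) (q*β) (q^(M+1))⁻¹ * (1-q*β)/(1-β*q^(x+1)) * FF q ε α (β*q) (γ*q) δ M 0 n j x
     = s6 (q^x)⁻¹ (β*δ*q^(x+1)) (q*β) (q^(M+1))⁻¹ * (Ψ q (q*β) x * pre q ε α (β*q) (γ*q) δ M 0 n j 0) * HH q ε α (β*q) (γ*q) δ M 0 n j x := by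
    rw [← px']; unfold FF; ring
  have F3 : s6 (β*δ*q^(x+1)) (q^x)⁻¹ (q*β) (q^(M+1))⁻¹ * (1-q*β) * FF q ε α (β*q) (γ*q) δ M 0 n j (x-1)
     = s6 (β*δ*q^(x+1)) (q^x)⁻¹ (q*β) (q^(M+1))⁻¹ * (Ψ q (q*β) x * pre q ε α (β*q) (γ*q) δ M 0 n j 0) * HH q ε α (β*q) (γ*q) δ M 0 n j (x-1) := by
    rw [← px'']; unfold FF; ring
  rw [F1, key, F2, F3]
  unfold HH
  simp only [mul_sum, ← sum_add_distrib]
  apply sum_congr rfl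
  intro a ha
  rw [SS_x0 _ _ _ _ _ _ hq, add_zero]; ring
lemma Gen.swap {q ε α β γ δ : ℂ} {N : ℕ} (G : Gen q ε α β γ δ N) : Gen q ε α β δ γ N where
  hq := G.hq
  h0 := G.h0
  h1 := G.h1
  h2 := G.h2
  h3 := G.h4
  h4 := G.h3
  bal := by rw [← G.bal]; ring
  gen := by
    intro e0 e1 e2 e3 e4 h0 h1 h2 h3 h4 hl hu k hk hk'
    have := G.gen e0 e1 e2 e4 e3 h0 h1 h2 h4 h3 ø ø k hk hk'
    convert this using 2; ring
  q1 := G.q1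
lemma SS_symm (q α β γ Q : ℂ) (n x : ℕ) (hq : q ≠ 0) : SS q α β γ Q n x = SS q γ β α Q x n := by
  unfold SS
  rw [ph_swapAC, SS_ph q γ β α Q _ _ _ _ _ _ _ x n hq rfl (by ring) rfl (by ring) rfl (by ring) rfl _ ø]
  rfl
lemma hh_swap (q ε α β γ δ : ℂ) (N a : ℕ) (G : Gen q ε α β γ δ N) :
   hh q ε α β γ δ N N 0 a = hh q ε α β δ γ N N 0 a := by
  have hq := G.hq
  have h0 := G.h0
  have h1 := G.h1
  have h2 := G.h2
  have h3 := G.h3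
  have h4 := G.h4
  have hbal := G.bal
  have e1 : (ε*δ*q^(N+0+1))⁻¹ = α*β*γ*q^(N+2) := by
    field_simp; linear_combination (-1)*hbal
  have e2 : (ε*γ*q^(N+0+1))⁻¹ = α*β*δ*q^(N+2) := by
    field_simp; linear_combination (-1)*hbal
  unfold hh hnum hden
  rw [e1, e2, poch_zero, poch_zero, poch_zero, add_zero]
  ring
lemma FF_swap (q ε α β γ δ : ℂ) (N x : ℕ) (G : Gen q ε α β γ δ N) :
   Ψ q (q^N)⁻¹ x * FF q ε α β γ δ N 0 0 0 x = FF q ε α β δ γ N 0 x 0 0 := by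
  have hq := G.hq
  unfold FF HH
  simp only [mul_sum]
  apply sum_congr rfl
  intro a ha
  rw [SS_x0 _ _ _ _ _ _ hq, SS_x0 _ _ _ _ _ _ hq, SS_n0 _ _ _ _ _ _ hq, SS_x0 _ _ _ _ _ _ hq, SS_symm q δ _ _ _ _ _ hq]
  rw [add_zero, hh_swap _ _ _ _ _ _ _ _ G, pow_zero, div_one]
  unfold pre
  rw [pow_zero, one_div, add_zero, poch_zero, poch_zero, poch_zero]
  ring
lemma Xstep (q ε α β γ δ : ℂ) (M m : ℕ) (G : Gen q ε α β γ δ (M+1)) (hm : m ≤ M) :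
   FF q ε α β γ δ (M+1) 0 0 0 (m+1) = -(γ*q^(M+1))*(1-q*β)*(1-q*δ) * FF q ε α (β*q) γ (δ*q) M 0 0 0 m := by
  have hq := G.hq
  have f1 := FF_swap q ε α β γ δ (M+1) (m+1) G
  have G' : Gen q ε α (β*q) γ (δ*q) M := by
    simpa using G.shift 0 0 1 0 1 rfl
  have f2 := FF_swap q ε α (β*q) γ (δ*q) M m G'
  have s := Istep q ε α β δ γ M m 0 0 G.swap ø ø
  have z1 : 1 - (q^(M+1))⁻¹ ≠ 0 := by
    have := qinv_ne hq G.q1 0 0 ø; simpa using this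
  have z2 : 1 - q*β ≠ 0 := by have := G.g2 1 ø ø; rwa [pow_one, mul_comm] at this
  have z3 : 1 - β*γ*q ≠ 0 := by have := G.g23 1 ø ø; rwa [pow_one] at this
  have s1 : s6 (q^0)⁻¹ (β*γ*q^(0+1)) (q*β) (q^(M+1))⁻¹ * (1-q*β)/(1-β*q^(0+1)) = 1 := by
    unfold s6
    rw [pow_zero, zero_add, pow_one, inv_one, mul_comm β q, mul_div_assoc, div_self z2, mul_one]
    have z3' : β*γ*q - 1 ≠ 0 := fun h => z3 (by linear_combination -h)
    rw [div_eq_one_iff_eq (by simp [z1, z2, z3'])]; ring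
  have s2 : s6 (β*γ*q^(0+1)) (q^0)⁻¹ (q*β) (q^(M+1))⁻¹ = 0 := by
    unfold s6; simp
  rw [s1, s2, ← f1, ← f2, poch_succ'] at s
  have pn : Ψ q ((q^(M+1))⁻¹*q) m ≠ 0 := by
    apply poch_ne; intro l hl
    have := qinv_ne hq G.q1 1 l ø
    convert this using 2; ring
  rw [show (q^M)⁻¹ = (q^(M+1))⁻¹*q by field_simp; try ring] at s
  unfold IK at s
  apply mul_left_cancel₀ (mul_ne_zero z1 pn)
  linear_combination s
def tt (q ε α β γ δ : ℂ) (N a : ℕ) : ℂ := pre q ε α β γ δ N 0 0 0 0 * hh q ε α β γ δ N N 0 a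
lemma tt_eq (q ε α β γ δ : ℂ) (N a : ℕ) (G : Gen q ε α β γ δ N) : tt q ε α β γ δ N a =
  Ψ q (q*γ) N * Ψ q (q*δ) N / Ψ q (α*β*q) (N+1) * (
   (-(ε*α*q^(N+2)))^a * q^(a*(a-1)/2) * Ψ q (q^N)⁻¹ a * (1-α*β*q^(2*a+1)) * Ψ q (α*β*q) a
    * Ψ q (q*β) a * Ψ q (α*β*δ*q^(N+2)) a * Ψ q (α*β*γ*q^(N+2)) a /
    (Ψ q q a * Ψ q (q*α) a * Ψ q (α*β*q^(N+2)) a * Ψ q (δ*q^N)⁻¹ a * Ψ q (γ*q^N)⁻¹ a)) := by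
  have hq := G.hq
  have h0 := G.h0
  have h4 := G.h4
  have hbal := G.bal
  have e1 : (ε*δ*q^(N+0+1))⁻¹ = α*β*γ*q^(N+2) := by
    field_simp; linear_combination (-1)*hbal
  unfold tt pre hh hnum hden
  rw [e1]
  simp only [poch_zero, add_zero, mul_one, one_mul]
lemma FF_tt (q ε α β γ δ : ℂ) (N : ℕ) (hq : q ≠ 0) : FF q ε α β γ δ N 0 0 0 0 = ∑ a ∈ range (N+1), tt q ε α β γ δ N a := by
  unfold FF HH tt
  rw [mul_sum]
  apply sum_congr rfl
  intro a ha
  rw [SS_x0 _ _ _ _ _ _ hq, SS_x0 _ _ _ _ _ _ hq, SS_n0 _ _ _ _ _ _ hq]; simp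
lemma b2_aux (e1 t1 E' T' U' v v' V V' A A' b ζ w X s : ℂ) (hA : b*A' = A*ζ) (hV : v*V = V'*v') (hb : b ≠ 0) (hX : X ≠ 0) (hv : v ≠ 0) (hv' : v' ≠ 0) :
  e1*t1*(E'*T'/U'*(w*A'*s/V')) = X⁻¹*ζ/b*v' * ((e1*E')*(t1*T')/(U'*v)*(w*X*A*s/V)) := by
  have hA2 : A' = A*ζ/b := by field_simp; linear_combination hA
  have hV2 : V = V'*v'/v := by field_simp; linear_combination hV
  rw [hA2, hV2]
  trans e1*t1*(E'*T'/U'*(w*(A*ζ/b)*s/V'))*(v'*v'⁻¹)*(v*v⁻¹)*(X*X⁻¹)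
  · rw [mul_inv_cancel₀ hX, mul_inv_cancel₀ hv, mul_inv_cancel₀ hv']; ring
  · simp only [div_eq_mul_inv, mul_inv, inv_inv]; ring
lemma b2 (q ε α β γ δ : ℂ) (M a : ℕ) (G : Gen q ε α β γ δ (M+1)) (ha : a ≤ M) :
  (1-q*γ)*(1-q*δ)*tt q ε α β (γ*q) (δ*q) M a
   = (q^a)⁻¹*(1-(q^(M+1))⁻¹*q^a)/(1-(q^(M+1))⁻¹)*(1-α*β*q^(M+2)*q^a) * tt q ε α β γ δ (M+1) a := by
  have hq := G.hq
  have h3 := G.h3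
  have h4 := G.h4
  have G' : Gen q ε α β (γ*q) (δ*q) M := by simpa using G.shift 0 0 0 1 1 rfl
  rw [tt_eq _ _ _ _ _ _ _ _ G', tt_eq _ _ _ _ _ _ _ _ G]
  have e6 := poch_shift q (q^(M+1))⁻¹ a
  have e7 := poch_shift q (α*β*q^(M+2)) a
  have z1 : 1 - (q^(M+1))⁻¹ ≠ 0 := by
    have := qinv_ne hq G.q1 0 0 ø; simpa using this
  have z2 := G.g12 (M+2) ø ø
  have z3 : 1 - α*β*q^(M+2)*q^a ≠ 0 := by
    have := G.g12 (M+2+a) ø ø; convert this using 2; ring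
  have hX : q^a ≠ 0 := pow_ne_zero _ hq
  have := b2_aux (1-q*γ) (1-q*δ) (Ψ q (q*γ*q) M) (Ψ q (q*δ*q) M) (Ψ q (α*β*q) (M+1)) _ _ _ _ _ _ _ _ ((-(ε*α*q^(M+2)))^a) (q^a)
    (q^(a*(a-1)/2) * (1-α*β*q^(2*a+1)) * Ψ q (α*β*q) a
    * Ψ q (q*β) a * Ψ q (α*β*δ*q^(M+1+2)) a * Ψ q (α*β*γ*q^(M+1+2)) a /
    (Ψ q q a * Ψ q (q*α) a * Ψ q (δ*q^(M+1))⁻¹ a * Ψ q (γ*q^(M+1))⁻¹ a)) e6 e7 z1 hX z2 z3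
  have w1 : (-(ε*α*q^(M+1+2)))^a = (-(ε*α*q^(M+2)))^a*q^a := by
    rw [← mul_pow]; congr 1; ring
  rw [w1, show q*(γ*q) = q*γ*q by ring, show q*(δ*q) = q*δ*q by ring, show α*β*(δ*q)*q^(M+2) = α*β*δ*q^(M+1+2) by ring,
   show α*β*(γ*q)*q^(M+2) = α*β*γ*q^(M+1+2) by ring, show δ*q*q^M = δ*q^(M+1) by ring, show γ*q*q^M = γ*q^(M+1) by ring,
   show (q^M)⁻¹ = (q^(M+1))⁻¹*q by field_simp; try ring, poch_succ' q (q*γ), poch_succ' q (q*δ), poch_succ q (α*β*q) (M+1),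
   show α*β*q^(M+1+2) = α*β*q^(M+2)*q by ring, show α*β*q*q^(M+1) = α*β*q^(M+2) by ring]
  refine Eq.trans ?_ (this.trans ?_)
  · ring
  · ring
lemma b1_aux (κ w0 w1 e1 t1 E' T' U' u B B' Bx C C' c Cx V V' v v' W W' y y' A A' b ζ s : ℂ) (hA : b*A' = A*ζ) (hB : u*B' = B*Bx) (hC : c*C' = C*Cx)
   (hV : v*V' = V*v') (hW : y*W' = W*y')
   (hb : b ≠ 0) (hu : u ≠ 0) (he : e1 ≠ 0) (ht : t1 ≠ 0) (hv' : v' ≠ 0) (hy' : y' ≠ 0) (hv : v ≠ 0) (hy : y ≠ 0) (hw0 : w0 ≠ 0)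
   :
  c*(E'*T'/U'*(s*A'*w1*B'*C'/(V'*W'))) = v*y/(e1*t1)*(w1/w0*ζ*Bx*Cx/(b*v'*y')) * ((E'*e1)*(T'*t1)/(u*U')*(s*A*w0*B*C/(V*W))) := by
  have hA2 : A' = A*ζ/b := by field_simp; linear_combination hA
  have hV2 : V' = V*v'/v := by field_simp; linear_combination hV
  have hW2 : W' = W*y'/y := by field_simp; linear_combination hW
  have hB2 : B' = B*Bx/u := by field_simp; linear_combination hB
  rw [hA2, hV2, hW2, hB2]
  trans (c*C')*(E'*T'/U'*(s*(A*ζ/b)*w1*(B*Bx/u)/((V*v'/v)*(W*y'/y))))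
  · ring
  rw [hC]
  trans (C*Cx)*(E'*T'/U'*(s*(A*ζ/b)*w1*(B*Bx/u)/((V*v'/v)*(W*y'/y))))*(e1*e1⁻¹)*(t1*t1⁻¹)*(w0*w0⁻¹)
  · rw [mul_inv_cancel₀ he, mul_inv_cancel₀ ht, mul_inv_cancel₀ hw0]; ring
  · simp only [div_eq_mul_inv, mul_inv, inv_inv]; ring
lemma b1 (q ε α β γ δ : ℂ) (M a : ℕ) (G : Gen q ε α β γ δ (M+1)) (ha : a ≤ M) :
  (1-q*β)*tt q (ε*q) α (β*q) γ δ M a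
   = (γ*δ*q^(2*(M+1)))⁻¹*((1-α*β*q^(2*a+2))/(1-α*β*q^(2*a+1))*(1-(q^(M+1))⁻¹*q^a)*(1-α*β*q*q^a)*(1-q*β*q^a)/((1-(q^(M+1))⁻¹)*(1-(δ*q^(M+1))⁻¹*q^a)*(1-(γ*q^(M+1))⁻¹*q^a)))
     * tt q ε α β γ δ (M+1) a := by
  have hq := G.hq
  have h3 := G.h3
  have h4 := G.h4
  have G' : Gen q (ε*q) α (β*q) γ δ M := by simpa using G.shift 1 0 1 0 0 rfl
  rw [tt_eq _ _ _ _ _ _ _ _ G', tt_eq _ _ _ _ _ _ _ _ G]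
  have e6 := poch_shift q (q^(M+1))⁻¹ a
  have e7 := poch_shift q (α*β*q) a
  have e8 := poch_shift q (q*β) a
  have e9 := poch_shift q (δ*q^(M+1))⁻¹ a
  have e10 := poch_shift q (γ*q^(M+1))⁻¹ a
  have z1 : 1 - (q^(M+1))⁻¹ ≠ 0 := by
    have := qinv_ne hq G.q1 0 0 ø; simpa using this
  have z2 : 1 - α*β*q ≠ 0 := by have := G.g12 1 ø ø; rwa [pow_one] at this
  have z3 : 1 - q*γ*q^M ≠ 0 := by have := G.g3 (M+1) ø ø; convert this using 2; ring
  have z4 : 1 - q*δ*q^M ≠ 0 := by have := G.g4 (M+1) ø ø; convert this using 2; ring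
  have z5 := inv_ne hq δ h4 (M+1) a ø (G.g4 _ ø ø)
  have z6 := inv_ne hq γ h3 (M+1) a ø (G.g3 _ ø ø)
  have z7 : 1 - (δ*q^(M+1))⁻¹ ≠ 0 := by
    have := inv_ne hq δ h4 (M+1) 0 ø (G.g4 _ ø ø); simpa using this
  have z8 : 1 - (γ*q^(M+1))⁻¹ ≠ 0 := by
    have := inv_ne hq γ h3 (M+1) 0 ø (G.g3 _ ø ø); simpa using this
  have z9 := G.g12 (2*a+1) ø ø
  have hX : q^a ≠ 0 := pow_ne_zero _ hq
  have hc : (γ*δ*q^(2*(M+1)))⁻¹ = (1 - (δ*q^(M+1))⁻¹)*(1 - (γ*q^(M+1))⁻¹)/((1 - q*γ*q^M)*(1 - q*δ*q^M)) := by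
    have y3 : 1 - γ*q^(M+1) ≠ 0 := G.g3 (M+1) ø ø
    have y4 : 1 - δ*q^(M+1) ≠ 0 := G.g4 (M+1) ø ø
    rw [show q*γ*q^M = γ*q^(M+1) by ring, show q*δ*q^M = δ*q^(M+1) by ring, show q^(2*(M+1)) = q^(M+1)*q^(M+1) by ring]
    have hN : q^(M+1) ≠ 0 := pow_ne_zero _ hq
    generalize q^(M+1) = Y at *
    have y3' : γ*Y ≠ 0 := mul_ne_zero h3 hN
    have y4' : δ*Y ≠ 0 := mul_ne_zero h4 hN
    have : γ*δ*(Y*Y) = (γ*Y)*(δ*Y) := by ring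
    rw [this]
    generalize γ*Y = u at *
    generalize δ*Y = v at *
    rw [eq_div_iff (mul_ne_zero y3 y4)]
    field_simp
    ring
  have := b1_aux 0 (1-α*β*q^(2*a+1)) (1-α*β*q^(2*a+2)) _ _ (Ψ q (q*γ) M) (Ψ q (q*δ) M) (Ψ q (α*β*q*q) (M+1)) _ _ _ _ _ _ _ _ _ _ _ _ _ _ _ _ _ _ _ _
    ((-(ε*α*q^(M+1+2)))^a * q^(a*(a-1)/2) * Ψ q (α*β*δ*q^(M+1+2)) a * Ψ q (α*β*γ*q^(M+1+2)) a /
    (Ψ q q a * Ψ q (q*α) a * Ψ q (α*β*q^(M+1+2)) a)) e6 e7 e8 e9 e10 z1 z2 z3 z4 z5 z6 z7 z8 z9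
  rw [hc, show ε*q*α*q^(M+2) = ε*α*q^(M+1+2) by ring, show q*(β*q) = q*β*q by ring, show α*(β*q)*δ*q^(M+2) = α*β*δ*q^(M+1+2) by ring,
   show α*(β*q)*γ*q^(M+2) = α*β*γ*q^(M+1+2) by ring, show (δ*q^M)⁻¹ = (δ*q^(M+1))⁻¹*q by field_simp; try ring,
   show (γ*q^M)⁻¹ = (γ*q^(M+1))⁻¹*q by field_simp; try ring,
   show (q^M)⁻¹ = (q^(M+1))⁻¹*q by field_simp; try ring, poch_succ q (q*γ), poch_succ q (q*δ), poch_succ' q (α*β*q) (M+1),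
   show α*(β*q)*q^(M+2) = α*β*q^(M+1+2) by ring, show α*(β*q)*q = α*β*q*q by ring, show α*(β*q)*q^(2*a+1) = α*β*q^(2*a+2) by ring]
  refine Eq.trans ?_ (this.trans ?_)
  · ring
  · ring
lemma b3 (q ε α β γ δ : ℂ) (M a : ℕ) (G : Gen q ε α β γ δ (M+1)) (ha : a ≤ M) :
  (1-q*q^a)*(1-q*α*q^a)*(1-α*β*q^(M+1+2)*q^a)/(1-α*β*q^(2*a+3))*tt q ε α β γ δ (M+1) (a+1)
   = -(ε*α*q^(M+1+2))*q^a*(1-(q^(M+1))⁻¹*q^a)/(1-α*β*q^(2*a+1))*(1-α*β*q*q^a)*(1-q*β*q^a)*(1-α*β*δ*q^(M+1+2)*q^a)*(1-α*β*γ*q^(M+1+2)*q^a)/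
     ((1-(δ*q^(M+1))⁻¹*q^a)*(1-(γ*q^(M+1))⁻¹*q^a)) * tt q ε α β γ δ (M+1) a := by
  have hq := G.hq
  have h3 := G.h3
  have h4 := G.h4
  rw [tt_eq _ _ _ _ _ _ _ _ G, tt_eq _ _ _ _ _ _ _ _ G]
  have z9 := G.g12 (2*a+1) ø ø
  have z10 := G.g12 (2*a+3) ø ø
  have n10 : 1 - q*q^a ≠ 0 := by have := G.q1 (a+1) ø ø; rwa [pow_succ, mul_comm] at this
  have n11 : 1 - q*α*q^a ≠ 0 := by have := G.g1 (a+1) ø ø; convert this using 2; ring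
  have n12 : 1 - α*β*q^(M+1+2)*q^a ≠ 0 := by have := G.g12 (M+1+2+a) ø ø; convert this using 2; ring
  simp only [poch_succ q _ a]
  rw [tri_succ, pow_add q _ a, pow_succ _ a, show 2*(a+1)+1 = 2*a+3 by ring]
  generalize 1-q*q^a = g1 at *
  generalize 1-q*α*q^a = g2 at *
  generalize 1 - α*β*q^(M+1+2)*q^a = g3 at *
  generalize 1 - α*β*q^(2*a+1) = g4 at *
  generalize 1 - α*β*q^(2*a+3) = g5 at *
  generalize 1-(q^(M+1))⁻¹*q^a = g6
  generalize 1-α*β*q*q^a = g7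
  generalize 1-q*β*q^a = g8
  generalize 1-α*β*δ*q^(M+1+2)*q^a = g9
  generalize 1-α*β*γ*q^(M+1+2)*q^a = g10
  generalize 1-(δ*q^(M+1))⁻¹*q^a = g11
  generalize 1-(γ*q^(M+1))⁻¹*q^a = g12
  generalize (-(ε*α*q^(M+1+2))) = g13
  generalize q^(a*(a-1)/2) = g14
  generalize Ψ q (q^(M+1))⁻¹ a = p1
  generalize Ψ q (α*β*q) a = p2
  generalize Ψ q (q*β) a = p3
  generalize Ψ q (α*β*δ*q^(M+1+2)) a = p4
  generalize Ψ q (α*β*γ*q^(M+1+2)) a = p5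
  generalize Ψ q q a = p6
  generalize Ψ q (q*α) a = p7
  generalize Ψ q (α*β*q^(M+1+2)) a = p8
  generalize Ψ q (δ*q^(M+1))⁻¹ a = p9
  generalize Ψ q (γ*q^(M+1))⁻¹ a = p10
  generalize Ψ q (α*β*q) (M+1+1) = p11
  generalize Ψ q (q*γ) (M+1) = p12
  generalize Ψ q (q*δ) (M+1) = p13
  trans (p12*p13/p11*(g13^a*g13*(g14*q^a)*(p1*g6)*(p2*g7)*(p3*g8)*(p4*g9)*(p5*g10)/(p6*p7*p8*(p9*g11)*(p10*g12))))
  · trans (p12*p13/p11*(g13^a*g13*(g14*q^a)*(p1*g6)*(p2*g7)*(p3*g8)*(p4*g9)*(p5*g10)/(p6*p7*p8*(p9*g11)*(p10*g12))))*(g1*g1⁻¹)*(g2*g2⁻¹)*(g3*g3⁻¹)*(g5*g5⁻¹)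
    · simp only [div_eq_mul_inv, mul_inv, inv_inv]; ring
    · rw [mul_inv_cancel₀ n10, mul_inv_cancel₀ n11, mul_inv_cancel₀ n12, mul_inv_cancel₀ z10]; ring
  · trans (p12*p13/p11*(g13^a*g13*(g14*q^a)*(p1*g6)*(p2*g7)*(p3*g8)*(p4*g9)*(p5*g10)/(p6*p7*p8*(p9*g11)*(p10*g12))))*(g4*g4⁻¹)
    · rw [mul_inv_cancel₀ z9]; ring
    · simp only [div_eq_mul_inv, mul_inv, inv_inv]; ring
def TT (q ε α β γ δ : ℂ) (N a : ℕ) : ℂ := (q^a)⁻¹*(1-q^a)*(1-α*q^a)*(1-α*β*q^(N+1)*q^a)/((1-(q^N)⁻¹)*(1-α*β*q^(2*a+1)))*tt q ε α β γ δ N a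
lemma b_alg (q ε α β γ δ X Y : ℂ) (hq : q ≠ 0) (hX : X ≠ 0) (hY : Y ≠ 0) (h3 : γ ≠ 0) (h4 : δ ≠ 0) (hb : ε*α*β*γ*δ*Y^2*q^3 = 1)
   (z4 : 1 - (δ*Y)⁻¹*X ≠ 0) (z3 : 1 - (γ*Y)⁻¹*X ≠ 0) (z0 : 1 - Y⁻¹ ≠ 0) (w0 : 1 - α*β*q*X^2 ≠ 0) :
   (1-α*Y) + Y*α*(1-q*ε)*((1-α*β*q^2*X^2)/(1-α*β*q*X^2)*(1-Y⁻¹*X)*(1-α*β*q*X)*(1-q*β*X)/((1-Y⁻¹)*(1-(δ*Y)⁻¹*X)*(1-(γ*Y)⁻¹*X)))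
    - X⁻¹*(1-Y⁻¹*X)/(1-Y⁻¹)*(1-α*β*(q*Y)*X)
   = (q*X)⁻¹/(1-Y⁻¹)*(-(ε*α*(Y*q^2))*X*(1-Y⁻¹*X)/(1-α*β*q*X^2)*(1-α*β*q*X)*(1-q*β*X)*(1-α*β*δ*(Y*q^2)*X)*(1-α*β*γ*(Y*q^2)*X)/
     ((1-(δ*Y)⁻¹*X)*(1-(γ*Y)⁻¹*X))) - X⁻¹*(1-X)*(1-α*X)*(1-α*β*(q*Y)*X)/((1-Y⁻¹)*(1-α*β*q*X^2)) := by
  have e4 : 1 - (δ*Y)⁻¹*X = (δ*Y-X)/(δ*Y) := by field_simp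
  have e3 : 1 - (γ*Y)⁻¹*X = (γ*Y-X)/(γ*Y) := by field_simp
  have e0 : 1 - Y⁻¹ = (Y-1)/Y := by field_simp
  rw [e4] at z4
  rw [e3] at z3
  rw [e0] at z0
  have z4' : δ*Y-X ≠ 0 := fun h => z4 (by rw [h]; simp)
  have z3' : γ*Y-X ≠ 0 := fun h => z3 (by rw [h]; simp)
  have z0' : Y-1 ≠ 0 := fun h => z0 (by rw [h]; simp)
  rw [e4, e3, e0]
  clear z4 z3 z0 e4 e3 e0
  have z4 : Y*δ-X ≠ 0 := by rwa [mul_comm]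
  have z3 : Y*γ-X ≠ 0 := by rwa [mul_comm]
  have w0' : 1 - α*q*β*X^2 ≠ 0 := by convert w0 using 2; ring
  field_simp
  linear_combination (-(X*((1-α*Y)*(1-α*q*β*X^2)*(Y-1)*(Y*δ-X)*(Y*γ-X) + α*Y^3*(1-α*q^2*β*X^2)*(Y-X)*(1-α*q*β*X)*(1-q*β*X)*δ*γ) - (1-α*q*β*X^2)*(Y-X)*(Y*δ-X)*(Y*γ-X)*(1-α*Y*q*β*X) + Y*(Y*δ-X)*(Y*γ-X)*(1-α*Y*q*β*X)*(1-X)*(1-α*X)))*hb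
lemma base_step (q ε α β γ δ : ℂ) (M a : ℕ) (G : Gen q ε α β γ δ (M+1)) (ha : a ≤ M) :
   (1-α*q^(M+1))*tt q ε α β γ δ (M+1) a + q^(3*(M+1))*α*γ*δ*(1-q*ε)*((1-q*β)*tt q (ε*q) α (β*q) γ δ M a)
    - (1-q*γ)*(1-q*δ)*tt q ε α β (γ*q) (δ*q) M a = TT q ε α β γ δ (M+1) (a+1) - TT q ε α β γ δ (M+1) a := by
  have hq := G.hq
  have hX : q^a ≠ 0 := pow_ne_zero _ hq
  have hY : q^(M+1) ≠ 0 := pow_ne_zero _ hq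
  have z1 : 1 - (q^(M+1))⁻¹ ≠ 0 := by
    have := qinv_ne hq G.q1 0 0 ø; simpa using this
  have z5 := inv_ne hq δ G.h4 (M+1) a ø (G.g4 _ ø ø)
  have z6 := inv_ne hq γ G.h3 (M+1) a ø (G.g3 _ ø ø)
  have z9 := G.g12 (2*a+1) ø ø
  rw [b1 _ _ _ _ _ _ _ _ G ha, b2 _ _ _ _ _ _ _ _ G ha]
  have e : TT q ε α β γ δ (M+1) (a+1) = (q*q^a)⁻¹/(1-(q^(M+1))⁻¹)*
    ((1-q*q^a)*(1-q*α*q^a)*(1-α*β*q^(M+1+2)*q^a)/(1-α*β*q^(2*a+3))*tt q ε α β γ δ (M+1) (a+1)) := by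
    unfold TT
    rw [show 2*(a+1)+1 = 2*a+3 by ring, pow_succ q a, show α*β*q^(M+1+1)*(q^a*q) = α*β*q^(M+1+2)*q^a by ring, show α*(q^a*q) = q*α*q^a by ring, mul_comm (q^a) q]
    rw [div_eq_mul_inv, div_eq_mul_inv, div_eq_mul_inv, mul_inv (1 - (q^(M+1))⁻¹)]; ring
  rw [e, b3 _ _ _ _ _ _ _ _ G ha]
  unfold TT
  have w : α*β*q^(2*a+1) = α*β*q*(q^a)^2 := by ring
  have hb : ε*α*β*γ*δ*(q^(M+1))^2*q^3 = 1 := by rw [← G.bal]; ring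
  rw [w] at z9 ⊢
  have := b_alg q ε α β γ δ (q^a) (q^(M+1)) hq hX hY G.h3 G.h4 hb z5 z6 z1 z9
  have hc : q^(3*(M+1))*α*γ*δ*(γ*δ*q^(2*(M+1)))⁻¹ = q^(M+1)*α := by
    have := G.h3
    have := G.h4
    rw [show q^(3*(M+1)) = q^(M+1)*q^(2*(M+1)) by ring]; field_simp
  rw [show q^(M+1+2) = q^(M+1)*q^2 by ring, show q^(M+1+1) = q*q^(M+1) by ring, show α*β*q^(2*a+2) = α*β*q^2*(q^a)^2 by ring]
  generalize tt q ε α β γ δ (M+1) a = T at *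
  generalize (γ*δ*q^(2*(M+1)))⁻¹ = ic at *
  generalize q^(3*(M+1)) = Y3 at *
  generalize hE : ((1-α*β*q^2*(q^a)^2)/(1-α*β*q*(q^a)^2)*(1-(q^(M+1))⁻¹*q^a)*(1-α*β*q*q^a)*(1-q*β*q^a)/((1-(q^(M+1))⁻¹)*(1-(δ*q^(M+1))⁻¹*q^a)*(1-(γ*q^(M+1))⁻¹*q^a))) = E at *
  clear hE
  generalize (q*q^a)⁻¹/(1-(q^(M+1))⁻¹) = F1 at *
  generalize hE : (q^a)⁻¹*(1-q^a)*(1-α*q^a)*(1-α*β*(q*q^(M+1))*q^a)/((1-(q^(M+1))⁻¹)*(1-α*β*q*(q^a)^2)) = F2 at *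
  clear hE
  generalize hE : (q^a)⁻¹*(1-(q^(M+1))⁻¹*q^a)/(1-(q^(M+1))⁻¹)*(1-α*β*(q*q^(M+1))*q^a) = F3 at *
  clear hE
  generalize hE : -(ε*α*(q^(M+1)*q^2))*q^a*(1-(q^(M+1))⁻¹*q^a)/(1-α*β*q*(q^a)^2)*(1-α*β*q*q^a)*(1-q*β*q^a)*(1-α*β*δ*(q^(M+1)*q^2)*q^a)*(1-α*β*γ*(q^(M+1)*q^2)*q^a)/
     ((1-(δ*q^(M+1))⁻¹*q^a)*(1-(γ*q^(M+1))⁻¹*q^a)) = F4 at *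
  clear hE
  generalize q^(M+1) = Y at *
  linear_combination T*this + (1-q*ε)*E*T*hc
lemma base_part (q ε α β γ δ : ℂ) (M a : ℕ) (G : Gen q ε α β γ δ (M+1)) (ha : a ≤ M+1) :
   ∑ k ∈ range a, ((1-α*q^(M+1))*tt q ε α β γ δ (M+1) k + q^(3*(M+1))*α*γ*δ*(1-q*ε)*((1-q*β)*tt q (ε*q) α (β*q) γ δ M k)
    - (1-q*γ)*(1-q*δ)*tt q ε α β (γ*q) (δ*q) M k) = TT q ε α β γ δ (M+1) a := by
  induction a with
  | zero => simp [TT]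
  | succ a ih => rw [sum_range_succ, ih ø, base_step _ _ _ _ _ _ _ _ G ø]; ring
lemma Bstep (q ε α β γ δ : ℂ) (M : ℕ) (G : Gen q ε α β γ δ (M+1)) :
   (1-α*q^(M+1))*FF q ε α β γ δ (M+1) 0 0 0 0 = -(q^(3*(M+1))*α*γ*δ*(1-q*ε)*(1-q*β))*FF q (ε*q) α (β*q) γ δ M 0 0 0 0
    + (1-q*γ)*(1-q*δ)*FF q ε α β (γ*q) (δ*q) M 0 0 0 0 := by
  have hq := G.hq
  rw [FF_tt _ _ _ _ _ _ _ hq, FF_tt _ _ _ _ _ _ _ hq, FF_tt _ _ _ _ _ _ _ hq, sum_range_succ _ (M+1)]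
  have h := base_part q ε α β γ δ M (M+1) G le_rfl
  rw [sum_sub_distrib, sum_add_distrib, ← mul_sum, ← mul_sum, ← mul_sum, ← mul_sum] at h
  have hT : TT q ε α β γ δ (M+1) (M+1) = -((1-α*q^(M+1))*tt q ε α β γ δ (M+1) (M+1)) := by
    unfold TT
    have z1 : 1 - (q^(M+1))⁻¹ ≠ 0 := by
      have := qinv_ne hq G.q1 0 0 ø; simpa using this
    have z9 := G.g12 (2*(M+1)+1) ø ø
    rw [show α*β*q^(M+1+1)*q^(M+1) = α*β*q^(2*(M+1)+1) by ring]
    have hY : q^(M+1) ≠ 0 := pow_ne_zero _ hq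
    have : (q^(M+1))⁻¹*(1-q^(M+1)) = -(1-(q^(M+1))⁻¹) := by field_simp; ring
    rw [this]
    generalize 1 - (q^(M+1))⁻¹ = u at *
    generalize 1 - α*β*q^(2*(M+1)+1) = v at *
    rw [← neg_mul]
    congr 1
    field_simp
  linear_combination h + hT
def kap (q ε α β γ δ : ℂ) (N y i j : ℕ) : ℂ :=
  ((α*q)^N)⁻¹ * (ε*β*γ*q)^i * (ε*γ*δ*q)^j * ((β*δ*q^(2*N))^y)⁻¹ * q^(y*(y-1)) * q^(i*j+i^2+j^2)
def Cl (N : ℕ) : Prop := ∀ q ε α β γ δ : ℂ, Gen q ε α β γ δ N → ∀ L y i j x : ℕ, L + y = N → x ≤ L →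
   FF q ε α β γ δ L y i j x = kap q ε α β γ δ N y i j * FF q⁻¹ γ⁻¹ α⁻¹ δ⁻¹ ε⁻¹ β⁻¹ L y j i x
lemma kap_I (q ε α β γ δ : ℂ) (M n j : ℕ) (h1 : α ≠ 0) (hq : q ≠ 0) :
   kap q ε α β γ δ (M+1) 0 (n+1) j = (ε*β*γ*q/α) * kap q ε α (β*q) (γ*q) δ M 0 n j := by
  unfold kap
  rw [show ε*(β*q)*(γ*q)*q = ε*β*γ*q*q^2 by ring, show ε*(γ*q)*δ*q = ε*γ*δ*q*q by ring, mul_pow _ (q^2), mul_pow _ q j, ← pow_mul]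
  have e : q^((n+1)*j+(n+1)^2+j^2) = q^(2*n)*q^j*q^(n*j+n^2+j^2)*q := by ring
  rw [e, pow_succ (α*q), pow_succ _ n, mul_inv _ (α*q)]
  field_simp
  try ring
lemma kap_X (q ε α β γ δ : ℂ) (M : ℕ) (c0' c2' c3' c4' : ℂ) :
   kap q ε α β γ δ (M+1) 0 0 0 = (α*q)⁻¹ * kap q c0' α c2' c3' c4' M 0 0 0 := by
  unfold kap
  rw [pow_succ (α*q), mul_inv _ (α*q)]
  simp only [pow_zero]
  ring
lemma kap_hat (q ε α β γ δ : ℂ) (N y i j : ℕ) (G : Gen q ε α β γ δ N) :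
   kap q ε α β γ δ N y i j * kap q⁻¹ γ⁻¹ α⁻¹ δ⁻¹ ε⁻¹ β⁻¹ N y j i = 1 := by
  have hq := G.hq
  have h0 := G.h0
  have h1 := G.h1
  have h2 := G.h2
  have h3 := G.h3
  have h4 := G.h4
  have e : kap q⁻¹ γ⁻¹ α⁻¹ δ⁻¹ ε⁻¹ β⁻¹ N y j i = (kap q ε α β γ δ N y i j)⁻¹ := by
    unfold kap
    rw [show j*i+j^2+i^2 = i*j+i^2+j^2 by ring]
    simp only [mul_inv, inv_pow, mul_pow, inv_inv]
    ring
  rw [e]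
  apply mul_inv_cancel₀
  unfold kap
  simp [hq, h0, h1, h2, h3, h4]
lemma I_s0 (q ε α β γ δ X Y : ℂ) (hq : q ≠ 0) (h0 : ε ≠ 0) (h1 : α ≠ 0) (h2 : β ≠ 0) (h3 : γ ≠ 0) (h4 : δ ≠ 0)
   (hX : X ≠ 0) (hY : Y ≠ 0) (y1 : 1 - Y ≠ 0) (n1 : 1-β*(X*q) ≠ 0) (n2 : 1 - q*β ≠ 0) (n3 : 1 - β*δ*q*X^2 ≠ 0) :
   (1-q*β)*(1-q*γ)*(1-Y⁻¹)*(-(δ*Y))*(s6 X⁻¹ (β*δ*(X*q)) (q*β) Y⁻¹ * (1-q*β)/(1-β*(X*q))) =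
    (ε*β*γ*q/α)*((1-q⁻¹*γ⁻¹)*(1-q⁻¹*β⁻¹)*ε⁻¹*(1-Y)/(α⁻¹*δ⁻¹*q⁻¹) *
     ((1-δ⁻¹*β⁻¹*(X⁻¹*q⁻¹))*(Y - X)/((1-Y)*(δ⁻¹*β⁻¹*(X⁻¹*q⁻¹)-X)))) := by
  unfold s6
  have e1 : 1 - Y⁻¹ = -(1-Y)/Y := by field_simp; ring
  have e2 : β*δ*(X*q) - X⁻¹ = -(1 - β*δ*q*X^2)/X := by field_simp; ring
  have e3 : δ⁻¹*β⁻¹*(X⁻¹*q⁻¹)-X = (1 - β*δ*q*X^2)/(β*δ*q*X) := by field_simp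
  have e4 : Y⁻¹ - X⁻¹ = (X-Y)/(X*Y) := by field_simp
  have e5 : X⁻¹ - q*β = (1-β*(X*q))/X := by field_simp
  have e6 : 1-q⁻¹*γ⁻¹ = -(1-q*γ)/(q*γ) := by field_simp; ring
  have e7 : 1-q⁻¹*β⁻¹ = -(1-q*β)/(q*β) := by field_simp; ring
  have e8 : 1-δ⁻¹*β⁻¹*(X⁻¹*q⁻¹) = -(1-β*δ*(X*q))/(β*δ*(X*q)) := by field_simp; ring
  rw [e1, e2, e3, e4, e5, e6, e7, e8]
  generalize 1-q*γ = a1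
  generalize 1-β*δ*(X*q) = a2
  generalize 1 - β*δ*q*X^2 = a3 at *
  generalize 1 - β*(X*q) = a4 at *
  generalize 1-q*β = a5 at *
  generalize 1-Y = a6 at *
  field_simp
  try ring
lemma I_s1 (q ε α β γ δ X Y : ℂ) (hq : q ≠ 0) (h0 : ε ≠ 0) (h1 : α ≠ 0) (h2 : β ≠ 0) (h3 : γ ≠ 0) (h4 : δ ≠ 0)
   (hX : X ≠ 0) (hY : Y ≠ 0) (y1 : 1 - Y ≠ 0) (n2 : 1 - q*β ≠ 0) (n3 : 1 - β*δ*q*X^2 ≠ 0) :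
   (1-q*β)*(1-q*γ)*(1-Y⁻¹)*(-(δ*Y))*(s6 (β*δ*(X*q)) X⁻¹ (q*β) Y⁻¹ * (1-q*β)) =
    (ε*β*γ*q/α)*((1-q⁻¹*γ⁻¹)*(1-q⁻¹*β⁻¹)*ε⁻¹*(1-Y)/(α⁻¹*δ⁻¹*q⁻¹) *
     ((1-δ⁻¹*X⁻¹)*(1-X)*(δ⁻¹*β⁻¹*(X⁻¹*q⁻¹)-Y)/((1-Y)*(δ⁻¹*β⁻¹*(X⁻¹*q⁻¹)-X)))) := by
  unfold s6
  have e1 : 1 - Y⁻¹ = -(1-Y)/Y := by field_simp; ring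
  have e2 : X⁻¹ - β*δ*(X*q) = (1 - β*δ*q*X^2)/X := by field_simp
  have e3 : δ⁻¹*β⁻¹*(X⁻¹*q⁻¹)-X = (1 - β*δ*q*X^2)/(β*δ*q*X) := by field_simp
  have e4 : Y⁻¹ - β*δ*(X*q) = (1-β*δ*X*q*Y)/Y := by field_simp
  have e5 : β*δ*(X*q) - q*β = -(β*q)*(1-δ*X) := by ring
  have e6 : 1-q⁻¹*γ⁻¹ = -(1-q*γ)/(q*γ) := by field_simp; ring
  have e7 : 1-q⁻¹*β⁻¹ = -(1-q*β)/(q*β) := by field_simp; ring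
  have e8 : δ⁻¹*β⁻¹*(X⁻¹*q⁻¹)-Y = (1-β*δ*X*q*Y)/(β*δ*X*q) := by field_simp
  have e9 : 1-δ⁻¹*X⁻¹ = -(1-δ*X)/(δ*X) := by field_simp; ring
  have e10 : 1-X⁻¹ = -(1-X)/X := by field_simp; ring
  rw [e1, e2, e3, e4, e5, e6, e7, e8, e9, e10]
  generalize 1-q*γ = a1
  generalize 1-β*δ*X*q*Y = a2
  generalize 1 - β*δ*q*X^2 = a3 at *
  generalize 1 - δ*X = a4 at *
  generalize 1-q*β = a5 at *
  generalize 1-Y = a6 at *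
  generalize 1-X = a7 at *
  field_simp
  try ring
lemma caseI (M : ℕ) (IH : Cl M) (q ε α β γ δ : ℂ) (G : Gen q ε α β γ δ (M+1)) (n j x : ℕ) (hx : x ≤ M+1) (hj : n + j ≤ M) :
   FF q ε α β γ δ (M+1) 0 (n+1) j x = kap q ε α β γ δ (M+1) 0 (n+1) j * FF q⁻¹ γ⁻¹ α⁻¹ δ⁻¹ ε⁻¹ β⁻¹ (M+1) 0 j (n+1) x := by
  have hq := G.hq
  have h0 := G.h0
  have h1 := G.h1
  have h2 := G.h2
  have h3 := G.h3
  have h4 := G.h4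
  have G' : Gen q ε α (β*q) (γ*q) δ M := by simpa using G.shift 0 0 1 1 0 rfl
  rw [Istep _ _ _ _ _ _ _ _ _ _ G hj hx, Jstep _ _ _ _ _ _ _ _ _ _ G.hat hx, kap_I _ _ _ _ _ _ _ _ _ h1 hq]
  have E : ∀ x', x' ≤ M → FF q ε α (β*q) (γ*q) δ M 0 n j x' = kap q ε α (β*q) (γ*q) δ M 0 n j * FF q⁻¹ (γ⁻¹*q⁻¹) α⁻¹ δ⁻¹ ε⁻¹ (β⁻¹*q⁻¹) M 0 j n x' := by
    intro x' hx'
    have := IH _ _ _ _ _ _ G' M 0 n j x' rfl hx'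
    rwa [mul_inv β, mul_inv γ] at this
  have E1 := E (x-1) ø
  have hX : q^x ≠ 0 := pow_ne_zero _ hq
  have hY : q^(M+1) ≠ 0 := pow_ne_zero _ hq
  have y1 : 1 - q^(M+1) ≠ 0 := G.q1 _ ø ø
  have n1 : 1-β*(q^x*q) ≠ 0 := by rw [← pow_succ]; exact G.g2 _ ø ø
  have n2 : 1 - q*β ≠ 0 := by have := G.g2 1 ø ø; rwa [pow_one, mul_comm] at this
  have n3 : 1 - β*δ*q*(q^x)^2 ≠ 0 := by have := G.g24 (2*x+1) ø ø; convert this using 2; ring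
  have s0 := I_s0 q ε α β γ δ (q^x) (q^(M+1)) hq h0 h1 h2 h3 h4 hX hY y1 n1 n2 n3
  have s1 := I_s1 q ε α β γ δ (q^x) (q^(M+1)) hq h0 h1 h2 h3 h4 hX hY y1 n2 n3
  unfold IK JK
  simp only [inv_pow, inv_inv]
  rw [pow_succ q x, mul_inv (q^x) q]
  have E0 : x ≤ M ∨ x = M+1 := by omega
  generalize (ε*β*γ*q/α) = ρ at *
  generalize (1-q*β)*(1-q*γ)*(1-(q^(M+1))⁻¹)*(-(δ*q^(M+1))) = K1 at *
  generalize (1-q⁻¹*γ⁻¹)*(1-q⁻¹*β⁻¹)*ε⁻¹*(1-q^(M+1))/(α⁻¹*δ⁻¹*q⁻¹) = K2 at *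
  generalize hA : s6 (q^x)⁻¹ (β*δ*(q^x*q)) (q*β) (q^(M+1))⁻¹ * (1-q*β)/(1-β*(q^x*q)) = A at *
  generalize s6 (β*δ*(q^x*q)) (q^x)⁻¹ (q*β) (q^(M+1))⁻¹ * (1-q*β) = B at *
  generalize hA' : (1 - δ⁻¹ * β⁻¹ * ((q ^ x)⁻¹ * q⁻¹)) * (q ^ (M + 1) - q ^ x) / ((1 - q ^ (M + 1)) * (δ⁻¹ * β⁻¹ * ((q ^ x)⁻¹ * q⁻¹) - q ^ x)) = A' at *
  generalize (1 - δ⁻¹ * (q ^ x)⁻¹) * (1 - q ^ x) * (δ⁻¹ * β⁻¹ * ((q ^ x)⁻¹ * q⁻¹) - q ^ (M + 1)) /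
          ((1 - q ^ (M + 1)) * (δ⁻¹ * β⁻¹ * ((q ^ x)⁻¹ * q⁻¹) - q ^ x)) = B' at *
  rw [E1]
  rcases E0 with E0 | E0
  · rw [E x E0]
    generalize FF q⁻¹ (γ⁻¹*q⁻¹) α⁻¹ δ⁻¹ ε⁻¹ (β⁻¹*q⁻¹) M 0 j n x = f1
    generalize FF q⁻¹ (γ⁻¹*q⁻¹) α⁻¹ δ⁻¹ ε⁻¹ (β⁻¹*q⁻¹) M 0 j n (x-1) = f2
    generalize kap q ε α (β*q) (γ*q) δ M 0 n j = k
    linear_combination k*f1*s0 + k*f2*s1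
  · have A0 : A = 0 := by rw [← hA, E0]; unfold s6; simp
    have A0' : A' = 0 := by rw [← hA', E0]; simp
    rw [A0, A0']
    generalize FF q⁻¹ (γ⁻¹*q⁻¹) α⁻¹ δ⁻¹ ε⁻¹ (β⁻¹*q⁻¹) M 0 j n (x-1) = f2
    generalize kap q ε α (β*q) (γ*q) δ M 0 n j = k
    linear_combination k*f2*s1
lemma cl_hat (q ε α β γ δ : ℂ) (L y i j x N : ℕ) (G : Gen q ε α β γ δ N)
   (h : FF q⁻¹ γ⁻¹ α⁻¹ δ⁻¹ ε⁻¹ β⁻¹ L y j i x = kap q⁻¹ γ⁻¹ α⁻¹ δ⁻¹ ε⁻¹ β⁻¹ N y j i * FF q⁻¹⁻¹ ε⁻¹⁻¹ α⁻¹⁻¹ β⁻¹⁻¹ γ⁻¹⁻¹ δ⁻¹⁻¹ L y i j x) :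
   FF q ε α β γ δ L y i j x = kap q ε α β γ δ N y i j * FF q⁻¹ γ⁻¹ α⁻¹ δ⁻¹ ε⁻¹ β⁻¹ L y j i x := by
  simp only [inv_inv] at h
  rw [h, ← mul_assoc, kap_hat _ _ _ _ _ _ _ _ _ _ G, one_mul]
lemma caseX (M : ℕ) (IH : Cl M) (q ε α β γ δ : ℂ) (G : Gen q ε α β γ δ (M+1)) (m : ℕ) (hx : m ≤ M) :
   FF q ε α β γ δ (M+1) 0 0 0 (m+1) = kap q ε α β γ δ (M+1) 0 0 0 * FF q⁻¹ γ⁻¹ α⁻¹ δ⁻¹ ε⁻¹ β⁻¹ (M+1) 0 0 0 (m+1) := by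
  have hq := G.hq
  have h0 := G.h0
  have h1 := G.h1
  have h2 := G.h2
  have h3 := G.h3
  have h4 := G.h4
  have G' : Gen q ε α (β*q) γ (δ*q) M := by simpa using G.shift 0 0 1 0 1 rfl
  rw [Xstep _ _ _ _ _ _ _ _ G hx, Xstep _ _ _ _ _ _ _ _ G.hat hx, kap_X _ _ _ _ _ _ _ ε (β*q) γ (δ*q),
   IH _ _ _ _ _ _ G' M 0 0 0 m rfl hx, mul_inv β, mul_inv δ]
  have hb := G.bal
  generalize kap q ε α (β*q) γ (δ*q) M 0 0 0 = k
  generalize FF q⁻¹ γ⁻¹ α⁻¹ (δ⁻¹*q⁻¹) ε⁻¹ (β⁻¹*q⁻¹) M 0 0 0 m = f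
  have : -(γ*q^(M+1))*(1-q*β)*(1-q*δ) = (α*q)⁻¹*(-(ε⁻¹*q⁻¹^(M+1))*(1-q⁻¹*δ⁻¹)*(1-q⁻¹*β⁻¹)) := by
    rw [show 2*(M+1)+3 = (M+1)+(M+1)+3 by ring, pow_add, pow_add] at hb
    have hY : q^(M+1) ≠ 0 := pow_ne_zero _ hq
    rw [inv_pow]
    generalize q^(M+1) = Y at *
    field_simp
    linear_combination (-(1-q*β)*(1-q*δ))*hb
  linear_combination k*f*this
lemma caseB (M : ℕ) (IH : Cl M) (q ε α β γ δ : ℂ) (G : Gen q ε α β γ δ (M+1)) :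
   FF q ε α β γ δ (M+1) 0 0 0 0 = kap q ε α β γ δ (M+1) 0 0 0 * FF q⁻¹ γ⁻¹ α⁻¹ δ⁻¹ ε⁻¹ β⁻¹ (M+1) 0 0 0 0 := by
  have hq := G.hq
  have h0 := G.h0
  have h1 := G.h1
  have h2 := G.h2
  have h3 := G.h3
  have h4 := G.h4
  have Ga : Gen q (ε*q) α (β*q) γ δ M := by simpa using G.shift 1 0 1 0 0 rfl
  have Gb : Gen q ε α β (γ*q) (δ*q) M := by simpa using G.shift 0 0 0 1 1 rfl
  have a := Bstep _ _ _ _ _ _ _ G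
  have b := Bstep _ _ _ _ _ _ _ G.hat
  rw [IH _ _ _ _ _ _ Ga M 0 0 0 0 rfl ø, IH _ _ _ _ _ _ Gb M 0 0 0 0 rfl ø] at a
  simp only [mul_inv] at a
  have ka := kap_X q ε α β γ δ M (ε*q) (β*q) γ δ
  have kb := kap_X q ε α β γ δ M ε β (γ*q) (δ*q)
  have ka' : kap q (ε*q) α (β*q) γ δ M 0 0 0 = (α*q)*kap q ε α β γ δ (M+1) 0 0 0 := by rw [ka]; field_simp
  have kb' : kap q ε α β (γ*q) (δ*q) M 0 0 0 = (α*q)*kap q ε α β γ δ (M+1) 0 0 0 := by rw [kb]; field_simp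
  rw [ka', kb'] at a
  have hb := G.bal
  have nz : 1 - α*q^(M+1) ≠ 0 := G.g1 _ ø ø
  apply mul_left_cancel₀ nz
  rw [a]
  rw [pow_mul] at b ⊢
  clear a
  clear ka kb ka' kb'
  generalize kap q ε α β γ δ (M+1) 0 0 0 = k at *
  generalize FF q⁻¹ γ⁻¹ α⁻¹ (δ⁻¹*q⁻¹) (ε⁻¹*q⁻¹) β⁻¹ M 0 0 0 0 = f2 at *
  generalize hf1 : FF q⁻¹ (γ⁻¹*q⁻¹) α⁻¹ (δ⁻¹*q⁻¹) ε⁻¹ β⁻¹ M 0 0 0 0 = f1 at *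
  generalize FF q⁻¹ γ⁻¹ α⁻¹ δ⁻¹ (ε⁻¹*q⁻¹) (β⁻¹*q⁻¹) M 0 0 0 0 = f3 at *
  generalize FF q⁻¹ γ⁻¹ α⁻¹ δ⁻¹ ε⁻¹ β⁻¹ (M+1) 0 0 0 0 = f at *
  have hY : q^(M+1) ≠ 0 := pow_ne_zero _ hq
  rw [show (q⁻¹^3)^(M+1) = ((q^(M+1))^3)⁻¹ by rw [inv_pow, inv_pow, ← pow_mul, ← pow_mul, mul_comm], inv_pow] at b
  rw [show (q^3)^(M+1) = (q^(M+1))^3 by rw [← pow_mul, ← pow_mul, mul_comm]]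
  rw [show q^(2*(M+1)+3) = (q^(M+1))^2*q^3 by ring] at hb
  generalize q^(M+1) = Y at *
  have r : 1 - α*Y = -(α*Y)*(1-α⁻¹*Y⁻¹) := by field_simp; ring
  have s1 : (1-q*γ)*(1-q*δ)*(α*q) = (α*Y)*((Y^3)⁻¹*α⁻¹*ε⁻¹*β⁻¹*(1-q⁻¹*γ⁻¹)*(1-q⁻¹*δ⁻¹)) := by
    field_simp
    linear_combination (1-q*γ)*(1-q*δ)*hb
  have s3 : (Y^3*α*γ*δ*(1-q*ε)*(1-q*β))*(α*q) = (α*Y)*((1-q⁻¹*ε⁻¹)*(1-q⁻¹*β⁻¹)) := by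
    field_simp
    linear_combination (1-q*ε)*(1-q*β)*hb
  rw [r]
  generalize 1-α⁻¹*Y⁻¹ = w at *
  generalize (Y^3)⁻¹*α⁻¹*ε⁻¹*β⁻¹*(1-q⁻¹*γ⁻¹)*(1-q⁻¹*δ⁻¹) = w1 at *
  generalize (1-q⁻¹*ε⁻¹)*(1-q⁻¹*β⁻¹) = w3 at *
  linear_combination (-k*f3)*s3 + k*f1*s1 + (α*Y)*k*b
lemma kapY (q ε α β γ δ : ℂ) (N y i j : ℕ) (G : Gen q ε α β γ δ (N+1)) :
   kap q ε α β γ δ (N+1) (y+1) i j = ε*γ*q^2/((q^i)^2*(q^j)^2) * kap q (ε*q) α β (γ*q) δ N y i j := by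
  have hq := G.hq
  have h1 := G.h1
  have h2 := G.h2
  have h4 := G.h4
  have hb := G.bal
  unfold kap
  have e1 : q^((y+1)*(y+1-1)) = q^(y*(y-1))*q^(2*y) := by
    rw [← pow_add]; congr 1
    cases y with
    | zero => rfl
    | succ y => simp; ring
  have e2 : (β*δ*q^(2*(N+1)))^(y+1) = (β*δ*q^(2*N))^y*q^(2*y)*(β*δ*q^(2*N)*q^2) := by
    rw [pow_succ, show β*δ*q^(2*(N+1)) = β*δ*q^(2*N)*q^2 by ring, mul_pow _ (q^2), ← pow_mul]
  rw [e1, e2, pow_succ (α*q), show ε*q*β*(γ*q)*q = (ε*β*γ*q)*q^2 by ring, show ε*q*(γ*q)*δ*q = (ε*γ*δ*q)*q^2 by ring,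
    mul_pow _ (q^2) i, mul_pow _ (q^2) j, ← pow_mul, ← pow_mul, ← pow_mul, ← pow_mul, mul_comm i 2, mul_comm j 2]
  have e3 : ε*γ*q^2 = (α*q)⁻¹*(β*δ*q^(2*N)*q^2)⁻¹ := by
    rw [← mul_inv]; apply eq_inv_of_mul_eq_one_left; rw [← hb]; ring
  have n1 : q^(2*y) ≠ 0 := pow_ne_zero _ hq
  have n2 : q^(2*i) ≠ 0 := pow_ne_zero _ hq
  have n3 : q^(2*j) ≠ 0 := pow_ne_zero _ hq
  rw [e3]
  generalize (ε*β*γ*q)^i = u1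
  generalize (ε*γ*δ*q)^j = u2
  generalize (α*q)^N = u3
  generalize (β*δ*q^(2*N))^y = u4
  generalize β*δ*q^(2*N)*q^2 = u5
  generalize α*q = u6
  generalize q^(2*y) = z1 at *
  generalize q^(2*i) = z2 at *
  generalize q^(2*j) = z3 at *
  generalize q^(y*(y-1)) = z4
  generalize q^(i*j+i^2+j^2) = z5
  simp only [mul_inv]
  field_simp
lemma kapi (q ε α β γ δ : ℂ) (N y i j : ℕ) :
   kap q ε α β γ δ N y (i+1) j = ε*β*γ*q*(q^j*(q^i)^2*q)*kap q ε α β γ δ N y i j := by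
  unfold kap
  rw [pow_succ _ i, show q^((i+1)*j+(i+1)^2+j^2) = (q^j*(q^i)^2*q)*q^(i*j+i^2+j^2) by ring]
  ring
lemma kapj (q ε α β γ δ : ℂ) (N y i j : ℕ) :
   kap q ε α β γ δ N y i (j+1) = ε*γ*δ*q*(q^i*(q^j)^2*q)*kap q ε α β γ δ N y i j := by
  unfold kap
  rw [pow_succ _ j, show q^(i*(j+1)+i^2+(j+1)^2) = (q^i*(q^j)^2*q)*q^(i*j+i^2+j^2) by ring]
  ring
section
variable (q ε α β γ δ : ℂ) (N i j : ℕ)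
lemma om_inv (z : ℂ) (h : z ≠ 0) : 1 - z⁻¹ = -(1-z)/z := by field_simp; ring
lemma hat_yP1 (hq : q ≠ 0) (h0 : ε ≠ 0) (h2 : β ≠ 0) (h3 : γ ≠ 0) (n : 1 - β*γ*q^(2*i+1) ≠ 0) :
  yP1 q⁻¹ γ⁻¹ ε⁻¹ β⁻¹ i = (1-q*ε)*(1-q*γ)*(1-β*γ*q^(i+1))*(q^i)^2/(q^2*ε*γ*(1-β*γ*q^(2*i+1))) := by
  unfold yP1
  have hA : q^i ≠ 0 := pow_ne_zero _ hq
  have e2 : q^(2*i+1) ≠ 0 := pow_ne_zero _ hq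
  have e1 : q^(i+1) ≠ 0 := pow_ne_zero _ hq
  simp only [inv_pow, ← mul_inv]
  rw [om_inv (q*γ) (by positivity), om_inv (q*ε) (by positivity), om_inv (γ*β*q^(i+1)) (by positivity), om_inv (γ*β*q^(2*i+1)) (by positivity), mul_comm γ β]
  generalize 1-q*ε = a1
  generalize 1-q*γ = a2
  generalize 1-β*γ*q^(i+1) = a3
  generalize 1-β*γ*q^(2*i+1) = a4 at *
  rw [show q^(2*i+1) = (q^i)^2*q by ring, show q^(i+1) = q^i*q by ring]
  generalize q^i = A at *
  field_simp
lemma hat_yP2 (hq : q ≠ 0) (h0 : ε ≠ 0) (h2 : β ≠ 0) (h3 : γ ≠ 0) (n : 1 - β*γ*q^(2*i+1) ≠ 0) :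
  yP2 q⁻¹ γ⁻¹ ε⁻¹ β⁻¹ N i = -((1-q*ε)*(1-q*γ)*(1-β*γ*q^(N+1+i))*(1-q^i)*(1-β*q^i))/(q^4*ε^2*γ^2*q^N*β*(1-β*γ*q^(2*i+1))) := by
  unfold yP2
  have hA : q^i ≠ 0 := pow_ne_zero _ hq
  have hY : q^N ≠ 0 := pow_ne_zero _ hq
  have e2 : q^(2*i+1) ≠ 0 := pow_ne_zero _ hq
  have e1 : q^(N+1+i) ≠ 0 := pow_ne_zero _ hq
  simp only [inv_pow, ← mul_inv, inv_inv]
  rw [om_inv (q*γ) (by positivity), om_inv (q*ε) (by positivity), om_inv (γ*β*q^(N+1+i)) (by positivity), om_inv (γ*β*q^(2*i+1)) (by positivity), om_inv (β*q^i) (by positivity), mul_comm γ β]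
  generalize 1-q*ε = a1
  generalize 1-q*γ = a2
  generalize 1-β*γ*q^(N+1+i) = a3
  generalize 1-β*γ*q^(2*i+1) = a4 at *
  generalize 1-β*q^i = a5 at *
  generalize 1-q^i = a6 at *
  rw [show q^(2*i+1) = (q^i)^2*q by ring, show q^(N+1+i) = q^i*q*q^N by ring]
  generalize q^i = A at *
  generalize q^N = Y at *
  field_simp
lemma hat_u00 (hq : q ≠ 0) (h0 : ε ≠ 0) (h4 : δ ≠ 0) (n : 1 - ε*δ*q^(2*j+1) ≠ 0) :
  u00 q⁻¹ δ⁻¹ ε⁻¹ j = q^j*(1-ε*δ*q^(j+1))/(1-ε*δ*q^(2*j+1)) := by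
  unfold u00
  have hA : q^j ≠ 0 := pow_ne_zero _ hq
  have e2 : q^(2*j+1) ≠ 0 := pow_ne_zero _ hq
  have e1 : q^(j+1) ≠ 0 := pow_ne_zero _ hq
  simp only [inv_pow, ← mul_inv, inv_inv]
  rw [om_inv (δ*ε*q^(j+1)) (by positivity), om_inv (δ*ε*q^(2*j+1)) (by positivity), mul_comm δ ε]
  generalize 1-ε*δ*q^(j+1) = a1
  generalize 1-ε*δ*q^(2*j+1) = a4 at *
  rw [show q^(2*j+1) = (q^j)^2*q by ring, show q^(j+1) = q^j*q by ring]
  generalize q^j = A at *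
  field_simp
lemma hat_u10 (hq : q ≠ 0) (h0 : ε ≠ 0) (h4 : δ ≠ 0) (n : 1 - ε*δ*q^(2*j+1) ≠ 0) :
  u10 q⁻¹ δ⁻¹ ε⁻¹ N j i = -((1-q^j)*(1-δ*q^j)*(q^i-ε*δ*q^j*q^N*q))/(q^i*δ*q^j*(1-ε*δ*q^(2*j+1))) := by
  unfold u10
  have hA : q^j ≠ 0 := pow_ne_zero _ hq
  have hY : q^N ≠ 0 := pow_ne_zero _ hq
  have hI : q^i ≠ 0 := pow_ne_zero _ hq
  have e2 : q^(2*j+1) ≠ 0 := pow_ne_zero _ hq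
  have e1 : q^(j+1) ≠ 0 := pow_ne_zero _ hq
  simp only [inv_pow, ← mul_inv, inv_inv]
  rw [om_inv (q^j) hA, om_inv (δ*q^j) (by positivity), om_inv (δ*ε*q^(2*j+1)) (by positivity), mul_comm δ ε]
  generalize 1-δ*q^j = a1
  generalize 1-q^j = a2
  generalize 1-ε*δ*q^(2*j+1) = a4 at *
  rw [show q^(2*j+1) = (q^j)^2*q by ring, show q^(j+1) = q^j*q by ring]
  generalize q^j = A at *
  generalize q^N = Y at *
  generalize q^i = I at *
  field_simp
  try ring
lemma hat_u01 (G : Gen q ε α β γ δ N) (n : 1 - ε*δ*q^(2*j+1) ≠ 0)  (n' : 1-β*γ*q^(N+1+i) ≠ 0) :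
  u01 q⁻¹ α⁻¹ δ⁻¹ ε⁻¹ N j i = (1-ε*δ*q^(j+1))*(q^j-β*γ*q^(N+1+i))/((1-β*γ*q^(N+1+i))*(1-ε*δ*q^(2*j+1))) := by
  have hq := G.hq
  have h0 := G.h0
  have h1 := G.h1
  have h4 := G.h4
  unfold u01
  have hA : q^j ≠ 0 := pow_ne_zero _ hq
  have e2 : q^(2*j+1) ≠ 0 := pow_ne_zero _ hq
  have e1 : q^(j+1) ≠ 0 := pow_ne_zero _ hq
  have e : α⁻¹*δ⁻¹*ε⁻¹*((q^N)⁻¹/(q^i)⁻¹)*(q^2)⁻¹ = β*γ*q^(N+1+i) := by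
    have hb := G.bal
    rw [show q^(2*N+3) = (q^N)^2*q^3 by ring] at hb
    rw [show q^(N+1+i) = q^i*q*q^N by ring]
    have hI : q^i ≠ 0 := pow_ne_zero _ hq
    have hY : q^N ≠ 0 := pow_ne_zero _ hq
    generalize q^N = Y at *
    generalize q^i = I at *
    field_simp
    linear_combination (-1)*hb
  simp only [inv_pow]
  rw [e]
  simp only [← mul_inv, inv_inv]
  rw [om_inv (δ*ε*q^(j+1)) (by positivity), om_inv (δ*ε*q^(2*j+1)) (by positivity), mul_comm δ ε]
  generalize 1-ε*δ*q^(j+1) = a1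
  generalize β*γ*q^(N+1+i) = a3 at *
  generalize 1-ε*δ*q^(2*j+1) = a4 at *
  rw [show q^(2*j+1) = (q^j)^2*q by ring, show q^(j+1) = q^j*q by ring]
  generalize q^j = A at *
  field_simp
lemma hat_u11 (G : Gen q ε α β γ δ N) (n : 1 - ε*δ*q^(2*j+1) ≠ 0)  (n' : 1-β*γ*q^(N+1+i) ≠ 0) :
  u11 q⁻¹ α⁻¹ δ⁻¹ ε⁻¹ N j i = -((1-q^N*q/(q^i*q^j))*(1-q^j)*(1-δ*q^j)*(1-ε*δ*q^(j+1)*(β*γ*q^(N+1+i))))/(δ*q^j*(1-β*γ*q^(N+1+i))*(1-ε*δ*q^(2*j+1))) := by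
  have hq := G.hq
  have h0 := G.h0
  have h1 := G.h1
  have h4 := G.h4
  unfold u11
  have hA : q^j ≠ 0 := pow_ne_zero _ hq
  have hI : q^i ≠ 0 := pow_ne_zero _ hq
  have hY : q^N ≠ 0 := pow_ne_zero _ hq
  have e2 : q^(2*j+1) ≠ 0 := pow_ne_zero _ hq
  have e1 : q^(j+1) ≠ 0 := pow_ne_zero _ hq
  have e : α⁻¹*δ⁻¹*ε⁻¹*((q^N)⁻¹/(q^i)⁻¹)*(q^2)⁻¹ = β*γ*q^(N+1+i) := by
    have hb := G.bal
    rw [show q^(2*N+3) = (q^N)^2*q^3 by ring] at hb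
    rw [show q^(N+1+i) = q^i*q*q^N by ring]
    generalize q^N = Y at *
    generalize q^i = I at *
    field_simp
    linear_combination (-1)*hb
  simp only [inv_pow]
  rw [e]
  have e' : (q^i)⁻¹/(q^N)⁻¹*(q^j)⁻¹/q⁻¹ = q^N*q/(q^i*q^j) := by field_simp
  rw [e']
  simp only [← mul_inv, inv_inv]
  rw [om_inv (q^j) hA, om_inv (δ*q^j) (by positivity), om_inv (δ*ε*q^(2*j+1)) (by positivity), mul_comm δ ε]
  generalize β*γ*q^(N+1+i) = a3 at *
  generalize 1-q^N*q/(q^i*q^j) = a1 at *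
  generalize 1-δ*q^j = a2
  generalize 1-q^j = a5
  generalize 1-ε*δ*q^(2*j+1) = a4 at *
  rw [show q^(2*j+1) = (q^j)^2*q by ring, show q^(j+1) = q^j*q by ring]
  generalize q^j = A at *
  field_simp
  try ring
end
section
variable (q ε α β γ δ : ℂ) (N i j : ℕ)
lemma sc00 (G : Gen q ε α β γ δ N) (hij : i + j ≤ N) :
   yP1 q ε γ δ j * u00 q β γ i = ε*γ*q^2/((q^i)^2*(q^j)^2) * (yP1 q⁻¹ γ⁻¹ ε⁻¹ β⁻¹ i * u00 q⁻¹ δ⁻¹ ε⁻¹ j) := by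
  have hq := G.hq
  have h0 := G.h0
  have h3 := G.h3
  have h4 := G.h4
  have n1 := G.g23 (2*i+1) ø ø
  have n2 := G.g04 (2*j+1) ø ø
  rw [hat_yP1 _ _ _ _ _ hq h0 G.h2 h3 n1, hat_u00 _ _ _ _ hq h0 h4 n2]
  unfold yP1 u00
  have hA : q^i ≠ 0 := pow_ne_zero _ hq
  have hB : q^j ≠ 0 := pow_ne_zero _ hq
  generalize 1-β*γ*q^(i+1) = a1
  generalize 1-β*γ*q^(2*i+1) = a2 at *
  generalize 1-ε*δ*q^(j+1) = a3
  generalize 1-ε*δ*q^(2*j+1) = a4 at *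
  generalize q^i = A at *
  generalize q^j = B at *
  field_simp
lemma sc10 (G : Gen q ε α β γ δ N) (hij : i + j ≤ N) :
   yP1 q ε γ δ j * u10 q β γ N i j = ε^2*β*γ^2*q^4/(q^j) * (yP2 q⁻¹ γ⁻¹ ε⁻¹ β⁻¹ N i * u01 q⁻¹ α⁻¹ δ⁻¹ ε⁻¹ N j i) := by
  have hq := G.hq
  have h0 := G.h0
  have h2 := G.h2
  have h3 := G.h3
  have h4 := G.h4
  have n1 := G.g23 (2*i+1) ø ø
  have n2 := G.g04 (2*j+1) ø ø
  have n3 := G.g23 (N+1+i) ø ø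
  rw [hat_yP2 _ _ _ _ _ _ hq h0 G.h2 h3 n1, hat_u01 _ _ _ _ _ _ _ _ _ G n2 n3]
  unfold yP1 u10
  have hA : q^i ≠ 0 := pow_ne_zero _ hq
  have hB : q^j ≠ 0 := pow_ne_zero _ hq
  have hY : q^N ≠ 0 := pow_ne_zero _ hq
  have e : β*γ*q^(i+1) - q^j/q^N = -(q^j-β*γ*q^(N+1+i))/q^N := by
    rw [show q^(N+1+i) = q^(i+1)*q^N by ring]; field_simp; ring
  rw [e]
  generalize q^j-β*γ*q^(N+1+i) = a0 at *
  generalize 1-β*γ*q^(N+1+i) = a1 at *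
  generalize 1-β*γ*q^(2*i+1) = a2 at *
  generalize 1-ε*δ*q^(j+1) = a3
  generalize 1-ε*δ*q^(2*j+1) = a4 at *
  generalize q^i = A at *
  generalize q^j = B at *
  generalize q^N = Y at *
  field_simp
lemma bal_u (G : Gen q ε α β γ δ N) : α*β*γ*(q^N/q^j)*q^2 = (ε*δ*q^(N+1+j))⁻¹ := by
  apply eq_inv_of_mul_eq_one_left
  have hB : q^j ≠ 0 := pow_ne_zero _ G.hq
  rw [← G.bal, show q^(2*N+3) = (q^N)^2*q^3 by ring, show q^(N+1+j) = q^j*q*q^N by ring]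
  field_simp
lemma sc01 (G : Gen q ε α β γ δ N) (hij : i + j ≤ N) :
   yP2 q ε γ δ N j * u01 q α β γ N i j = ε^2*δ*γ^2*q^4/(q^i) * (yP1 q⁻¹ γ⁻¹ ε⁻¹ β⁻¹ i * u10 q⁻¹ δ⁻¹ ε⁻¹ N j i) := by
  have hq := G.hq
  have h0 := G.h0
  have h2 := G.h2
  have h3 := G.h3
  have h4 := G.h4
  have n1 := G.g23 (2*i+1) ø ø
  have n2 := G.g04 (2*j+1) ø ø
  have n3 := G.g04 (N+1+j) ø ø
  rw [hat_yP1 _ _ _ _ _ hq h0 G.h2 h3 n1, hat_u10 _ _ _ _ _ _ hq h0 h4 n2]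
  unfold yP2 u01
  have hA : q^i ≠ 0 := pow_ne_zero _ hq
  have hB : q^j ≠ 0 := pow_ne_zero _ hq
  have hY : q^N ≠ 0 := pow_ne_zero _ hq
  have hZ : q^(N+1+j) ≠ 0 := pow_ne_zero _ hq
  rw [bal_u _ _ _ _ _ _ _ _ G, om_inv (ε*δ*q^(N+1+j)) (by positivity), om_inv (q^j) hB]
  have e : 1 - (ε*δ*q^(N+1+j))⁻¹*q^i = -(q^i-ε*δ*q^j*q^N*q)/(ε*δ*q^(N+1+j)) := by
    rw [show q^(N+1+j) = q^j*q*q^N by ring]; field_simp; ring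
  rw [e]
  generalize q^i-ε*δ*q^j*q^N*q = a0 at *
  generalize 1-ε*δ*q^(N+1+j) = a1 at *
  generalize 1-β*γ*q^(2*i+1) = a2 at *
  generalize 1-β*γ*q^(i+1) = a3
  generalize 1-ε*δ*q^(2*j+1) = a4 at *
  generalize q^(N+1+j) = Z at *
  generalize q^i = A at *
  generalize q^j = B at *
  generalize q^N = Y at *
  field_simp
lemma sc11 (G : Gen q ε α β γ δ N) (hij : i + j ≤ N) :
   yP2 q ε γ δ N j * u11 q α β γ N i j = ε^3*β*δ*γ^3*q^5*(q^i*q^j) * (yP2 q⁻¹ γ⁻¹ ε⁻¹ β⁻¹ N i * u11 q⁻¹ α⁻¹ δ⁻¹ ε⁻¹ N j i) := by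
  have hq := G.hq
  have h0 := G.h0
  have h2 := G.h2
  have h3 := G.h3
  have h4 := G.h4
  have n1 := G.g23 (2*i+1) ø ø
  have n2 := G.g04 (2*j+1) ø ø
  have n3 := G.g04 (N+1+j) ø ø
  have n4 := G.g23 (N+1+i) ø ø
  rw [hat_yP2 _ _ _ _ _ _ hq h0 G.h2 h3 n1, hat_u11 _ _ _ _ _ _ _ _ _ G n2 n4]
  unfold yP2 u11
  have hA : q^i ≠ 0 := pow_ne_zero _ hq
  have hB : q^j ≠ 0 := pow_ne_zero _ hq
  have hY : q^N ≠ 0 := pow_ne_zero _ hq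
  have hZ : q^(N+1+j) ≠ 0 := pow_ne_zero _ hq
  rw [bal_u _ _ _ _ _ _ _ _ G, om_inv (ε*δ*q^(N+1+j)) (by positivity), om_inv (q^j) hB]
  have e : β*γ*q^(i+1) - (ε*δ*q^(N+1+j))⁻¹ = -(1-ε*δ*q^(j+1)*(β*γ*q^(N+1+i)))/(ε*δ*q^(N+1+j)) := by
    rw [show q^(N+1+j) = q^j*q*q^N by ring, show q^(N+1+i) = q^(i+1)*q^N by ring, pow_succ q j]; field_simp; ring
  have e' : 1 - q^j/q^N*q^i/q = -(1 - q^N*q/(q^i*q^j))*(q^i*q^j)/(q^N*q) := by field_simp; ring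
  rw [e, e']
  generalize 1-ε*δ*q^(j+1)*(β*γ*q^(N+1+i)) = a0 at *
  generalize 1 - q^N*q/(q^i*q^j) = a5 at *
  generalize 1-ε*δ*q^(N+1+j) = a1 at *
  generalize 1-β*γ*q^(2*i+1) = a2 at *
  generalize 1-β*γ*q^(N+1+i) = a3 at *
  generalize 1-ε*δ*q^(2*j+1) = a4 at *
  generalize q^(N+1+j) = Z at *
  generalize q^i = A at *
  generalize q^j = B at *
  generalize q^N = Y at *
  field_simp
end
lemma caseY (M : ℕ) (IH : Cl M) (q ε α β γ δ : ℂ) (G : Gen q ε α β γ δ (M+1)) (L y i j x : ℕ) (hL : L + y = M) (hx : x ≤ L) (hij : i + j ≤ M+1) :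
   FF q ε α β γ δ L (y+1) i j x = kap q ε α β γ δ (M+1) (y+1) i j * FF q⁻¹ γ⁻¹ α⁻¹ δ⁻¹ ε⁻¹ β⁻¹ L (y+1) j i x := by
  subst hL
  have hq := G.hq
  have hA : q^i ≠ 0 := pow_ne_zero _ hq
  have hB : q^j ≠ 0 := pow_ne_zero _ hq
  have G' : Gen q (ε*q) α β (γ*q) δ (L+y) := by simpa using G.shift 1 0 0 1 0 rfl
  rw [ystep _ _ _ _ _ _ _ _ _ _ _ G hij, ystep _ _ _ _ _ _ _ _ _ _ _ G.hat ø]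
  have E : ∀ i j, FF q (ε*q) α β (γ*q) δ L y i j x = kap q (ε*q) α β (γ*q) δ (L+y) y i j * FF q⁻¹ (γ⁻¹*q⁻¹) α⁻¹ δ⁻¹ (ε⁻¹*q⁻¹) β⁻¹ L y j i x := by
    intro i j
    have := IH _ _ _ _ _ _ G' L y i j x rfl hx
    rwa [mul_inv ε, mul_inv γ] at this
  have t00 : yP1 q ε γ δ j * u00 q β γ i * FF q (ε*q) α β (γ*q) δ L y i j x
     = kap q ε α β γ δ (L+y+1) (y+1) i j * (yP1 q⁻¹ γ⁻¹ ε⁻¹ β⁻¹ i * u00 q⁻¹ δ⁻¹ ε⁻¹ j * FF q⁻¹ (γ⁻¹*q⁻¹) α⁻¹ δ⁻¹ (ε⁻¹*q⁻¹) β⁻¹ L y j i x) := by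
    rw [sc00 _ _ _ _ _ _ _ _ _ G hij, E, kapY _ _ _ _ _ _ _ _ _ _ G]; ring
  have t10 : yP1 q ε γ δ j * u10 q β γ (L+y+1) i j * FF q (ε*q) α β (γ*q) δ L y (i-1) j x
     = kap q ε α β γ δ (L+y+1) (y+1) i j * (yP2 q⁻¹ γ⁻¹ ε⁻¹ β⁻¹ (L+y+1) i * u01 q⁻¹ α⁻¹ δ⁻¹ ε⁻¹ (L+y+1) j i * FF q⁻¹ (γ⁻¹*q⁻¹) α⁻¹ δ⁻¹ (ε⁻¹*q⁻¹) β⁻¹ L y j (i-1) x) := by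
    cases i with
    | zero => simp [u10, yP2]
    | succ n =>
      have hn : q^n ≠ 0 := pow_ne_zero _ hq
      rw [sc10 _ _ _ _ _ _ _ _ _ G hij, E, kapY _ _ _ _ _ _ _ _ _ _ G, Nat.add_sub_cancel, kapi]
      have : ε^2*β*γ^2*q^4/q^j = ε*γ*q^2/((q^(n+1))^2*(q^j)^2)*(ε*q*β*(γ*q)*q*(q^j*(q^n)^2*q)) := by
        rw [pow_succ q n]; field_simp
      rw [this]; ring
  have t01 : yP2 q ε γ δ (L+y+1) j * u01 q α β γ (L+y+1) i j * FF q (ε*q) α β (γ*q) δ L y i (j-1) x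
     = kap q ε α β γ δ (L+y+1) (y+1) i j * (yP1 q⁻¹ γ⁻¹ ε⁻¹ β⁻¹ i * u10 q⁻¹ δ⁻¹ ε⁻¹ (L+y+1) j i * FF q⁻¹ (γ⁻¹*q⁻¹) α⁻¹ δ⁻¹ (ε⁻¹*q⁻¹) β⁻¹ L y (j-1) i x) := by
    cases j with
    | zero => simp [u10, yP2]
    | succ n =>
      have hn : q^n ≠ 0 := pow_ne_zero _ hq
      rw [sc01 _ _ _ _ _ _ _ _ _ G hij, E, kapY _ _ _ _ _ _ _ _ _ _ G, Nat.add_sub_cancel, kapj]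
      have : ε^2*δ*γ^2*q^4/q^i = ε*γ*q^2/((q^i)^2*(q^(n+1))^2)*(ε*q*(γ*q)*δ*q*(q^i*(q^n)^2*q)) := by
        rw [pow_succ q n]; field_simp
      rw [this]; ring
  have t11 : yP2 q ε γ δ (L+y+1) j * u11 q α β γ (L+y+1) i j * FF q (ε*q) α β (γ*q) δ L y (i-1) (j-1) x
     = kap q ε α β γ δ (L+y+1) (y+1) i j * (yP2 q⁻¹ γ⁻¹ ε⁻¹ β⁻¹ (L+y+1) i * u11 q⁻¹ α⁻¹ δ⁻¹ ε⁻¹ (L+y+1) j i * FF q⁻¹ (γ⁻¹*q⁻¹) α⁻¹ δ⁻¹ (ε⁻¹*q⁻¹) β⁻¹ L y (j-1) (i-1) x) := by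
    cases j with
    | zero => simp [u11, yP2]
    | succ n =>
     cases i with
     | zero => simp [u11, yP2]
     | succ m =>
      have hn : q^n ≠ 0 := pow_ne_zero _ hq
      have hm : q^m ≠ 0 := pow_ne_zero _ hq
      rw [sc11 _ _ _ _ _ _ _ _ _ G hij, E, kapY _ _ _ _ _ _ _ _ _ _ G, Nat.add_sub_cancel, Nat.add_sub_cancel, kapj, kapi]
      have : ε^3*β*δ*γ^3*q^5*(q^(m+1)*q^(n+1)) = ε*γ*q^2/((q^(m+1))^2*(q^(n+1))^2)*((ε*q*(γ*q)*δ*q*(q^(m+1)*(q^n)^2*q))*(ε*q*β*(γ*q)*q*(q^n*(q^m)^2*q))) := by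
        rw [pow_succ q m, pow_succ q n]; field_simp
      rw [this]; ring
  rw [t00, t10, t01, t11]; ring
theorem main_cl (N : ℕ) : Cl N := by
  induction N with
  | zero =>
    intro q ε α β γ δ G L y i j x hL hx
    by_cases hij : L + y < i + j
    · rw [FF_vanish _ _ _ _ _ _ _ _ _ _ _ G.hq hij, FF_vanish _ _ _ _ _ _ _ _ _ _ _ G.hat.hq ø, mul_zero]
    · obtain ⟨rfl, rfl, rfl, rfl, rfl⟩ : L = 0 ∧ y = 0 ∧ i = 0 ∧ j = 0 ∧ x = 0 := by omega
      have f : ∀ q ε α β γ δ : ℂ, Gen q ε α β γ δ 0 → FF q ε α β γ δ 0 0 0 0 0 = 1 := by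
        intro q ε α β γ δ G
        have h := G.g12 1 ø ø
        rw [FF_tt _ _ _ _ _ _ _ G.hq, sum_range_one, tt_eq _ _ _ _ _ _ _ _ G]
        rw [pow_one] at h
        simp [poch, h]
      rw [f _ _ _ _ _ _ G, f _ _ _ _ _ _ G.hat]
      simp [kap]
  | succ M IH =>
    intro q ε α β γ δ G L y i j x hL hx
    by_cases hij : L + y < i + j
    · rw [FF_vanish _ _ _ _ _ _ _ _ _ _ _ G.hq hij, FF_vanish _ _ _ _ _ _ _ _ _ _ _ G.hat.hq ø, mul_zero]
    · cases y with
      | succ y => exact caseY M IH _ _ _ _ _ _ G L y i j x ø hx ø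
      | zero =>
        obtain rfl : L = M+1 := by omega
        cases i with
        | succ n => exact caseI M IH _ _ _ _ _ _ G n j x hx ø
        | zero =>
          cases j with
          | succ n =>
            apply cl_hat _ _ _ _ _ _ _ _ _ _ _ _ G
            exact caseI M IH _ _ _ _ _ _ G.hat n 0 x hx ø
          | zero =>
            cases x with
            | succ m => exact caseX M IH _ _ _ _ _ _ G m ø
            | zero => exact caseB M IH _ _ _ _ _ _ G
lemma poch_add (q a : ℂ) (k m : ℕ) : Ψ q a (k+m) = Ψ q a k * Ψ q (a*q^k) m := by
  unfold poch
  rw [prod_range_add]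
  congr 1
  apply prod_congr rfl
  intro l _
  rw [pow_add]; ring
lemma poch_rev (q s z : ℂ) (hs : s ≠ 0) (hq : q = s^2) (hz : z ≠ 0) (k m : ℕ) :
   Ψ q (z*q^(k+m))⁻¹ k * Ψ q (q*z) m * ((-z)^k * s^(2*k*m+k*(k+1))) = Ψ q (q*z) (k+m) := by
  have hq0 : q ≠ 0 := by rw [hq]; positivity
  induction k with
  | zero => simp [poch_zero]
  | succ k ih =>
    rw [poch_succ']
    have e : (z*q^(k+1+m))⁻¹*q = (z*q^(k+m))⁻¹ := by
      rw [show k+1+m = k+m+1 by ring, pow_succ]; field_simp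
    rw [e, show k+1+m = k+m+1 by ring, poch_succ q (q*z), ← ih]
    have e2 : s^(2*(k+1)*m+(k+1)*(k+1+1)) = s^(2*k*m+k*(k+1))*q^(k+m+1) := by
      rw [hq, ← pow_mul, ← pow_add]; congr 1; ring
    rw [e2, pow_succ (-z)]
    have e3 : (1-(z*q^(k+m+1))⁻¹)*(-z)*q^(k+m+1) = 1 - q*z*q^(k+m) := by
      rw [pow_succ]; field_simp; ring
    rw [← e3]; ring
lemma poch_inv (q s z : ℂ) (hs : s ≠ 0) (hq : q = s^2) (hz : z ≠ 0) (k : ℕ) :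
   Ψ q⁻¹ z⁻¹ k = Ψ q z k * ((-z)^k)⁻¹ * (s^((k:ℤ)*(k-1)))⁻¹ := by
  have hq0 : q ≠ 0 := by rw [hq]; positivity
  induction k with
  | zero => simp [poch_zero]
  | succ k ih =>
    rw [poch_succ, poch_succ, ih]
    have e : s^(((k+1:ℕ):ℤ)*(((k+1:ℕ):ℤ)-1)) = s^((k:ℤ)*(k-1))*q^k := by
      rw [hq, ← pow_mul, ← zpow_natCast s (2*k), ← zpow_add₀ hs]; congr 1; push_cast; ring
    have : q^k ≠ 0 := pow_ne_zero _ hq0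
    have : s^((k:ℤ)*(k-1)) ≠ 0 := zpow_ne_zero _ hs
    have : (-z)^k ≠ 0 := pow_ne_zero _ (neg_ne_zero.2 hz)
    rw [e, pow_succ (-z), inv_pow]
    generalize s^((k:ℤ)*(k-1)) = S at *
    generalize (-z)^k = Z at *
    generalize q^k = Q at *
    field_simp
    ring
def mn (s t0 t1 t2 t3 t4 : ℂ) (g e e0 e1 e2 e3 e4 : ℤ) : ℂ := (-1)^g*s^e*t0^e0*t1^e1*t2^e2*t3^e3*t4^e4
structure NZ (s t0 t1 t2 t3 t4 : ℂ) : Prop where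
  hs : s ≠ 0
  h0 : t0 ≠ 0
  h1 : t1 ≠ 0
  h2 : t2 ≠ 0
  h3 : t3 ≠ 0
  h4 : t4 ≠ 0
lemma mn_mul {s t0 t1 t2 t3 t4 : ℂ} (H : NZ s t0 t1 t2 t3 t4) (g e e0 e1 e2 e3 e4 g' f f0 f1 f2 f3 f4 : ℤ) : mn s t0 t1 t2 t3 t4 g e e0 e1 e2 e3 e4 * mn s t0 t1 t2 t3 t4 g' f f0 f1 f2 f3 f4
   = mn s t0 t1 t2 t3 t4 (g+g') (e+f) (e0+f0) (e1+f1) (e2+f2) (e3+f3) (e4+f4) := by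
  unfold mn
  rw [zpow_add₀ H.hs, zpow_add₀ H.h0, zpow_add₀ H.h1, zpow_add₀ H.h2, zpow_add₀ H.h3, zpow_add₀ H.h4, zpow_add₀ (by norm_num : (-1:ℂ) ≠ 0)]
  ring
lemma mn_inv {s t0 t1 t2 t3 t4 : ℂ}  (g e e0 e1 e2 e3 e4 : ℤ) : (mn s t0 t1 t2 t3 t4 g e e0 e1 e2 e3 e4)⁻¹
   = mn s t0 t1 t2 t3 t4 (-g) (-e) (-e0) (-e1) (-e2) (-e3) (-e4) := by
  unfold mn
  simp only [mul_inv, zpow_neg]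
lemma mn_zpow {s t0 t1 t2 t3 t4 : ℂ}  (g e e0 e1 e2 e3 e4 k : ℤ) : (mn s t0 t1 t2 t3 t4 g e e0 e1 e2 e3 e4)^k
   = mn s t0 t1 t2 t3 t4 (g*k) (e*k) (e0*k) (e1*k) (e2*k) (e3*k) (e4*k) := by
  unfold mn
  simp only [mul_zpow, zpow_mul]
lemma mn_pow {s t0 t1 t2 t3 t4 : ℂ}  (g e e0 e1 e2 e3 e4 : ℤ) (k : ℕ) : (mn s t0 t1 t2 t3 t4 g e e0 e1 e2 e3 e4)^k
   = mn s t0 t1 t2 t3 t4 (g*k) (e*k) (e0*k) (e1*k) (e2*k) (e3*k) (e4*k) := by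
  rw [← zpow_natCast, mn_zpow]
lemma mn_neg {s t0 t1 t2 t3 t4 : ℂ}  (g e e0 e1 e2 e3 e4 : ℤ) : -(mn s t0 t1 t2 t3 t4 g e e0 e1 e2 e3 e4)
   = mn s t0 t1 t2 t3 t4 (g+1) e e0 e1 e2 e3 e4 := by
  unfold mn
  rw [zpow_add₀ (by norm_num : (-1:ℂ) ≠ 0)]; ring
lemma mn_s (s t0 t1 t2 t3 t4 : ℂ) : s = mn s t0 t1 t2 t3 t4 0 1 0 0 0 0 0 := by simp [mn]
lemma mn_t0 (s t0 t1 t2 t3 t4 : ℂ) : t0 = mn s t0 t1 t2 t3 t4 0 0 1 0 0 0 0 := by simp [mn]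
lemma mn_t1 (s t0 t1 t2 t3 t4 : ℂ) : t1 = mn s t0 t1 t2 t3 t4 0 0 0 1 0 0 0 := by simp [mn]
lemma mn_t2 (s t0 t1 t2 t3 t4 : ℂ) : t2 = mn s t0 t1 t2 t3 t4 0 0 0 0 1 0 0 := by simp [mn]
lemma mn_t3 (s t0 t1 t2 t3 t4 : ℂ) : t3 = mn s t0 t1 t2 t3 t4 0 0 0 0 0 1 0 := by simp [mn]
lemma mn_t4 (s t0 t1 t2 t3 t4 : ℂ) : t4 = mn s t0 t1 t2 t3 t4 0 0 0 0 0 0 1 := by simp [mn]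
/-- equality of monomials up to balance (k) and even sign (2*r) -/
lemma mn_eq {s t0 t1 t2 t3 t4 : ℂ} (H : NZ s t0 t1 t2 t3 t4) (b : ℤ) (hb : s^b*t0*t1*t2*t3*t4 = 1) (k r : ℤ) (g e e0 e1 e2 e3 e4 g' f f0 f1 f2 f3 f4 : ℤ)
   (hg : g = g' + 2*r) (he : e = f + b*k) (h0 : e0 = f0+k) (h1 : e1 = f1+k) (h2 : e2 = f2+k) (h3 : e3 = f3+k) (h4 : e4 = f4+k) :
   mn s t0 t1 t2 t3 t4 g e e0 e1 e2 e3 e4 = mn s t0 t1 t2 t3 t4 g' f f0 f1 f2 f3 f4 := by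
  have a1 : mn s t0 t1 t2 t3 t4 (2*r) (b*k) k k k k k = 1 := by
    unfold mn
    rw [zpow_mul, zpow_mul]
    rw [show ((-1:ℂ)^(2:ℤ)) = 1 by norm_num, one_zpow, one_mul, ← mul_zpow, ← mul_zpow, ← mul_zpow, ← mul_zpow, ← mul_zpow, hb, one_zpow]
  rw [hg, he, h0, h1, h2, h3, h4, ← mn_mul H, a1, mul_one]
lemma p_eq (q s α β γ t2 : ℂ) (K n x : ℕ) (hq : q ≠ 0) (hn : n ≤ K) (hx : x ≤ K) :
   p q s α β γ t2 K n x = Om q s α β γ t2 K n * SS q α β γ (q^K) n x := by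
  unfold p
  rw [if_pos ø]
  congr 1
  rw [SS_cutn _ _ _ _ _ _ _ (n+1) hq ø]
  unfold ph tm
  simp only [Int.toNat_natCast]
  apply sum_congr rfl
  intro k _
  simp only [zpow_neg, zpow_natCast]
  rw [show q^((n:ℤ)+1) = q^(n+1) by norm_cast, show q^((x:ℤ)+1) = q^(x+1) by norm_cast, show q^((K:ℤ)+2) = q^(K+2) by norm_cast, pow_add q K 2, ← mul_assoc]
lemma Om_eq (q s α β γ t2 : ℂ) (n m : ℕ) :
   Om q s α β γ t2 ((n+m:ℕ):ℤ) n = Ψ q q (n+m)/(Ψ q q n*Ψ q q m) * (1-β*γ*q^(2*n+1)) * Ψ q (q*β) n * Ψ q (α*β*γ*q^(n+m+2)) n * Ψ q (q*α) m /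
     ((s*t2)^((n:ℤ)-m) * Ψ q (β*γ*q^(n+1)) (n+m+1) * Ψ q (q*γ) n) := by
  unfold Om binom
  rw [if_pos ø, Int.toNat_natCast, Int.toNat_natCast, show (((n+m:ℕ):ℤ)-(n:ℤ)).toNat = m by omega, show (((n+m:ℕ):ℤ)+1).toNat = n+m+1 by omega,
   show q^(2*(n:ℤ)+1) = q^(2*n+1) by norm_cast, show q^(((n+m:ℕ):ℤ)+2) = q^(n+m+2) by norm_cast, show q^((n:ℤ)+1) = q^(n+1) by norm_cast,
   show 2*(n:ℤ) - ((n+m:ℕ):ℤ) = (n:ℤ)-m by push_cast; ring]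
lemma q_tri (q s : ℂ) (hq : q = s^2) (a : ℕ) : q^(a*(a-1)/2) = s^((a:ℤ)*((a:ℤ)-1)) := by
  rw [hq, ← pow_mul, Nat.two_mul_div_two_of_even (Nat.even_mul_pred_self a), ← zpow_natCast]
  congr 1
  cases a <;> simp
lemma om_eq (q s r : ℂ) (hq : q = s^2) (a : ℕ) : om q r a = (-1)^a*r^a*s^((a:ℤ)*((a:ℤ)+1)) := by
  unfold om
  rw [zpow_natCast, zpow_natCast]
  congr 1
  rw [show (a:ℤ)*((a:ℤ)+1) = ((a*(a+1):ℕ):ℤ) by push_cast; ring, show (((a*(a+1):ℕ):ℤ)/2) = ((a*(a+1)/2:ℕ):ℤ) by push_cast; rfl,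
   zpow_natCast, zpow_natCast, hq, ← pow_mul, Nat.two_mul_div_two_of_even (Nat.even_mul_succ_self a)]
lemma mn_m1 (s t0 t1 t2 t3 t4 : ℂ) : (-1:ℂ) = mn s t0 t1 t2 t3 t4 1 0 0 0 0 0 0 := by simp [mn]
lemma mono1 {s t0 t1 t2 t3 t4 : ℂ} (H : NZ s t0 t1 t2 t3 t4) (a j m l : ℕ)
   (hb : s^(2*((a+j+m:ℕ):ℤ)+3)*t0*t1*t2*t3*t4 = 1) (E S T0 T1 T2 T3 T4 : ℂ)
   (hE : E = -1) (hS : S = s) (h0 : T0 = t0) (h1 : T1 = t1) (h2 : T2 = t2) (h3 : T3 = t3) (h4 : T4 = t4) :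
   E^a*(T1*T2*T3/T4)^a*S^((a:ℤ)*((a:ℤ)+1)) * ((S*T0)^((j:ℤ)-m))⁻¹*((S*T2)^((a:ℤ)-l))⁻¹
     *(E^j*S^(2*j*m+j*(j+1)))*(E^a*S^(2*a*l+a*(a+1)))*((E*(T0^2*T4^2*(S^2)^j))^a*S^(2*a*(j+m+1)+a*(a+1)))
   = ((E*T3^2)^(a+j)*S^(2*(a+j)*m+(a+j)*(a+j+1)))*((E*T4^2)^a*S^(2*a*l+a*(a+1)))*(((T3^2)^j)⁻¹*(S*T2)^(a+l)*(S*T0)^((a:ℤ)+m-j))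
     *((E*(T0^2*T1^2*(S^2)^(a+j+m+2+j)))^a*S^((a:ℤ)*((a:ℤ)-1))) := by
  rw [mn_m1 s t0 t1 t2 t3 t4] at hE
  rw [mn_s s t0 t1 t2 t3 t4] at hS
  rw [mn_t0 s t0 t1 t2 t3 t4] at h0
  rw [mn_t1 s t0 t1 t2 t3 t4] at h1
  rw [mn_t2 s t0 t1 t2 t3 t4] at h2
  rw [mn_t3 s t0 t1 t2 t3 t4] at h3
  rw [mn_t4 s t0 t1 t2 t3 t4] at h4
  rw [hE, hS, h0, h1, h2, h3, h4]
  simp only [div_eq_mul_inv, mn_mul H, mn_inv, mn_pow, mn_zpow]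
  apply mn_eq H _ hb (-(a:ℤ)) 0 <;> push_cast <;> ring
structure Sq (q s ε α β γ δ t0 t1 t2 t3 t4 : ℂ) : Prop where
  hq : q = s^2
  h0 : ε = t0^2
  h1 : α = t1^2
  h2 : β = t2^2
  h3 : γ = t3^2
  h4 : δ = t4^2
def Cf (q s ε α β γ δ t0 t2 : ℂ) (L N j : ℕ) : ℂ :=
  Ψ q (q*γ) N*(γ^j)⁻¹*(1-ε*δ*q^(2*j+1))*Ψ q (q*ε) j*Ψ q (q*δ) L*(s*t2)^L*(s*t0)^((N:ℤ)-2*j)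
   /(Ψ q q j*Ψ q (ε*δ*q^(j+1)) (N+1)*Ψ q (q*δ) j*Ψ q (α*β*q) (L+1))
lemma Gen.pq {q ε α β γ δ : ℂ} {N : ℕ} (G : Gen q ε α β γ δ N) (k : ℕ) (h : k ≤ N) : Ψ q q k ≠ 0 := by
  apply poch_ne; intro l hl; rw [← pow_succ']; exact G.q1 (l+1) ø ø
lemma pne {q c : ℂ} {M : ℕ} (h : ∀ k, 1 ≤ k → k ≤ M → 1 - c*q^k ≠ 0) (k : ℕ) (hk : k ≤ M) : Ψ q (q*c) k ≠ 0 := by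
  apply poch_ne; intro l hl
  have := h (l+1) ø ø
  rw [pow_succ'] at this; convert this using 2; ring
lemma pne2 {q c : ℂ} {M : ℕ} (h : ∀ k, 1 ≤ k → k ≤ M → 1 - c*q^k ≠ 0) (k d : ℕ) (hk : k + d ≤ M) : Ψ q (c*q^(d+1)) k ≠ 0 := by
  apply poch_ne; intro l hl
  have := h (l+d+1) ø ø
  convert this using 2; ring
lemma term_eq {q s ε α β γ δ t0 t1 t2 t3 t4 : ℂ} (a j m l : ℕ) (hL : a + l ≤ a+j+m) (G : Gen q ε α β γ δ (a+j+m)) (H : NZ s t0 t1 t2 t3 t4)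
   (Q : Sq q s ε α β γ δ t0 t1 t2 t3 t4) (hb : s^(2*((a+j+m:ℕ):ℤ)+3)*t0*t1*t2*t3*t4 = 1) :
   om q (t1*t2*t3/t4) a * Om q s γ ε δ t0 ((j+m:ℕ):ℤ) j * Om q s δ β α t2 ((a+l:ℕ):ℤ) a
     = Cf q s ε α β γ δ t0 t2 (a+l) (a+j+m) j * hh q ε α β γ δ (a+l) (a+j+m) j a := by
  have hq := G.hq
  have M := mono1 H a j m l hb (-1) s t0 t1 t2 t3 t4 rfl rfl rfl rfl rfl rfl rfl
  simp only [neg_one_mul] at M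
  rw [om_eq q s _ Q.hq, Om_eq, Om_eq]
  unfold Cf hh hnum hden
  rw [q_tri q s Q.hq]
  have RA := poch_rev q s 1 H.hs Q.hq one_ne_zero a l
  have RB := poch_rev q s δ H.hs Q.hq G.h4 a l
  have RC := poch_rev q s γ H.hs Q.hq G.h3 (a+j) m
  have RD := poch_rev q s 1 H.hs Q.hq one_ne_zero j m
  have RE := poch_rev q s (ε*δ*q^j) H.hs Q.hq (by have := G.h0; have := G.h4; positivity) a (j+m+1)
  have F1 := poch_add q (α*β*q) a (a+l+1)
  have F2 := poch_add q (α*β*q) (a+l+1) a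
  rw [show a+l+1+a = a+(a+l+1) by ring, F1] at F2
  rw [one_mul, mul_one] at RA RD
  rw [show ε*δ*q^j*q^(a+(j+m+1)) = ε*δ*q^(a+j+m+j+1) by ring, show q*(ε*δ*q^j) = ε*δ*q^(j+1) by ring, show a+(j+m+1)=a+j+m+1 by ring] at RE
  rw [show α*β*q*q^a = α*β*q^(a+1) by ring, show α*β*q*q^(a+l+1) = α*β*q^(a+l+2) by ring] at F2
  rw [show q^a/q^(a+j+m) = (q^(j+m))⁻¹ by rw [show a+j+m = a+(j+m) by ring, pow_add]; field_simp,
    show ε*γ*δ*q^(a+j+m+2)/q^a = γ*ε*δ*q^(j+m+2) by rw [show a+j+m+2 = a+(j+m+2) by ring, pow_add]; field_simp,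
    show β*α*q^(2*a+1) = α*β*q^(2*a+1) by ring, show δ*β*α*q^(a+l+2) = α*β*δ*q^(a+l+2) by ring, show β*α*q^(a+1) = α*β*q^(a+1) by ring]
  rw [← Q.h0, ← Q.h1, ← Q.h3, ← Q.h4, ← Q.hq] at M
  rw [show ((a+j+m:ℕ):ℤ)-2*j = (a:ℤ)+m-j by push_cast; ring]
  have z1 : Ψ q (q*γ) (a+j+m) ≠ 0 := pne G.g3 _ ø
  have z2 : Ψ q (q*δ) (a+l) ≠ 0 := pne G.g4 _ ø
  have z3 : Ψ q (ε*δ*q^(j+1)) (a+j+m+1) ≠ 0 := pne2 G.g04 _ _ ø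
  have z4 : Ψ q q (a+l) ≠ 0 := G.pq _ ø
  have z5 : Ψ q q (j+m) ≠ 0 := G.pq _ ø
  have z6 : Ψ q (α*β*q) a * Ψ q (α*β*q^(a+1)) (a+l+1) ≠ 0 := by
    refine mul_ne_zero ?_ (pne2 G.g12 _ _ ø)
    have := pne2 G.g12 a 0 ø
    simpa using this
  have z7 : Ψ q (q*α) a ≠ 0 := pne G.g1 _ ø
  have z8 : Ψ q q a ≠ 0 := G.pq _ ø
  have z9 : Ψ q q j ≠ 0 := G.pq _ ø
  have z10 : Ψ q (q*δ) j ≠ 0 := pne G.g4 _ ø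
  have z11 : (s*t0)^((j:ℤ)-m) ≠ 0 := zpow_ne_zero _ (mul_ne_zero H.hs H.h0)
  have z12 : (s*t2)^((a:ℤ)-l) ≠ 0 := zpow_ne_zero _ (mul_ne_zero H.hs H.h2)
  have z13 : γ^j ≠ 0 := pow_ne_zero _ G.h3
  generalize (-1:ℂ)^j * s^(2*j*m+j*(j+1)) = mD at *
  generalize (-1:ℂ)^a * s^(2*a*l+a*(a+1)) = mA at *
  generalize (-(ε*δ*q^j))^a * s^(2*a*(j+m+1)+a*(a+1)) = mE at *
  generalize (-γ)^(a+j) * s^(2*(a+j)*m+(a+j)*(a+j+1)) = mC at *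
  generalize (-δ)^a * s^(2*a*l+a*(a+1)) = mB at *
  generalize (-1:ℂ)^a*(t1*t2*t3/t4)^a*s^((a:ℤ)*((a:ℤ)+1)) = O at *
  generalize (s*t0)^((j:ℤ)-m) = P1 at *
  generalize (s*t2)^((a:ℤ)-l) = P2 at *
  generalize (s*t0)^((a:ℤ)+m-j) = P3 at *
  generalize (s*t2)^(a+l) = P4 at *
  generalize (-(ε*α*q^(a+j+m+2+j)))^a = P5 at *
  generalize s^((a:ℤ)*((a:ℤ)-1)) = P6 at *
  generalize γ^j = P7 at *
  generalize Ψ q (q^(a+l))⁻¹ a = R1 at *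
  generalize Ψ q (δ*q^(a+l))⁻¹ a = R2 at *
  generalize Ψ q (γ*q^(a+j+m))⁻¹ (a+j) = R3 at *
  generalize Ψ q (q^(j+m))⁻¹ j = R4 at *
  generalize Ψ q (ε*δ*q^(a+j+m+j+1))⁻¹ a = R5 at *
  rw [← RC] at z1 ⊢
  rw [← RB] at z2 ⊢
  rw [← RE] at z3 ⊢
  rw [← RA] at z4 ⊢
  rw [← RD] at z5 ⊢
  clear RA RB RC RD RE F1
  rw [F2] at z6
  generalize Ψ q (α*β*q) a = A1 at *
  generalize Ψ q (α*β*q^(a+1)) (a+l+1) = A2 at *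
  generalize Ψ q (α*β*q) (a+l+1) = A3 at *
  generalize Ψ q (α*β*q^(a+l+2)) a = A4 at *
  generalize 1-ε*δ*q^(2*j+1) = B1
  generalize 1-α*β*q^(2*a+1) = B2
  generalize Ψ q (q*ε) j = B3
  generalize Ψ q (q*β) a = B4
  generalize Ψ q (γ*ε*δ*q^(j+m+2)) j = B5
  generalize Ψ q (α*β*δ*q^(a+l+2)) a = B6
  generalize Ψ q (q*α) a = B7 at *
  generalize Ψ q q a = B8 at *
  generalize Ψ q q j = B9 at *
  generalize Ψ q (q*δ) j = B10 at *
  generalize Ψ q (q*γ) m = D1 at *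
  generalize Ψ q (q*δ) l = D2 at *
  generalize Ψ q (ε*δ*q^(j+1)) (j+m+1) = D3 at *
  generalize Ψ q q l = D4 at *
  generalize Ψ q q m = D5 at *
  clear hq Q H G hb hL
  have z62 := z6
  rw [← F2] at z62
  simp only [mul_ne_zero_iff] at z1 z2 z3 z4 z5 z6 z62
  obtain ⟨⟨_,_⟩,_⟩ := z1
  obtain ⟨⟨_,_⟩,_⟩ := z2
  obtain ⟨⟨_,_⟩,_⟩ := z3
  obtain ⟨⟨_,_⟩,_⟩ := z4
  obtain ⟨⟨_,_⟩,_⟩ := z5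
  obtain ⟨_,_⟩ := z6
  obtain ⟨_,_⟩ := z62
  have M' : O*mD*mA*mE*P7 = mC*mB*P4*P3*P5*P6*P1*P2 := by
    field_simp at M
    linear_combination M
  have e1 : A2 = A3*A4/A1 := by field_simp; linear_combination F2
  rw [e1]
  field_simp
  linear_combination (B1*B2*B3*B4*B5*B6)*M'
lemma G_eq {q s ε α β γ δ t0 t1 t2 t3 t4 : ℂ} (N L y i j x n : ℕ) (hN : L + y = N) (hx : x ≤ L) (hij : i + j + n = N) (Ge : Gen q ε α β γ δ N) (H : NZ s t0 t1 t2 t3 t4)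
   (Q : Sq q s ε α β γ δ t0 t1 t2 t3 t4)
   (hc0 : ε = (q ^ (2 * (N : ℤ) + 3) * α * β * γ * δ)⁻¹)
   (ht0 : t0 = (s ^ (2 * (N : ℤ) + 3) * t1 * t2 * t3 * t4)⁻¹) :
   G q s α β γ δ t1 t2 t3 t4 N i j x y = Om q s α β γ t2 ((i+n:ℕ):ℤ) i * Cf q s ε α β γ δ t0 t2 L N j * HH q ε α β γ δ L y i j x := by
  have hq := Ge.hq
  have hb : s^(2*(N:ℤ)+3)*t0*t1*t2*t3*t4 = 1 := by
    rw [ht0]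
    have := H.h1; have := H.h2; have := H.h3; have := H.h4; have := zpow_ne_zero (2*(N:ℤ)+3) H.hs
    field_simp
  unfold G
  rw [if_pos ø, ← hc0, ← ht0]
  unfold HH
  rw [mul_sum]
  rw [show (min ((N:ℤ)-j) ((N:ℤ)-y)).toNat + 1 = min (i+n) L + 1 by omega]
  rw [← sum_subset (range_subset_range.2 (show min (i+n) L + 1 ≤ L + 1 by omega))]
  · apply sum_congr rfl
    intro a ha
    have ha := mem_range.1 ha
    obtain ⟨l, rfl⟩ : ∃ l, L = a + l := ⟨L - a, by omega⟩
    obtain ⟨m, hm⟩ : ∃ m, N = a+j+m := ⟨N-a-j, by omega⟩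
    have T := term_eq (q:=q) (s:=s) (ε:=ε) (α:=α) (β:=β) (γ:=γ) (δ:=δ) (t0:=t0) (t1:=t1) (t2:=t2) (t3:=t3) (t4:=t4) a j m l ø (hm ▸ Ge) H Q (hm ▸ hb)
    rw [← hm] at T
    rw [hN]
    have e1 : q^N/q^j = q^(i+n) := by rw [← hij, show i+j+n=j+(i+n) by ring, pow_add]; field_simp
    have e2 : q^N/q^a = q^(j+m) := by rw [hm, show a+j+m=a+(j+m) by ring, pow_add]; field_simp
    rw [e1, e2, show (N:ℤ)-j = ((i+n:ℕ):ℤ) by omega, show (N:ℤ)-a = ((j+m:ℕ):ℤ) by omega, show (N:ℤ)-y = ((a+l:ℕ):ℤ) by omega,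
      p_eq _ _ _ _ _ _ _ _ _ hq ø ø, p_eq _ _ _ _ _ _ _ _ _ hq ø ø, p_eq _ _ _ _ _ _ _ _ _ hq ø ø]
    linear_combination (Om q s α β γ t2 ((i+n:ℕ):ℤ) i*SS q α β γ (q^(i+n)) i a*SS q γ ε δ (q^(j+m)) j y*SS q δ β α (q^(a+l)) a x)*T
  · intro a ha hna
    have ha := mem_range.1 ha
    simp only [mem_range, not_lt] at hna
    have : hh q ε α β γ δ L (L+y) j a = 0 := by
      unfold hh hnum
      rw [poch_eq_zero q (q^a/q^(L+y)) j (L+y-a) ø]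
      · ring
      · rw [div_mul_eq_mul_div, ← pow_add, show a+(L+y-a) = L+y by omega]; exact div_self (pow_ne_zero _ hq)
    rw [this]; ring
def mW (q s ε γ δ t0 t2 : ℂ) (L N i j n : ℕ) : ℂ :=
  (s*t2)^L*(s*t0)^((N:ℤ)-2*j)*(γ^j)⁻¹*((s*t2)^((i:ℤ)-n))⁻¹*((-1)^i*s^(2*i*n+i*(i+1)))/((-(ε*δ*q^j))^i*s^(2*i*(j+n+1)+i*(i+1)))
def Wf (q s ε α β γ δ t0 t2 : ℂ) (L y i j x n : ℕ) : ℂ :=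
  (1-β*γ*q^(2*i+1))*(1-ε*δ*q^(2*j+1))*Ψ q (q*α) n*mW q s ε γ δ t0 t2 L (L+y) i j n
   /(Ψ q q i*Ψ q q j*Ψ q (β*γ*q^(i+1)) (i+n+1)*Ψ q (ε*δ*q^(j+1)) (j+n+1)*Ψ q (q*γ) i*Ψ q (q*δ) j*Ψ q (q*β) x*Ψ q (q*ε) y)
lemma W_eq {q s ε α β γ δ t0 t1 t2 t3 t4 : ℂ} (L y i j x n : ℕ) (hx : x ≤ L) (hij : i + j + n = L+y) (G : Gen q ε α β γ δ (L+y)) (H : NZ s t0 t1 t2 t3 t4)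
   (Q : Sq q s ε α β γ δ t0 t1 t2 t3 t4) :
   Om q s α β γ t2 ((i+n:ℕ):ℤ) i * Cf q s ε α β γ δ t0 t2 L (L+y) j = Wf q s ε α β γ δ t0 t2 L y i j x n * pre q ε α β γ δ L y i j x := by
  have hq := G.hq
  have hc0 := G.h0
  have hc4 := G.h4
  rw [Om_eq]
  unfold Cf Wf pre mW
  have RA := poch_rev q s 1 H.hs Q.hq one_ne_zero i n
  have RE := poch_rev q s (ε*δ*q^j) H.hs Q.hq (by positivity) i (j+n+1)
  rw [one_mul, mul_one] at RA
  have e1 : q^j/q^(L+y) = (q^(i+n))⁻¹ := by rw [← hij, show i+j+n=j+(i+n) by ring, pow_add]; field_simp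
  have e2 : α*β*γ*q^(i+n+2) = (ε*δ*q^j*q^(i+(j+n+1)))⁻¹ := by
    have B := G.bal
    rw [← hij, show 2*(i+j+n)+3 = (i+n+2)+(j+(i+(j+n+1))) by ring, pow_add, pow_add q j] at B
    rw [← one_div, eq_div_iff (by positivity)]
    linear_combination B
  rw [e1, e2]
  rw [show q*(ε*δ*q^j) = ε*δ*q^(j+1) by ring, show i+(j+n+1)=L+y+1 by omega] at RE
  rw [show i+(j+n+1)=L+y+1 by omega]
  have z1 : Ψ q (ε*δ*q^(j+1)) (L+y+1) ≠ 0 := pne2 G.g04 _ _ ø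
  have z2 : Ψ q q (i+n) ≠ 0 := G.pq _ ø
  have z3 : Ψ q (q*ε) y ≠ 0 := pne G.g0 _ ø
  have z4 : Ψ q (q*β) x ≠ 0 := pne G.g2 _ ø
  have z5 : Ψ q (q*δ) j ≠ 0 := pne G.g4 _ ø
  have z6 : Ψ q (q*γ) i ≠ 0 := pne G.g3 _ ø
  have z7 : Ψ q q i ≠ 0 := G.pq _ ø
  have z8 : Ψ q q j ≠ 0 := G.pq _ ø
  have z9 : Ψ q (β*γ*q^(i+1)) (i+n+1) ≠ 0 := pne2 G.g23 _ _ ø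
  have z10 : Ψ q (α*β*q) (L+1) ≠ 0 := by simpa using pne2 G.g12 (L+1) 0 ø
  have z11 : (s*t2)^((i:ℤ)-n) ≠ 0 := zpow_ne_zero _ (mul_ne_zero H.hs H.h2)
  have z13 : γ^j ≠ 0 := pow_ne_zero _ G.h3
  generalize (-1:ℂ)^i * s^(2*i*n+i*(i+1)) = mA at *
  generalize (-(ε*δ*q^j))^i * s^(2*i*(j+n+1)+i*(i+1)) = mE at *
  generalize (s*t2)^((i:ℤ)-n) = P2 at *
  generalize (s*t0)^(((L+y:ℕ):ℤ)-2*j) = P3 at *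
  generalize (s*t2)^L = P4 at *
  generalize γ^j = P7 at *
  generalize Ψ q (ε*δ*q^j*q^(L+y+1))⁻¹ i = R5 at *
  rw [← RE] at z1 ⊢
  rw [← RA] at z2 ⊢
  clear RA RE e1 e2
  generalize Ψ q (q^(i+n))⁻¹ i = R1 at *
  generalize Ψ q (ε*δ*q^(j+1)) (j+n+1) = R2 at *
  generalize 1-ε*δ*q^(2*j+1) = B1
  generalize 1-β*γ*q^(2*i+1) = B2
  generalize Ψ q q n = A1 at *
  generalize Ψ q (q*ε) y = A2 at *
  generalize Ψ q (q*β) x = A3 at *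
  generalize Ψ q (q*δ) j = A4 at *
  generalize Ψ q (q*γ) i = A5 at *
  generalize Ψ q q i = A6 at *
  generalize Ψ q q j = A7 at *
  generalize Ψ q (β*γ*q^(i+1)) (i+n+1) = A8 at *
  generalize Ψ q (α*β*q) (L+1) = A9 at *
  generalize Ψ q (q*ε) j = D1
  generalize Ψ q (q*β) i = D2
  generalize Ψ q (q*γ) (L+y) = D3
  generalize Ψ q (q*δ) L = D4
  generalize Ψ q (q*α) n = D5
  simp only [mul_ne_zero_iff] at z1 z2
  obtain ⟨⟨_,_⟩,_⟩ := z1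
  obtain ⟨⟨_,_⟩,_⟩ := z2
  clear hq hc0 hc4 G H Q
  field_simp
/-- monomial from reversing a q-Pochhammer symbol's base -/
def pv (s z : ℂ) (k : ℕ) : ℂ := ((-z)^k)⁻¹ * (s^((k:ℤ)*(k-1)))⁻¹
lemma mono2 {s t0 t1 t2 t3 t4 : ℂ} (H : NZ s t0 t1 t2 t3 t4) (L y i j x n : ℕ) (hij : i+j+n=L+y)
   (hb : s^(2*((L+y:ℕ):ℤ)+3)*t0*t1*t2*t3*t4 = 1) (E S T0 T1 T2 T3 T4 : ℂ)
   (hE : E = -1) (hS : S = s) (h0 : T0 = t0) (h1 : T1 = t1) (h2 : T2 = t2) (h3 : T3 = t3) (h4 : T4 = t4) :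
   (S*T2)^L*(S*T0)^(((L+y:ℕ):ℤ)-2*j)*((T3^2)^j)⁻¹*((S*T2)^((i:ℤ)-n))⁻¹*(E^i*S^(2*i*n+i*(i+1)))/((-(T0^2*T4^2*(S^2)^j))^i*S^(2*i*(j+n+1)+i*(i+1)))
    * (((T1^2*S^2)^(L+y))⁻¹*(T0^2*T2^2*T3^2*S^2)^i*(T0^2*T3^2*T4^2*S^2)^j*((T2^2*T4^2*(S^2)^(2*(L+y)))^y)⁻¹*(S^((y:ℤ)*((y:ℤ)-1)))^2*(S^2)^(i*j+i^2+j^2))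
   = ((T0/T1)^i*(T3/T1)^j*(T1/T0)^x*(T1/T4)^y*((T3/T2)^i*(T4/T0)^j/((T4/T2)^x*(T3/T0)^y))
     *(E^y*(T1*T3*T0/T2)^y*S^((y:ℤ)*((y:ℤ)+1))/(E^x*(T2*T4*T1/T0)^x*S^((x:ℤ)*((x:ℤ)+1))))
     *(E^(L+y)*(S*T1*T2*T4)^(L+y)*S^(((L+y:ℕ):ℤ)*(((L+y:ℕ):ℤ)+1))))
   * ((S⁻¹*T4⁻¹)^L*(S⁻¹*T3⁻¹)^(((L+y:ℕ):ℤ)-2*i)*(((T0^2)⁻¹)^i)⁻¹*((S⁻¹*T4⁻¹)^((j:ℤ)-n))⁻¹*(E^j*(S⁻¹)^(2*j*n+j*(j+1)))/((-((T3^2)⁻¹*(T2^2)⁻¹*((S^2)⁻¹)^i))^j*(S⁻¹)^(2*j*(i+n+1)+j*(j+1))))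
   * ((-(T0^2*T4^2*(S^2)^(2*j+1)))⁻¹*(-(T2^2*T3^2*(S^2)^(2*i+1)))⁻¹*pv S (S^2*T1^2) n)
   /(pv S (S^2) j*pv S (S^2) i*pv S (T0^2*T4^2*(S^2)^(j+1)) (j+n+1)*pv S (T2^2*T3^2*(S^2)^(i+1)) (i+n+1)*pv S (S^2*T0^2) j*pv S (S^2*T2^2) i*pv S (S^2*T4^2) x*pv S (S^2*T3^2) y) := by
  rw [mn_m1 s t0 t1 t2 t3 t4] at hE
  rw [mn_s s t0 t1 t2 t3 t4] at hS
  rw [mn_t0 s t0 t1 t2 t3 t4] at h0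
  rw [mn_t1 s t0 t1 t2 t3 t4] at h1
  rw [mn_t2 s t0 t1 t2 t3 t4] at h2
  rw [mn_t3 s t0 t1 t2 t3 t4] at h3
  rw [mn_t4 s t0 t1 t2 t3 t4] at h4
  rw [hE, hS, h0, h1, h2, h3, h4]
  unfold pv
  simp only [div_eq_mul_inv, mn_neg, mn_mul H, mn_inv, mn_pow, mn_zpow]
  have hn : (n:ℤ) = L+y-i-j := by omega
  apply mn_eq H _ hb (-((L:ℤ)+y)-i-j-2*y) (-(y+(L+y)+i+j)) <;> push_cast <;> rw [hn] <;> ring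
lemma poch_inv' (q s z w : ℂ) (hs : s ≠ 0) (hq : q = s^2) (hz : z ≠ 0) (hw : w = z⁻¹) (k : ℕ) :
   Ψ q⁻¹ w k = Ψ q z k * pv s z k := by
  rw [hw, poch_inv q s z hs hq hz, pv]; ring
lemma om_inv' (z w : ℂ) (hz : z ≠ 0) (hw : w = z⁻¹) : 1 - w = (1-z)*(-z)⁻¹ := by
  rw [hw]; field_simp; ring
lemma pv_ne (s z : ℂ) (k : ℕ) (hs : s ≠ 0) (hz : z ≠ 0) : pv s z k ≠ 0 := by
  unfold pv
  have := zpow_ne_zero ((k:ℤ)*(k-1)) hs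
  have := pow_ne_zero k (neg_ne_zero.2 hz)
  positivity
lemma scal {q s ε α β γ δ t0 t1 t2 t3 t4 : ℂ} (L y i j x n : ℕ) (hx : x ≤ L) (hij : i + j + n = L+y) (G : Gen q ε α β γ δ (L+y)) (H : NZ s t0 t1 t2 t3 t4)
   (Q : Sq q s ε α β γ δ t0 t1 t2 t3 t4) (hb : s^(2*((L+y:ℕ):ℤ)+3)*t0*t1*t2*t3*t4 = 1) :
   Wf q s ε α β γ δ t0 t2 L y i j x n * kap q ε α β γ δ (L+y) y i j
   = ((t0 / t1) ^ i * (t3 / t1) ^ j * (t1 / t0) ^ x * (t1 / t4) ^ y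
          * (qR.xi q β γ t2 t3 (i : ℤ) * qR.xi q ε δ t0 t4 (j : ℤ)
              / (qR.xi q β δ t2 t4 (x : ℤ) * qR.xi q ε γ t0 t3 (y : ℤ)))
          * (qR.om q (t1 * t3 * t0 / t2) (y : ℤ) / qR.om q (t2 * t4 * t1 / t0) (x : ℤ))
          * qR.om q (s * t1 * t2 * t4) ((L+y:ℕ) : ℤ))
    * Wf q⁻¹ s⁻¹ γ⁻¹ α⁻¹ δ⁻¹ ε⁻¹ β⁻¹ t3⁻¹ t4⁻¹ L y j i x n := by
  have hq := G.hq
  have hc0 := G.h0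
  have hc1 := G.h1
  have hc2 := G.h2
  have hc3 := G.h3
  have hc4 := G.h4
  have M := mono2 H L y i j x n hij hb (-1) s t0 t1 t2 t3 t4 rfl rfl rfl rfl rfl rfl rfl
  rw [← Q.h0, ← Q.h1, ← Q.h2, ← Q.h3, ← Q.h4, ← Q.hq] at M
  have ey : q^(y*(y-1)) = (s^((y:ℤ)*((y:ℤ)-1)))^2 := by
    rw [← q_tri q s Q.hq, ← pow_mul, Nat.div_mul_cancel (Nat.even_mul_pred_self y).two_dvd]
  unfold Wf mW kap xi
  rw [om_eq q s _ Q.hq, om_eq q s _ Q.hq, om_eq q s _ Q.hq, ey]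
  simp only [Int.toNat_natCast, zpow_natCast]
  rw [om_inv' (ε*δ*q^(2*j+1)) (δ⁻¹*ε⁻¹*q⁻¹^(2*j+1)) (by positivity) (by simp [mul_inv]; ring),
    om_inv' (β*γ*q^(2*i+1)) (γ⁻¹*β⁻¹*q⁻¹^(2*i+1)) (by positivity) (by simp [mul_inv]; ring),
    poch_inv' q s (q*α) (q⁻¹*α⁻¹) H.hs Q.hq (by positivity) (by simp [mul_inv]; ring),
    poch_inv' q s q q⁻¹ H.hs Q.hq hq rfl, poch_inv' q s q q⁻¹ H.hs Q.hq hq rfl,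
    poch_inv' q s (ε*δ*q^(j+1)) (δ⁻¹*ε⁻¹*q⁻¹^(j+1)) H.hs Q.hq (by positivity) (by simp [mul_inv]; ring),
    poch_inv' q s (β*γ*q^(i+1)) (γ⁻¹*β⁻¹*q⁻¹^(i+1)) H.hs Q.hq (by positivity) (by simp [mul_inv]; ring),
    poch_inv' q s (q*ε) (q⁻¹*ε⁻¹) H.hs Q.hq (by positivity) (by simp [mul_inv]; ring),
    poch_inv' q s (q*β) (q⁻¹*β⁻¹) H.hs Q.hq (by positivity) (by simp [mul_inv]; ring),
    poch_inv' q s (q*δ) (q⁻¹*δ⁻¹) H.hs Q.hq (by positivity) (by simp [mul_inv]; ring),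
    poch_inv' q s (q*γ) (q⁻¹*γ⁻¹) H.hs Q.hq (by positivity) (by simp [mul_inv]; ring)]
  have n1 : Ψ q (q*ε) y ≠ 0 := pne G.g0 _ ø
  have n2 : Ψ q (q*ε) j ≠ 0 := pne G.g0 _ ø
  have n3 : Ψ q (q*β) i ≠ 0 := pne G.g2 _ ø
  have n4 : Ψ q (q*β) x ≠ 0 := pne G.g2 _ ø
  have n5 : Ψ q (q*δ) x ≠ 0 := pne G.g4 _ ø
  have n6 : Ψ q (q*δ) j ≠ 0 := pne G.g4 _ ø
  have n7 : Ψ q (q*γ) i ≠ 0 := pne G.g3 _ ø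
  have n8 : Ψ q (q*γ) y ≠ 0 := pne G.g3 _ ø
  have n9 : Ψ q q i ≠ 0 := G.pq _ ø
  have n10 : Ψ q q j ≠ 0 := G.pq _ ø
  have n11 : Ψ q (β*γ*q^(i+1)) (i+n+1) ≠ 0 := pne2 G.g23 _ _ ø
  have n12 : Ψ q (ε*δ*q^(j+1)) (j+n+1) ≠ 0 := pne2 G.g04 _ _ ø
  generalize Ψ q (q*ε) y = A1 at *
  generalize Ψ q (q*ε) j = A2 at *
  generalize Ψ q (q*β) i = A3 at *
  generalize Ψ q (q*β) x = A4 at *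
  generalize Ψ q (q*δ) x = A5 at *
  generalize Ψ q (q*δ) j = A6 at *
  generalize Ψ q (q*γ) i = A7 at *
  generalize Ψ q (q*γ) y = A8 at *
  generalize Ψ q q i = A9 at *
  generalize Ψ q q j = B1 at *
  generalize Ψ q (β*γ*q^(i+1)) (i+n+1) = B2 at *
  generalize Ψ q (ε*δ*q^(j+1)) (j+n+1) = B3 at *
  generalize Ψ q (q*α) n = B4
  generalize 1-ε*δ*q^(2*j+1) = B5
  generalize 1-β*γ*q^(2*i+1) = B6
  have g1 : pv s q j ≠ 0 := pv_ne _ _ _ H.hs hq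
  have g2 : pv s q i ≠ 0 := pv_ne _ _ _ H.hs hq
  have g3 : pv s (ε*δ*q^(j+1)) (j+n+1) ≠ 0 := pv_ne _ _ _ H.hs (by positivity)
  have g4 : pv s (β*γ*q^(i+1)) (i+n+1) ≠ 0 := pv_ne _ _ _ H.hs (by positivity)
  have g5 : pv s (q*ε) j ≠ 0 := pv_ne _ _ _ H.hs (by positivity)
  have g6 : pv s (q*β) i ≠ 0 := pv_ne _ _ _ H.hs (by positivity)
  have g7 : pv s (q*δ) x ≠ 0 := pv_ne _ _ _ H.hs (by positivity)
  have g8 : pv s (q*γ) y ≠ 0 := pv_ne _ _ _ H.hs (by positivity)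
  generalize pv s q j = p1 at *
  generalize pv s q i = p2 at *
  generalize pv s (ε*δ*q^(j+1)) (j+n+1) = p3 at *
  generalize pv s (β*γ*q^(i+1)) (i+n+1) = p4 at *
  generalize pv s (q*ε) j = p5 at *
  generalize pv s (q*β) i = p6 at *
  generalize pv s (q*δ) x = p7 at *
  generalize pv s (q*γ) y = p8 at *
  generalize pv s (q*α) n = p9 at *
  generalize (-(ε*δ*q^(2*j+1)))⁻¹ = o1 at *
  generalize (-(β*γ*q^(2*i+1)))⁻¹ = o2 at *
  generalize (s*t2)^L*(s*t0)^(((L+y:ℕ):ℤ)-2*j)*(γ^j)⁻¹*((s*t2)^((i:ℤ)-n))⁻¹*((-1)^i*s^(2*i*n+i*(i+1)))/((-(ε*δ*q^j))^i*s^(2*i*(j+n+1)+i*(i+1))) = V at *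
  generalize (s⁻¹*t4⁻¹)^L*(s⁻¹*t3⁻¹)^(((L+y:ℕ):ℤ)-2*i)*((ε⁻¹)^i)⁻¹*((s⁻¹*t4⁻¹)^((j:ℤ)-n))⁻¹*((-1)^j*(s⁻¹)^(2*j*n+j*(j+1)))/((-(γ⁻¹*β⁻¹*(q⁻¹)^i))^j*(s⁻¹)^(2*j*(i+n+1)+j*(j+1))) = Vh at *
  generalize (((α*q)^(L+y))⁻¹*(ε*β*γ*q)^i*(ε*γ*δ*q)^j*((β*δ*q^(2*(L+y)))^y)⁻¹*(s^((y:ℤ)*((y:ℤ)-1)))^2*q^(i*j+i^2+j^2)) = K at *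
  generalize ((-1)^y*(t1*t3*t0/t2)^y*s^((y:ℤ)*((y:ℤ)+1))/((-1)^x*(t2*t4*t1/t0)^x*s^((x:ℤ)*((x:ℤ)+1)))) = O1 at *
  generalize ((-1)^(L+y)*(s*t1*t2*t4)^(L+y)*s^(((L+y:ℕ):ℤ)*(((L+y:ℕ):ℤ)+1))) = O2 at *
  generalize (t0 / t1) ^ i * (t3 / t1) ^ j * (t1 / t0) ^ x * (t1 / t4) ^ y = O3 at *
  have y1 : (t3/t2)^i ≠ 0 := pow_ne_zero _ (div_ne_zero H.h3 H.h2)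
  have y2 : (t4/t0)^j ≠ 0 := pow_ne_zero _ (div_ne_zero H.h4 H.h0)
  have y3 : (t4/t2)^x ≠ 0 := pow_ne_zero _ (div_ne_zero H.h4 H.h2)
  have y4 : (t3/t0)^y ≠ 0 := pow_ne_zero _ (div_ne_zero H.h3 H.h0)
  generalize (t3/t2)^i = q1 at *
  generalize (t4/t0)^j = q2 at *
  generalize (t4/t2)^x = q3 at *
  generalize (t3/t0)^y = q4 at *
  clear ey hb Q H G hc0 hc1 hc2 hc3 hc4 hq
  field_simp at M ⊢
  linear_combination (B4*B5*B6)*M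
end gs

/-- Second symmetry relation of the Griffiths polynomials of q-Racah type
(exchange of the two degrees). -/
theorem griffiths_symmetry_degrees
    (N : ℕ) (q s c1 c2 c3 c4 c0 t1 t2 t3 t4 t0 : ℂ)
    (hq : q ≠ 0) (hc1 : c1 ≠ 0) (hc2 : c2 ≠ 0) (hc3 : c3 ≠ 0) (hc4 : c4 ≠ 0)
    (hs : s ^ 2 = q) (ht1 : t1 ^ 2 = c1) (ht2 : t2 ^ 2 = c2) (ht3 : t3 ^ 2 = c3)
    (ht4 : t4 ^ 2 = c4)
    (hc0 : c0 = (q ^ (2 * (N : ℤ) + 3) * c1 * c2 * c3 * c4)⁻¹)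
    (ht0 : t0 = (s ^ (2 * (N : ℤ) + 3) * t1 * t2 * t3 * t4)⁻¹)
    (hgen : ∀ e0 e1 e2 e3 e4 : ℕ, e0 ≤ 1 → e1 ≤ 1 → e2 ≤ 1 → e3 ≤ 1 → e4 ≤ 1 →
      1 ≤ e0 + e1 + e2 + e3 + e4 → e0 + e1 + e2 + e3 + e4 ≤ 4 →
      ∀ k : ℤ, 1 ≤ k → k ≤ 2 * (N : ℤ) + 5 →
        c0 ^ e0 * c1 ^ e1 * c2 ^ e2 * c3 ^ e3 * c4 ^ e4 ≠ q ^ (-k))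
    (hq1 : ∀ k : ℕ, 1 ≤ k → k ≤ N → q ^ k ≠ 1)
    (i j x y : ℕ) (hij : i + j ≤ N) (hxy : x + y ≤ N) :
    qR.G q s c1 c2 c3 c4 t1 t2 t3 t4 (N : ℤ) (i : ℤ) (j : ℤ) (x : ℤ) (y : ℤ)
      = (t0 / t1) ^ i * (t3 / t1) ^ j * (t1 / t0) ^ x * (t1 / t4) ^ y
          * (qR.xi q c2 c3 t2 t3 (i : ℤ) * qR.xi q c0 c4 t0 t4 (j : ℤ)
              / (qR.xi q c2 c4 t2 t4 (x : ℤ) * qR.xi q c0 c3 t0 t3 (y : ℤ)))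
          * (qR.om q (t1 * t3 * t0 / t2) (y : ℤ) / qR.om q (t2 * t4 * t1 / t0) (x : ℤ))
          * qR.om q (s * t1 * t2 * t4) (N : ℤ)
          * qR.G q⁻¹ s⁻¹ c1⁻¹ c4⁻¹ c0⁻¹ c2⁻¹ t1⁻¹ t4⁻¹ t0⁻¹ t2⁻¹
              (N : ℤ) (j : ℤ) (i : ℤ) (x : ℤ) (y : ℤ) := by
  have hs0 : s ≠ 0 := by rintro rfl; apply hq; rw [← hs]; norm_num
  have h1 : t1 ≠ 0 := by rintro rfl; apply hc1; rw [← ht1]; norm_num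
  have h2 : t2 ≠ 0 := by rintro rfl; apply hc2; rw [← ht2]; norm_num
  have h3 : t3 ≠ 0 := by rintro rfl; apply hc3; rw [← ht3]; norm_num
  have h4 : t4 ≠ 0 := by rintro rfl; apply hc4; rw [← ht4]; norm_num
  have hsz : s ^ (2 * (N : ℤ) + 3) ≠ 0 := zpow_ne_zero _ hs0
  have hqz : q ^ (2 * (N : ℤ) + 3) ≠ 0 := zpow_ne_zero _ hq
  have h0 : t0 ≠ 0 := by rw [ht0]; positivity
  have hc00 : c0 ≠ 0 := by rw [hc0]; positivity
  have hsq : q ^ (2 * (N : ℤ) + 3) = (s ^ (2 * (N : ℤ) + 3))^2 := by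
    rw [← hs, ← zpow_natCast s 2, ← zpow_natCast, ← zpow_mul, ← zpow_mul]; congr 1; push_cast; ring
  have hb : s ^ (2 * (N : ℤ) + 3)*t0*t1*t2*t3*t4 = 1 := by rw [ht0]; field_simp
  have hbq : q ^ (2 * (N : ℤ) + 3)*c0*c1*c2*c3*c4 = 1 := by rw [hc0]; field_simp
  have hc0t : c0 = t0^2 := by rw [hc0, ht0, ← ht1, ← ht2, ← ht3, ← ht4, hsq]; field_simp
  have Ge : gs.Gen q c0 c1 c2 c3 c4 N := by
    refine ⟨hq, hc00, hc1, hc2, hc3, hc4, ?_, ?_, ?_⟩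
    · rw [show q ^ (2 * (N : ℤ) + 3) = q^(2*N+3) by norm_cast] at hbq
      linear_combination hbq
    · intro e0 e1 e2 e3 e4 a0 a1 a2 a3 a4 b1 b2 k k1 k2 hk
      apply hgen e0 e1 e2 e3 e4 a0 a1 a2 a3 a4 b1 b2 k (by omega) (by omega)
      rw [zpow_neg, zpow_natCast]
      have := pow_ne_zero k hq
      field_simp
      linear_combination -hk
    · intro k k1 k2 hk
      apply hq1 k k1 k2
      linear_combination -hk
  have H : gs.NZ s t0 t1 t2 t3 t4 := ⟨hs0, h0, h1, h2, h3, h4⟩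
  have Q : gs.Sq q s c0 c1 c2 c3 c4 t0 t1 t2 t3 t4 := ⟨hs.symm, hc0t, ht1.symm, ht2.symm, ht3.symm, ht4.symm⟩
  have H' : gs.NZ s⁻¹ t3⁻¹ t1⁻¹ t4⁻¹ t0⁻¹ t2⁻¹ :=
    ⟨inv_ne_zero hs0, inv_ne_zero h3, inv_ne_zero h1, inv_ne_zero h4, inv_ne_zero h0, inv_ne_zero h2⟩
  have Q' : gs.Sq q⁻¹ s⁻¹ c3⁻¹ c1⁻¹ c4⁻¹ c0⁻¹ c2⁻¹ t3⁻¹ t1⁻¹ t4⁻¹ t0⁻¹ t2⁻¹ := by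
    constructor <;> rw [inv_pow] <;> congr 1
    exacts [hs.symm, ht3.symm, ht1.symm, ht4.symm, ht2.symm]
  obtain ⟨L, hL⟩ : ∃ L, L + y = N := ⟨N - y, by omega⟩
  obtain ⟨n, hn⟩ : ∃ n, i + j + n = N := ⟨N - i - j, by omega⟩
  have hx : x ≤ L := by omega
  have C := gs.main_cl N q c0 c1 c2 c3 c4 Ge L y i j x hL hx
  rw [gs.G_eq N L y i j x n hL hx hn Ge H Q hc0 ht0,
    gs.G_eq (ε := c3⁻¹) (t0 := t3⁻¹) N L y j i x n hL hx (by omega) Ge.hat H' Q' (by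
      rw [inv_zpow]; congr 1
      rw [← mul_inv, ← mul_inv, ← mul_inv, ← mul_inv, ← one_div, eq_div_iff (by positivity)]
      linear_combination hbq) (by
      rw [inv_zpow]; congr 1
      rw [← mul_inv, ← mul_inv, ← mul_inv, ← mul_inv, ← one_div, eq_div_iff (by positivity)]
      linear_combination hb)]
  subst hL
  rw [gs.W_eq L y i j x n hx hn Ge H Q, gs.W_eq L y j i x n hx (by omega) Ge.hat H' Q']
  have S := gs.scal L y i j x n hx hn Ge H Q hb
  unfold gs.FF at C
  rw [mul_assoc (gs.Wf _ _ _ _ _ _ _ _ _ _ _ _ _ _ _), C, ← mul_assoc, S]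
  ring
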